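/- Let Λ be a weight vector on ℝ^n and let p : ℝ^n → ℂ be a smooth function satisfying, for every multi-index α, |∂^α p(ξ)| ≤ c_α Λ(ξ)^{-α} for all ξ ∈ ℝ^n (zero-order global multiplier). Then for every 1 < q < ∞ there exists a constant C > 0 such that ‖F^{-1}(p·û)‖_{L^q(ℝ^n)} ≤ C ‖u‖_{L^q(ℝ^n)} for every Schwartz function u on ℝ^n, where F^{-1} denotes the inverse Fourier transform and û the Fourier transform of u. -/

import Mathlib

open scoped BigOperators RealInnerProductSpace
open MeasureTheory

noncomputable section

abbrev Euc (n : ℕ) := EuclideanSpace ℝ (Fin n)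

/-- The Japanese bracket `⟨ξ⟩ = (1+|ξ|²)^{1/2}`. -/
def jb {n : ℕ} (ξ : Euc n) : ℝ := Real.sqrt (1 + ‖ξ‖ ^ 2)

variable {n : ℕ} {F : Type*} [NormedAddCommGroup F] [NormedSpace ℝ F]

/-- Partial derivative in direction `j`. -/
def pd (j : Fin n) (f : Euc n → F) : Euc n → F :=
  fun ξ => fderiv ℝ f ξ (EuclideanSpace.single j 1)

/-- Iterated partial derivative `∂^α`. -/
def mpd (α : Fin n → ℕ) (f : Euc n → F) : Euc n → F :=
  (List.finRange n).foldr (fun j g => (pd j)^[α j] g) f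

/-- Partial derivative in the `x` variable of a symbol. -/
def xpd (j : Fin n) (a : Euc n → Euc n → F) : Euc n → Euc n → F :=
  fun x ξ => fderiv ℝ (fun y => a y ξ) x (EuclideanSpace.single j 1)

/-- Iterated `x`-derivative `∂_x^β` of a symbol. -/
def xmpd (β : Fin n → ℕ) (a : Euc n → Euc n → F) : Euc n → Euc n → F :=
  (List.finRange n).foldr (fun j g => (xpd j)^[β j] g) a

/-- The mixed derivative `∂_ξ^α ∂_x^β a`. -/
def smpd (α β : Fin n → ℕ) (a : Euc n → Euc n → F) : Euc n → Euc n → F :=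
  fun x ξ => mpd α (xmpd β a x) ξ

/-- `Λ = (λ_1,…,λ_n)` is a weight vector: positive continuous components satisfying
the polynomial growth (PG), (M) and slowly varying (SW) conditions. -/
def IsWeightVector (Λ : Fin n → Euc n → ℝ) : Prop :=
  (∀ j, Continuous (Λ j)) ∧ (∀ j ξ, 0 < Λ j ξ) ∧
  ∃ C c : ℝ, 0 < C ∧ 0 < c ∧
    (∀ j ξ, c * jb ξ ^ c ≤ Λ j ξ ∧ Λ j ξ ≤ C * jb ξ ^ C) ∧
    (∀ j (ξ : Euc n), c * |ξ j| ≤ Λ j ξ) ∧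
    (∀ ξ η : Euc n, ∑ k, |ξ k - η k| * (Λ k η)⁻¹ ≤ c →
      ∀ j, C⁻¹ * Λ j ξ ≤ Λ j η ∧ Λ j η ≤ C * Λ j ξ)

/-- `m` is an admissible weight associated to the weight vector `Λ`:
positive, continuous, temperate and slowly varying (SW1). -/
def IsAdmissible (Λ : Fin n → Euc n → ℝ) (m : Euc n → ℝ) : Prop :=
  Continuous m ∧ (∀ ξ, 0 < m ξ) ∧
  ∃ N C c : ℝ, 0 < N ∧ 0 < C ∧ 0 < c ∧
    (∀ ξ η : Euc n, m η ≤ C * m ξ * (1 + ‖η - ξ‖) ^ N) ∧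
    (∀ ξ η : Euc n, ∑ k, |ξ k - η k| * (Λ k η)⁻¹ ≤ c →
      C⁻¹ * m ξ ≤ m η ∧ m η ≤ C * m ξ)

/-- The symbol class `S_{m,Λ}(Ω)`. -/
def IsSymbol (Ω : Set (Euc n)) (m : Euc n → ℝ) (Λ : Fin n → Euc n → ℝ)
    (a : Euc n → Euc n → ℂ) : Prop :=
  ContDiffOn ℝ (⊤ : ℕ∞) (fun p : Euc n × Euc n => a p.1 p.2) (Ω ×ˢ Set.univ) ∧
  ∀ K : Set (Euc n), IsCompact K → K ⊆ Ω → ∀ α β : Fin n → ℕ,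
    ∃ c > 0, ∀ x ∈ K, ∀ ξ, ‖smpd α β a x ξ‖ ≤ c * m ξ * (∏ k, Λ k ξ ^ α k)⁻¹

/-- The regularizing class `S^{-∞}(Ω)`. -/
def IsSmoothing (Ω : Set (Euc n)) (a : Euc n → Euc n → ℂ) : Prop :=
  ContDiffOn ℝ (⊤ : ℕ∞) (fun p : Euc n × Euc n => a p.1 p.2) (Ω ×ˢ Set.univ) ∧
  ∀ K : Set (Euc n), IsCompact K → K ⊆ Ω → ∀ (μ : ℝ) (α β : Fin n → ℕ),
    ∃ c > 0, ∀ x ∈ K, ∀ ξ, ‖smpd α β a x ξ‖ ≤ c * jb ξ ^ (μ - ∑ k, (α k : ℝ))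

/-- The `Λ`-neighborhood `X_{εΛ}` of a set `X ⊆ ℝ^n`. -/
def lamNbhd (Λ : Fin n → Euc n → ℝ) (ε : ℝ) (X : Set (Euc n)) : Set (Euc n) :=
  ⋃ ξ0 ∈ X, {ξ : Euc n | ∀ j, |ξ j - ξ0 j| < ε * Λ j ξ0}


/-- The Fourier multiplier `u ↦ F⁻¹(p·û)`, with
`û(ξ) = ∫ e^{-ix·ξ} u(x) dx` and `F⁻¹g(x) = (2π)^{-n} ∫ e^{ix·ξ} g(ξ) dξ`. -/
def fourierMult {n : ℕ} (p : Euc n → ℂ) (u : Euc n → ℂ) : Euc n → ℂ :=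
  fun x => (((2 * Real.pi) ^ n : ℝ)⁻¹ : ℂ) *
    ∫ ξ : Euc n, Complex.exp (Complex.I * (⟪x, ξ⟫ : ℝ)) * p ξ *
      ∫ y : Euc n, Complex.exp (-(Complex.I * (⟪y, ξ⟫ : ℝ))) * u y


section JensenGap

/-- Cauchy–Schwarz for real integrals. -/
lemma cs_integral {Ω : Type*} [MeasurableSpace Ω] {μ : Measure Ω} {A B : Ω → ℝ}
    (hA : Integrable (fun x => A x ^ 2) μ) (hB : Integrable (fun x => B x ^ 2) μ)
    (hAB : Integrable (fun x => A x * B x) μ) :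
    (∫ x, A x * B x ∂μ) ^ 2 ≤ (∫ x, A x ^ 2 ∂μ) * ∫ x, B x ^ 2 ∂μ := by
  have key : ∀ t : ℝ, 0 ≤ (∫ x, A x ^ 2 ∂μ) * (t * t) + (2 * ∫ x, A x * B x ∂μ) * t
      + ∫ x, B x ^ 2 ∂μ := by
    intro t
    have h : ∫ x, (t * A x + B x) ^ 2 ∂μ = (∫ x, A x ^ 2 ∂μ) * (t * t)
        + (2 * ∫ x, A x * B x ∂μ) * t + ∫ x, B x ^ 2 ∂μ := by
      have e : ∀ x, (t * A x + B x) ^ 2 = (t * t) * A x ^ 2 + (2 * t) * (A x * B x) + B x ^ 2 := by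
        intro x; ring
      simp_rw [e]
      rw [integral_add ((hA.const_mul _).fun_add (hAB.const_mul _)) hB,
        integral_add (hA.const_mul _) (hAB.const_mul _), integral_const_mul, integral_const_mul]
      ring
    rw [← h]
    exact integral_nonneg fun x => sq_nonneg _
  have := discrim_le_zero key
  unfold discrim at this
  nlinarith

lemma beta_ineq {a y : ℝ} (ha : 1 / 2 ≤ a) (ha1 : a < 1) (hy : 0 < y) :
    (y ^ a - 1) ^ 2 ≤ (2 / (1 - a)) * (1 + a * (y - 1) - y ^ a) * (1 + y) := by
  have h1 : (1 - a) * (1 - √y) ^ 2 ≤ 1 + a * (y - 1) - y ^ a := by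
    have hg := Real.geom_mean_le_arith_mean2_weighted (w₁ := 2 * a - 1) (w₂ := 2 * (1 - a))
      (p₁ := y) (p₂ := √y) (by linarith) (by linarith) hy.le (Real.sqrt_nonneg y) (by ring)
    have : y ^ (2 * a - 1) * √y ^ (2 * (1 - a)) = y ^ a := by
      rw [Real.sqrt_eq_rpow, ← Real.rpow_mul hy.le, ← Real.rpow_add hy]
      congr 1; ring
    rw [this] at hg
    nlinarith [Real.sq_sqrt hy.le]
  have h2 : (y ^ a - 1) ^ 2 ≤ (y - 1) ^ 2 := by
    rcases le_total y 1 with h | h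
    · have : y ≤ y ^ a := by
        conv_lhs => rw [← Real.rpow_one y]
        exact Real.rpow_le_rpow_of_exponent_ge hy h ha1.le
      have h3 : y ^ a ≤ 1 := Real.rpow_le_one hy.le h (by linarith)
      nlinarith
    · have : y ^ a ≤ y := by
        conv_rhs => rw [← Real.rpow_one y]
        exact Real.rpow_le_rpow_of_exponent_le h ha1.le
      have h3 : 1 ≤ y ^ a := Real.one_le_rpow h (by linarith)
      nlinarith
  have h3 : (y - 1) ^ 2 ≤ 2 * (1 - √y) ^ 2 * (1 + y) := by
    have e : y = √y ^ 2 := (Real.sq_sqrt hy.le).symm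
    have : (y - 1) ^ 2 = (1 - √y) ^ 2 * (1 + √y) ^ 2 := by
      conv_lhs => rw [e]
      ring
    rw [this]
    have : (1 + √y) ^ 2 ≤ 2 * (1 + y) := by nlinarith [sq_nonneg (1 - √y)]
    nlinarith [sq_nonneg (1 - √y)]
  have h4 : 0 < 1 - a := by linarith
  have h5 : (1 - √y) ^ 2 ≤ (1 + a * (y - 1) - y ^ a) / (1 - a) := by
    rw [le_div_iff₀ h4]; linarith
  calc _ ≤ _ := h2
    _ ≤ _ := h3
    _ ≤ 2 * ((1 + a * (y - 1) - y ^ a) / (1 - a)) * (1 + y) := by gcongr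
    _ = _ := by ring

set_option maxHeartbeats 1600000 in
lemma jensen_gap {Ω : Type*} [MeasurableSpace Ω] (γ : Measure Ω) [IsProbabilityMeasure γ]
    {X : Ω → ℂ} {Y m : Ω → ℝ} (hX : Measurable X) (hY : Measurable Y) (hm : Measurable m)
    {R ε N M a : ℝ} (hXR : ∀ x, ‖X x‖ ≤ R) (hε : 0 < ε) (hYε : ∀ x, ε ≤ Y x) (hYN : ∀ x, Y x ≤ N)
    (hmM : ∀ x, |m x| ≤ M) (ha : 1 / 2 ≤ a) (ha1 : a < 1) :
    ‖∫ x, (m x : ℂ) * (X x - ∫ x, X x ∂γ) ∂γ‖ ^ 2 * (∫ x, Y x ∂γ) ^ (-a) ≤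
      (8 * M ^ 2 / (1 - a)) * ((∫ x, ‖X x‖ ^ 2 * (Y x) ^ (-a) ∂γ) -
        ‖∫ x, X x ∂γ‖ ^ 2 * (∫ x, Y x ∂γ) ^ (-a)) := by
  have ha0 : 0 < a := by linarith
  have hne : Nonempty Ω := by
    by_contra h
    rw [not_nonempty_iff] at h
    have := measure_univ (μ := γ)
    rw [Set.univ_eq_empty_iff.mpr h] at this
    simp at this
  obtain ⟨ω⟩ := hne
  have hM0 : 0 ≤ M := (abs_nonneg _).trans (hmM ω)
  have hR0 : 0 ≤ R := (norm_nonneg _).trans (hXR ω)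
  have hN0 : 0 < N := by linarith [hYε ω, hYN ω]
  -- bounded measurable functions are integrable
  have bint : ∀ {f : Ω → ℝ} (K : ℝ), Measurable f → (∀ x, |f x| ≤ K) → Integrable f γ := by
    intro f K hf hK
    exact Integrable.of_bound hf.aestronglyMeasurable K (.of_forall hK)
  have bintC : ∀ {f : Ω → ℂ} (K : ℝ), Measurable f → (∀ x, ‖f x‖ ≤ K) → Integrable f γ := by
    intro f K hf hK
    exact Integrable.of_bound hf.aestronglyMeasurable K (.of_forall hK)
  have iX : Integrable X γ := bintC R hX hXR
  have hY0 : ∀ x, 0 < Y x := fun x => hε.trans_le (hYε x)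
  have iY : Integrable Y γ := bint N hY fun x => by rw [abs_of_pos (hY0 x)]; exact hYN x
  set x0 := ∫ x, X x ∂γ with hx0
  set y0 := ∫ x, Y x ∂γ with hy0
  have hy0ε : ε ≤ y0 := by
    have := integral_mono (μ := γ) (integrable_const ε) iY hYε
    simpa using this
  have hy0p : 0 < y0 := hε.trans_le hy0ε
  set Z : Ω → ℝ := fun x => Y x ^ a with hZ
  have mZ : Measurable Z := hY.pow_const a
  set z0 := y0 ^ a with hz0
  have z0p : 0 < z0 := Real.rpow_pos_of_pos hy0p a
  have hZp : ∀ x, 0 < Z x := fun x => Real.rpow_pos_of_pos (hY0 x) a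
  have hZε : ∀ x, ε ^ a ≤ Z x := fun x => Real.rpow_le_rpow hε.le (hYε x) ha0.le
  have hZN : ∀ x, Z x ≤ N ^ a := fun x => Real.rpow_le_rpow (hY0 x).le (hYN x) ha0.le
  have εp : 0 < ε ^ a := Real.rpow_pos_of_pos hε a
  have Np : 0 < N ^ a := Real.rpow_pos_of_pos hN0 a
  have iZ : Integrable Z γ := bint (N ^ a) mZ fun x => by rw [abs_of_pos (hZp x)]; exact hZN x
  have hneg : ∀ x, Y x ^ (-a) = (Z x)⁻¹ := fun x => Real.rpow_neg (hY0 x).le a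
  simp_rw [hneg]
  rw [Real.rpow_neg hy0p.le, ← hz0]
  set EZ := ∫ x, Z x ∂γ with hEZ
  have hinvle : ∀ x, (Z x)⁻¹ ≤ (ε ^ a)⁻¹ := fun x => inv_anti₀ εp (hZε x)
  have iXZ : Integrable (fun x => ‖X x‖ ^ 2 * (Z x)⁻¹) γ := by
    refine bint (R ^ 2 * (ε ^ a)⁻¹) (by fun_prop) fun x => ?_
    rw [abs_of_nonneg (by have := hZp x; positivity)]
    have := hinvle x
    have := hXR x
    have := hZp x
    gcongr
  -- beta
  set β : Ω → ℝ := fun x => 1 + a * (Y x / y0 - 1) - Z x / z0 with hβ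
  have hzeta : ∀ x, (Y x / y0) ^ a = Z x / z0 := fun x => Real.div_rpow (hY0 x).le hy0p.le a
  have hβi : ∀ x, (Z x / z0 - 1) ^ 2 ≤ (2 / (1 - a)) * β x * (1 + Y x / y0) := by
    intro x
    have := beta_ineq ha ha1 (div_pos (hY0 x) hy0p)
    rw [hzeta] at this
    exact this
  have h1a : 0 < 1 - a := by linarith
  have hβ0 : ∀ x, 0 ≤ β x := by
    intro x
    have h := hβi x
    have h2 : 0 < 1 + Y x / y0 := by have := div_pos (hY0 x) hy0p; linarith
    have h3 : 0 ≤ (2 / (1 - a)) * β x * (1 + Y x / y0) := le_trans (sq_nonneg _) h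
    by_contra hc
    push Not at hc
    have : (2 / (1 - a)) * β x * (1 + Y x / y0) < 0 := by
      apply mul_neg_of_neg_of_pos _ h2
      apply mul_neg_of_pos_of_neg (by positivity) hc
    linarith
  have iβ : Integrable β γ := by
    have : Integrable (fun x => 1 + a * (Y x / y0 - 1) - Z x / z0) γ :=
      ((integrable_const _).add (((iY.div_const _).sub (integrable_const _)).const_mul _)).sub
        (iZ.div_const _)
    exact this
  have Eβ : ∫ x, β x ∂γ = 1 - EZ / z0 := by
    have i1 : Integrable (fun x => Y x / y0 - 1) γ := (iY.div_const _).sub (integrable_const _)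
    simp only [hβ]
    rw [integral_sub ((integrable_const _).fun_add (i1.const_mul _)) (iZ.div_const _),
      integral_add (integrable_const _) (i1.const_mul _), integral_const_mul,
      integral_sub (iY.div_const _) (integrable_const _), integral_div, integral_div]
    simp only [integral_const, probReal_univ, smul_eq_mul, mul_one, ← hy0, ← hEZ]
    rw [div_self hy0p.ne']
    ring
  have hEZle : 0 ≤ 1 - EZ / z0 := by rw [← Eβ]; exact integral_nonneg hβ0
  -- G1
  set θ : ℂ := x0 / z0 with hθ
  set G1 := ∫ x, ‖X x - θ * Z x‖ ^ 2 * (Z x)⁻¹ ∂γ with hG1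
  have hG10 : 0 ≤ G1 := integral_nonneg fun x => by have := hZp x; positivity
  have G1eq : (∫ x, ‖X x‖ ^ 2 * (Z x)⁻¹ ∂γ) - ‖x0‖ ^ 2 * z0⁻¹ =
      G1 + ‖x0‖ ^ 2 / z0 * (1 - EZ / z0) := by
    have e : ∀ x, ‖X x - θ * Z x‖ ^ 2 * (Z x)⁻¹ =
        ‖X x‖ ^ 2 * (Z x)⁻¹ - 2 * ((starRingEnd ℂ θ) * X x).re + ‖θ‖ ^ 2 * Z x := by
      intro x
      have hz := (hZp x).ne'
      have : ‖X x - θ * Z x‖ ^ 2 = ‖X x‖ ^ 2 - 2 * ((starRingEnd ℂ θ) * X x).re * Z x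
          + ‖θ‖ ^ 2 * Z x ^ 2 := by
        simp only [Complex.sq_norm, Complex.normSq_apply]
        simp
        ring
      rw [this]; field_simp
    have ire : Integrable (fun x => ((starRingEnd ℂ θ) * X x).re) γ := (iX.const_mul _).re
    have ere : ∫ x, ((starRingEnd ℂ θ) * X x).re ∂γ = ‖x0‖ ^ 2 / z0 := by
      have := integral_re (iX.const_mul (starRingEnd ℂ θ))
      simp only [RCLike.re_to_complex] at this
      rw [this, integral_const_mul, ← hx0, hθ]
      simp only [map_div₀, Complex.conj_ofReal]
      rw [div_mul_eq_mul_div, Complex.div_ofReal_re, mul_comm, Complex.mul_conj]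
      rw [Complex.ofReal_re, Complex.normSq_eq_norm_sq]
    rw [hG1]
    simp_rw [e]
    have isub : Integrable (fun x => ‖X x‖ ^ 2 * (Z x)⁻¹ - 2 * ((starRingEnd ℂ θ) * X x).re) γ :=
      iXZ.sub (ire.const_mul 2)
    rw [integral_add isub (iZ.const_mul _),
      integral_sub iXZ (ire.const_mul 2), integral_const_mul, integral_const_mul, ere, ← hEZ]
    have : ‖θ‖ = ‖x0‖ / z0 := by rw [hθ, norm_div, Complex.norm_real, Real.norm_of_nonneg z0p.le]
    rw [this]
    field_simp
    ring
  rw [G1eq]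
  -- decomposition
  have ib1 : Integrable (fun x => (m x : ℂ) * (X x - θ * Z x)) γ := by
    refine bintC (M * (R + ‖θ‖ * N ^ a)) (by fun_prop) fun x => ?_
    rw [norm_mul, Complex.norm_real, Real.norm_eq_abs]
    refine mul_le_mul (hmM x) ?_ (norm_nonneg _) hM0
    refine (norm_sub_le _ _).trans (add_le_add (hXR x) ?_)
    rw [norm_mul, Complex.norm_real, Real.norm_of_nonneg (hZp x).le]
    exact mul_le_mul_of_nonneg_left (hZN x) (norm_nonneg _)
  have iζ : Integrable (fun x => |Z x / z0 - 1|) γ := ((iZ.div_const _).sub (integrable_const _)).abs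
  have ib2 : Integrable (fun x => m x * (Z x / z0 - 1)) γ := by
    refine bint (M * (N ^ a / z0 + 1)) (by fun_prop) fun x => ?_
    rw [abs_mul]
    refine mul_le_mul (hmM x) ?_ (abs_nonneg _) hM0
    refine (abs_sub _ _).trans ?_
    rw [abs_of_pos (div_pos (hZp x) z0p), abs_one]
    have := hZN x
    gcongr
  have dec : ∫ x, (m x : ℂ) * (X x - x0) ∂γ = (∫ x, (m x : ℂ) * (X x - θ * Z x) ∂γ)
      + x0 * ((∫ x, m x * (Z x / z0 - 1) ∂γ : ℝ) : ℂ) := by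
    have ib3 : Integrable (fun x => x0 * ((m x * (Z x / z0 - 1) : ℝ) : ℂ)) γ := ib2.ofReal.const_mul _
    rw [← integral_complex_ofReal, ← integral_const_mul, ← integral_add ib1 ib3]
    congr 1; ext x
    have : (z0 : ℂ) ≠ 0 := by exact_mod_cast z0p.ne'
    rw [hθ]; push_cast; field_simp; ring
  have first : ‖∫ x, (m x : ℂ) * (X x - θ * Z x) ∂γ‖ ^ 2 ≤ M ^ 2 * (G1 * z0) := by
    have i1 : Integrable (fun x => (‖X x - θ * Z x‖ * √(Z x)⁻¹) ^ 2) γ := by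
      have : ∀ x, (‖X x - θ * Z x‖ * √(Z x)⁻¹) ^ 2 = ‖X x - θ * Z x‖ ^ 2 * (Z x)⁻¹ := fun x => by
        rw [mul_pow, Real.sq_sqrt (inv_nonneg.mpr (hZp x).le)]
      simp_rw [this]
      refine bint ((R + ‖θ‖ * N ^ a) ^ 2 * (ε ^ a)⁻¹) (by fun_prop) fun x => ?_
      rw [abs_of_nonneg (by have := hZp x; positivity)]
      have h1 : ‖X x - θ * Z x‖ ≤ R + ‖θ‖ * N ^ a := by
        refine (norm_sub_le _ _).trans (add_le_add (hXR x) ?_)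
        rw [norm_mul, Complex.norm_real, Real.norm_of_nonneg (hZp x).le]
        exact mul_le_mul_of_nonneg_left (hZN x) (norm_nonneg _)
      have := hinvle x
      have := hZp x
      gcongr
    have i2 : Integrable (fun x => (√(Z x)) ^ 2) γ := by
      have : ∀ x, (√(Z x)) ^ 2 = Z x := fun x => Real.sq_sqrt (hZp x).le
      simp_rw [this]; exact iZ
    have i3 : Integrable (fun x => (‖X x - θ * Z x‖ * √(Z x)⁻¹) * √(Z x)) γ := by
      refine Integrable.mono' (i1.add i2) (by fun_prop) (.of_forall fun x => ?_)
      simp only [Real.norm_eq_abs, Pi.add_apply]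
      rw [abs_of_nonneg (by positivity)]
      nlinarith [sq_nonneg (‖X x - θ * Z x‖ * √(Z x)⁻¹ - √(Z x)), sq_nonneg (‖X x - θ * Z x‖ * √(Z x)⁻¹),
        sq_nonneg (√(Z x))]
    have cs := cs_integral i1 i2 i3
    have e1 : ∫ x, (‖X x - θ * Z x‖ * √(Z x)⁻¹) ^ 2 ∂γ = G1 := by
      rw [hG1]; congr 1; ext x
      rw [mul_pow, Real.sq_sqrt (inv_nonneg.mpr (hZp x).le)]
    have e2 : ∫ x, (√(Z x)) ^ 2 ∂γ = EZ := by
      rw [hEZ]; congr 1; ext x; exact Real.sq_sqrt (hZp x).le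
    have e3 : ∀ x, (‖X x - θ * Z x‖ * √(Z x)⁻¹) * √(Z x) = ‖X x - θ * Z x‖ := fun x => by
      rw [mul_assoc, ← Real.sqrt_mul (inv_nonneg.mpr (hZp x).le), inv_mul_cancel₀ (hZp x).ne']; simp
    rw [e1, e2] at cs
    simp_rw [e3] at cs i3
    have hle : ‖∫ x, (m x : ℂ) * (X x - θ * Z x) ∂γ‖ ≤ M * ∫ x, ‖X x - θ * Z x‖ ∂γ := by
      rw [← integral_const_mul]
      refine norm_integral_le_of_norm_le (i3.const_mul M) (.of_forall fun x => ?_)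
      rw [norm_mul, Complex.norm_real, Real.norm_eq_abs]
      exact mul_le_mul_of_nonneg_right (hmM x) (norm_nonneg _)
    have hEZz : EZ ≤ z0 := by
      have : EZ / z0 ≤ 1 := by linarith
      rwa [div_le_one z0p] at this
    calc _ ≤ (M * ∫ x, ‖X x - θ * Z x‖ ∂γ) ^ 2 := by gcongr
      _ = M ^ 2 * (∫ x, ‖X x - θ * Z x‖ ∂γ) ^ 2 := by ring
      _ ≤ M ^ 2 * (G1 * EZ) := by gcongr
      _ ≤ _ := by gcongr
  have second : |∫ x, m x * (Z x / z0 - 1) ∂γ| ^ 2 ≤ M ^ 2 * (4 / (1 - a) * (1 - EZ / z0)) := by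
    set κ := 2 / (1 - a) with hκ
    have κ0 : 0 < κ := by positivity
    have hle : |∫ x, m x * (Z x / z0 - 1) ∂γ| ≤ M * ∫ x, |Z x / z0 - 1| ∂γ := by
      rw [← integral_const_mul, ← Real.norm_eq_abs]
      refine norm_integral_le_of_norm_le (iζ.const_mul M) (.of_forall fun x => ?_)
      rw [Real.norm_eq_abs, abs_mul]
      exact mul_le_mul_of_nonneg_right (hmM x) (abs_nonneg _)
    have hq : ∀ x, 0 ≤ 1 + Y x / y0 := fun x => by have := div_pos (hY0 x) hy0p; linarith
    have i1 : Integrable (fun x => (√(κ * β x)) ^ 2) γ := by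
      have : ∀ x, (√(κ * β x)) ^ 2 = κ * β x := fun x => Real.sq_sqrt (mul_nonneg κ0.le (hβ0 x))
      simp_rw [this]; exact iβ.const_mul _
    have iq : Integrable (fun x => 1 + Y x / y0) γ := (integrable_const _).add (iY.div_const _)
    have i2 : Integrable (fun x => (√(1 + Y x / y0)) ^ 2) γ := by
      have : ∀ x, (√(1 + Y x / y0)) ^ 2 = 1 + Y x / y0 := fun x => Real.sq_sqrt (hq x)
      simp_rw [this]; exact iq
    have mβ : Measurable β := by fun_prop
    have i3 : Integrable (fun x => √(κ * β x) * √(1 + Y x / y0)) γ := by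
      refine Integrable.mono' (i1.add i2) (by fun_prop) (.of_forall fun x => ?_)
      simp only [Real.norm_eq_abs, Pi.add_apply]
      rw [abs_of_nonneg (by positivity)]
      nlinarith [sq_nonneg (√(κ * β x) - √(1 + Y x / y0)), sq_nonneg (√(κ * β x)),
        sq_nonneg (√(1 + Y x / y0))]
    have cs := cs_integral i1 i2 i3
    have e1 : ∫ x, (√(κ * β x)) ^ 2 ∂γ = κ * (1 - EZ / z0) := by
      rw [← Eβ, ← integral_const_mul]; congr 1; ext x
      exact Real.sq_sqrt (mul_nonneg κ0.le (hβ0 x))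
    have e2 : ∫ x, (√(1 + Y x / y0)) ^ 2 ∂γ = 2 := by
      have : ∀ x, (√(1 + Y x / y0)) ^ 2 = 1 + Y x / y0 := fun x => Real.sq_sqrt (hq x)
      simp_rw [this]
      rw [integral_add (integrable_const _) (iY.div_const _), integral_div, ← hy0, div_self hy0p.ne']
      simp; norm_num
    rw [e1, e2] at cs
    have hle2 : ∫ x, |Z x / z0 - 1| ∂γ ≤ ∫ x, √(κ * β x) * √(1 + Y x / y0) ∂γ := by
      refine integral_mono iζ i3 fun x => ?_
      simp only
      rw [← Real.sqrt_mul (mul_nonneg κ0.le (hβ0 x))]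
      exact Real.abs_le_sqrt (hβi x)
    have h0 : 0 ≤ ∫ x, |Z x / z0 - 1| ∂γ := integral_nonneg fun x => abs_nonneg _
    calc _ ≤ (M * ∫ x, |Z x / z0 - 1| ∂γ) ^ 2 := by gcongr
      _ = M ^ 2 * (∫ x, |Z x / z0 - 1| ∂γ) ^ 2 := by ring
      _ ≤ M ^ 2 * (κ * (1 - EZ / z0) * 2) := by
        gcongr
        exact (pow_le_pow_left₀ h0 hle2 2).trans cs
      _ = _ := by rw [hκ]; ring
  rw [dec]
  set D1 := ‖∫ x, (m x : ℂ) * (X x - θ * Z x) ∂γ‖ with hD1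
  set D2 := |∫ x, m x * (Z x / z0 - 1) ∂γ| with hD2
  have hn : ‖(∫ x, (m x : ℂ) * (X x - θ * Z x) ∂γ)
      + x0 * ((∫ x, m x * (Z x / z0 - 1) ∂γ : ℝ) : ℂ)‖ ≤ D1 + ‖x0‖ * D2 := by
    refine (norm_add_le _ _).trans (le_of_eq ?_)
    rw [norm_mul, Complex.norm_real, Real.norm_eq_abs]
  have h4 : 1 ≤ 1 / (1 - a) := by rw [le_div_iff₀ h1a]; linarith
  calc _ ≤ (D1 + ‖x0‖ * D2) ^ 2 * z0⁻¹ := by gcongr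
    _ ≤ (2 * D1 ^ 2 + 2 * (‖x0‖ ^ 2 * D2 ^ 2)) * z0⁻¹ := by
      gcongr; nlinarith [sq_nonneg (D1 - ‖x0‖ * D2)]
    _ ≤ (2 * (M ^ 2 * (G1 * z0)) + 2 * (‖x0‖ ^ 2 * (M ^ 2 * (4 / (1 - a) * (1 - EZ / z0))))) * z0⁻¹ := by
      gcongr
    _ = 2 * M ^ 2 * 1 * G1 + 8 * M ^ 2 / (1 - a) * (‖x0‖ ^ 2 / z0 * (1 - EZ / z0)) := by
      field_simp; ring
    _ ≤ 2 * M ^ 2 * (1 / (1 - a)) * G1 + 8 * M ^ 2 / (1 - a) * (‖x0‖ ^ 2 / z0 * (1 - EZ / z0)) := by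
      gcongr
    _ ≤ 8 * M ^ 2 / (1 - a) * G1 + 8 * M ^ 2 / (1 - a) * (‖x0‖ ^ 2 / z0 * (1 - EZ / z0)) := by
      gcongr
      rw [mul_one_div]
      gcongr
      norm_num
    _ = _ := by ring

end JensenGap

section HeatSquare
open ProbabilityTheory

/-- variance `4^s` -/
def Vr (s : ℝ) : NNReal := ⟨(4:ℝ) ^ s, by positivity⟩

lemma Vr_coe (s : ℝ) : (Vr s : ℝ) = (4:ℝ) ^ s := rfl
lemma Vr_pos (s : ℝ) : 0 < Vr s := by
  rw [← NNReal.coe_pos, Vr_coe]; positivity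
lemma Vr_add_one (s : ℝ) : Vr (s + 1) = 4 * Vr s := by
  apply NNReal.coe_injective
  push_cast
  rw [Vr_coe, Vr_coe, Real.rpow_add (by norm_num), Real.rpow_one]; ring

/-- Gaussian density with variance `c * 4^s`. -/
def gk (c : NNReal) (s y : ℝ) : ℝ := gaussianPDFReal 0 (c * Vr s) y

lemma gk_eq (c : NNReal) (s y : ℝ) : gk c s y =
    (Real.sqrt (2 * Real.pi * (c * (4:ℝ) ^ s)))⁻¹ * Real.exp (- y ^ 2 / (2 * (c * (4:ℝ) ^ s))) := by
  unfold gk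
  rw [gaussianPDFReal_def]
  simp [Vr_coe]

lemma gk_nonneg (c : NNReal) (s y : ℝ) : 0 ≤ gk c s y := gaussianPDFReal_nonneg _ _ _

lemma gk_meas (c : NNReal) : Measurable (fun p : ℝ × ℝ => gk c p.1 p.2) := by
  simp only [gk_eq]
  fun_prop

lemma gk_meas1 (c : NNReal) (s : ℝ) : Measurable (fun y => gk c s y) := by
  simp only [gk_eq]
  fun_prop

lemma gk_integrable (c : NNReal) (s : ℝ) : Integrable (gk c s) := integrable_gaussianPDFReal _ _

lemma gk_integral (c : NNReal) (hc : c ≠ 0) (s : ℝ) : ∫ y, gk c s y = 1 :=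
  integral_gaussianPDFReal_eq_one _ (mul_ne_zero hc (Vr_pos s).ne')

lemma gk_shift (s y : ℝ) : gk 4 s y = gk 1 (s+1) y := by
  unfold gk; rw [Vr_add_one, one_mul]

lemma gk_pos (c : NNReal) (hc : c ≠ 0) (s y : ℝ) : 0 < gk c s y :=
  gaussianPDFReal_pos _ _ _ (mul_ne_zero hc (Vr_pos s).ne')

lemma gk_def (c : NNReal) (s y : ℝ) : gaussianPDFReal 0 (c * Vr s) y = gk c s y := rfl

attribute [irreducible] gk

variable {E : Type*} [NormedAddCommGroup E] [NormedSpace ℝ E]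

/-- heat average -/
def Pg (c : NNReal) (s : ℝ) (f : ℝ → E) (x : ℝ) : E := ∫ y, gk c s y • f (x + y)

lemma Pg_eq (c : NNReal) (hc : c ≠ 0) (s : ℝ) (f : ℝ → E) (x : ℝ) :
    Pg c s f x = ∫ y, f (x + y) ∂(gaussianReal 0 (c * Vr s)) := by
  rw [integral_gaussianReal_eq_integral_smul (mul_ne_zero hc (Vr_pos s).ne')]
  simp only [gk_def]
  rfl

lemma Pg_shift (s : ℝ) (f : ℝ → E) (x : ℝ) : Pg 4 s f x = Pg 1 (s+1) f x := by
  unfold Pg; simp only [gk_shift]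

lemma Pg_meas (c : NNReal) [SecondCountableTopology E] [MeasurableSpace E] [BorelSpace E]
    {f : ℝ → E} (hf : Measurable f) : Measurable (fun p : ℝ × ℝ => Pg c p.1 f p.2) := by
  apply StronglyMeasurable.measurable
  refine StronglyMeasurable.integral_prod_right' (f := fun q : (ℝ × ℝ) × ℝ =>
    gk c q.1.1 q.2 • f (q.1.2 + q.2)) ?_
  apply Measurable.stronglyMeasurable
  exact ((gk_meas c).comp (measurable_fst.fst.prodMk measurable_snd)).smul
    (hf.comp (by fun_prop))

lemma Pg_meas1 (c : NNReal) (s : ℝ) [SecondCountableTopology E] [MeasurableSpace E] [BorelSpace E]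
    {f : ℝ → E} (hf : Measurable f) : Measurable (fun y => Pg c s f y) := by
  have := (Pg_meas c hf).comp (measurable_const.prodMk measurable_id : Measurable (fun y : ℝ => (s, y)))
  exact this

lemma Pg_meas1x (c : NNReal) (s x : ℝ) [SecondCountableTopology E] [MeasurableSpace E] [BorelSpace E]
    {f : ℝ → E} (hf : Measurable f) : Measurable (fun y => Pg c s f (x + y)) := by
  have := (Pg_meas1 c s hf).comp (measurable_const_add x)
  exact this

lemma Pg_bdd (c : NNReal) (hc : c ≠ 0) (s : ℝ) {f : ℝ → E} {R : ℝ} (hR : ∀ x, ‖f x‖ ≤ R) (x : ℝ) :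
    ‖Pg c s f x‖ ≤ R := by
  rw [Pg_eq c hc]
  refine (norm_integral_le_of_norm_le_const (C := R) (Filter.Eventually.of_forall fun y => hR _)).trans ?_
  simp

lemma Pg_semi (c d : NNReal) (hc : c ≠ 0) (hd : d ≠ 0) (s : ℝ) [SecondCountableTopology E]
    [MeasurableSpace E] [BorelSpace E] {f : ℝ → E} (hf : Measurable f) {R : ℝ}
    (hR : ∀ x, ‖f x‖ ≤ R) (x : ℝ) :
    ∫ y, Pg d s f (x + y) ∂(gaussianReal 0 (c * Vr s)) = Pg (c + d) s f x := by
  rw [Pg_eq (c+d) (by positivity)]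
  have : gaussianReal 0 ((c+d) * Vr s) = (gaussianReal 0 (c * Vr s)) ∗ (gaussianReal 0 (d * Vr s)) := by
    rw [gaussianReal_conv_gaussianReal]; simp [add_mul]
  rw [this, integral_conv]
  · simp only [Pg_eq d hd, add_assoc]
  · rw [← this]
    refine Integrable.of_bound (C := R) ?_ (Filter.Eventually.of_forall fun y => hR _)
    exact (hf.comp (by fun_prop)).stronglyMeasurable.aestronglyMeasurable

lemma Pg_ge (c : NNReal) (hc : c ≠ 0) (s : ℝ) {W : ℝ → ℝ} (hW : Measurable W) {ε N : ℝ}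
    (h1 : ∀ x, ε ≤ W x) (h2 : ∀ x, W x ≤ N) (x : ℝ) : ε ≤ Pg c s W x ∧ Pg c s W x ≤ N := by
  have hi : Integrable (fun y => W (x + y)) (gaussianReal 0 (c * Vr s)) := by
    refine Integrable.of_bound (C := max |ε| |N|) ?_ (Filter.Eventually.of_forall fun y => ?_)
    · exact (hW.comp (by fun_prop)).stronglyMeasurable.aestronglyMeasurable
    · rw [Real.norm_eq_abs]; exact abs_le_max_abs_abs (h1 _) (h2 _)
  rw [Pg_eq c hc]
  constructor
  · have := integral_mono (integrable_const ε) hi (fun y => h1 _)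
    simpa using this
  · have := integral_mono hi (integrable_const N) (fun y => h2 _)
    simpa using this

lemma lint_avg {γ : Measure ℝ} [IsProbabilityMeasure γ] {g : ℝ → ℝ} (hg : Measurable g)
    (h0 : ∀ x, 0 ≤ g x) {B : ℝ} (hB : ∀ x, g x ≤ B) :
    ∫⁻ x, ENNReal.ofReal (∫ y, g (x + y) ∂γ) = ∫⁻ x, ENNReal.ofReal (g x) := by
  have : ∀ x, ENNReal.ofReal (∫ y, g (x + y) ∂γ) = ∫⁻ y, ENNReal.ofReal (g (x + y)) ∂γ := by
    intro x
    rw [ofReal_integral_eq_lintegral_ofReal]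
    · refine Integrable.of_bound (C := B) ?_ (Filter.Eventually.of_forall fun y => ?_)
      · exact (hg.comp (by fun_prop)).stronglyMeasurable.aestronglyMeasurable
      · rw [Real.norm_of_nonneg (h0 _)]; exact hB _
    · exact Filter.Eventually.of_forall fun y => h0 _
  simp only [this]
  rw [lintegral_lintegral_swap]
  · have : ∀ y, ∫⁻ x, ENNReal.ofReal (g (x + y)) = ∫⁻ x, ENNReal.ofReal (g x) := fun y =>
      lintegral_add_right_eq_self (fun x => ENNReal.ofReal (g x)) y
    simp [this]
  · apply Measurable.aemeasurable
    simp only [Function.uncurry_def]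
    fun_prop

/-- the energy functional -/
def phiE (a : ℝ) (f : ℝ → ℂ) (W : ℝ → ℝ) (s : ℝ) : ENNReal :=
  ∫⁻ x, ENNReal.ofReal (‖Pg 1 s f x‖ ^ 2 * (Pg 1 s W x) ^ (-a))

variable {f : ℝ → ℂ} {W : ℝ → ℝ} {R ε N a : ℝ}

lemma phiE_le (hf : Measurable f) (hR : ∀ x, ‖f x‖ ≤ R) (hW : Measurable W) (hε : 0 < ε)
    (h1 : ∀ x, ε ≤ W x) (h2 : ∀ x, W x ≤ N) (ha : 1 / 2 ≤ a) (ha1 : a < 1) (s : ℝ) :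
    phiE a f W s ≤ ∫⁻ x, ENNReal.ofReal (‖f x‖ ^ 2 * (W x) ^ (-a)) := by
  rw [← lint_avg (γ := gaussianReal 0 (1 * Vr s)) (g := fun x => ‖f x‖ ^ 2 * (W x) ^ (-a))
    (B := R ^ 2 * ε ^ (-a)) (by fun_prop)
    (fun x => by have := hε.trans_le (h1 x); positivity)]
  · apply lintegral_mono
    intro x
    apply ENNReal.ofReal_le_ofReal
    have := jensen_gap (gaussianReal 0 (1 * Vr s)) (X := fun y => f (x + y)) (Y := fun y => W (x + y))
      (m := fun _ => 0) (by fun_prop) (by fun_prop) (by fun_prop) (M := 1) (fun y => hR _) hε (fun y => h1 _)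
      (fun y => h2 _) (by simp) ha ha1
    simp only [Complex.ofReal_zero, zero_mul, integral_zero, norm_zero] at this
    rw [zero_pow (by norm_num), zero_mul] at this
    have h3 : 0 < 8 * (1:ℝ) ^ 2 / (1 - a) := by
      have : 0 < 1 - a := by linarith
      positivity
    have := nonneg_of_mul_nonneg_right this h3
    simp only [Pg_eq 1 one_ne_zero]
    linarith
  · intro x
    have := hε.trans_le (h1 x)
    have h3 : W x ^ (-a) ≤ ε ^ (-a) :=
      Real.rpow_le_rpow_of_nonpos hε (h1 x) (by linarith)
    have := hR x
    gcongr

lemma gk_ratio (s y : ℝ) : gk 1 s y ≤ 3 * gk 3 s y := by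
  rw [gk_eq, gk_eq]
  have hV : (0:ℝ) < 4 ^ s := by positivity
  set V := (4:ℝ) ^ s
  have e1 : Real.exp (-y ^ 2 / (2 * (((1:NNReal):ℝ) * V))) ≤ Real.exp (-y ^ 2 / (2 * (((3:NNReal):ℝ) * V))) := by
    apply Real.exp_le_exp.mpr
    rw [div_le_div_iff₀ (by simpa using hV) (by simpa using hV)]
    have := mul_nonneg (sq_nonneg y) hV.le
    push_cast
    nlinarith
  have e2 : (Real.sqrt (2 * Real.pi * (((1:NNReal):ℝ) * V)))⁻¹ ≤
      3 * (Real.sqrt (2 * Real.pi * (((3:NNReal):ℝ) * V)))⁻¹ := by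
    have hp := Real.pi_pos
    have : Real.sqrt (2 * Real.pi * (((3:NNReal):ℝ) * V)) ≤ 3 * Real.sqrt (2 * Real.pi * (((1:NNReal):ℝ) * V)) := by
      apply Real.sqrt_le_iff.mpr
      constructor
      · positivity
      · rw [mul_pow, Real.sq_sqrt (by positivity)]
        push_cast
        have := mul_pos hp hV
        nlinarith
    rw [← div_eq_mul_inv, inv_eq_one_div, div_le_div_iff₀ (by positivity) (by
      apply Real.sqrt_pos.mpr; push_cast; positivity)]
    linarith
  calc _ ≤ (3 * (Real.sqrt (2 * Real.pi * (((3:NNReal):ℝ) * V)))⁻¹) * Real.exp (-y ^ 2 / (2 * (((3:NNReal):ℝ) * V))) := by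
        gcongr
    _ = _ := by ring

/-- the constant of the one dimensional square function -/
def Csq (a : ℝ) : ℝ := 8 * 3 ^ 2 / (1 - a)

lemma Csq_pos (ha1 : a < 1) : 0 < Csq a := by
  unfold Csq
  have : 0 < 1 - a := by linarith
  positivity

lemma gap_point (hf : Measurable f) (hR : ∀ x, ‖f x‖ ≤ R) (hW : Measurable W) (hε : 0 < ε)
    (h1 : ∀ x, ε ≤ W x) (h2 : ∀ x, W x ≤ N) (ha : 1 / 2 ≤ a) (ha1 : a < 1) (s x : ℝ) :
    ‖Pg 2 s f x - Pg 4 s f x‖ ^ 2 * (Pg 4 s W x) ^ (-a) + Csq a * (‖Pg 4 s f x‖ ^ 2 * (Pg 4 s W x) ^ (-a))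
     ≤ Csq a * ∫ y, ‖Pg 1 s f (x + y)‖ ^ 2 * (Pg 1 s W (x + y)) ^ (-a) ∂(gaussianReal 0 (3 * Vr s)) := by
  have hfm : Measurable (fun y => Pg 1 s f y) := Pg_meas1 1 s hf
  have hWm : Measurable (fun y => Pg 1 s W y) := Pg_meas1 1 s hW
  have g3 : ∀ y, 0 < gk 3 s y := fun y => gk_pos 3 (by norm_num) s y
  have := jensen_gap (gaussianReal 0 (3 * Vr s)) (X := fun y => Pg 1 s f (x + y))
      (Y := fun y => Pg 1 s W (x + y))
      (m := fun y => gk 1 s y / gk 3 s y) (Pg_meas1x 1 s x hf) (Pg_meas1x 1 s x hW)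
      ((gk_meas1 1 s).div (gk_meas1 3 s)) (M := 3) (R := R) (ε := ε) (N := N) (a := a)
      (fun y => Pg_bdd 1 one_ne_zero s hR _)
      hε (fun y => (Pg_ge 1 one_ne_zero s hW h1 h2 _).1)
      (fun y => (Pg_ge 1 one_ne_zero s hW h1 h2 _).2) (by
        intro y
        rw [abs_of_nonneg (div_nonneg (gk_nonneg _ _ _) (gk_nonneg _ _ _))]
        rw [div_le_iff₀ (g3 y)]
        exact gk_ratio s y) ha ha1
  have hWR : ∀ x, ‖W x‖ ≤ max |ε| |N| := fun x => abs_le_max_abs_abs (h1 _) (h2 _)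
  rw [Pg_semi 3 1 (by norm_num) one_ne_zero s hf hR x, Pg_semi 3 1 (by norm_num) one_ne_zero s hW hWR x] at this
  rw [show (3 + 1 : NNReal) = 4 by norm_num] at this
  have hm : ∫ y, (((gk 1 s y / gk 3 s y : ℝ)) : ℂ) * (Pg 1 s f (x + y) - Pg 4 s f x) ∂(gaussianReal 0 (3 * Vr s))
      = Pg 2 s f x - Pg 4 s f x := by
    rw [integral_gaussianReal_eq_integral_smul (mul_ne_zero (by norm_num) (Vr_pos s).ne')]
    have : ∀ y, gaussianPDFReal 0 (3 * Vr s) y • ((((gk 1 s y / gk 3 s y : ℝ)) : ℂ) * (Pg 1 s f (x + y) - Pg 4 s f x))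
      = gaussianPDFReal 0 (1 * Vr s) y • (Pg 1 s f (x + y) - Pg 4 s f x) := by
      intro y
      rw [← Complex.real_smul, smul_smul]
      congr 1
      have := g3 y
      rw [gk_def, gk_def]
      field_simp
    simp only [this]
    rw [← integral_gaussianReal_eq_integral_smul (mul_ne_zero one_ne_zero (Vr_pos s).ne')]
    rw [integral_sub, Pg_semi 1 1 one_ne_zero one_ne_zero s hf hR x]
    · norm_num
    · refine Integrable.of_bound (C := R) ?_ (Filter.Eventually.of_forall fun y => Pg_bdd 1 one_ne_zero s hR _)
      exact (Pg_meas1x 1 s x hf).stronglyMeasurable.aestronglyMeasurable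
    · exact integrable_const _
  rw [hm] at this
  unfold Csq
  linarith

lemma phi_step (hf : Measurable f) (hR : ∀ x, ‖f x‖ ≤ R) (hW : Measurable W) (hε : 0 < ε)
    (h1 : ∀ x, ε ≤ W x) (h2 : ∀ x, W x ≤ N) (ha : 1 / 2 ≤ a) (ha1 : a < 1) (s : ℝ) :
    (∫⁻ x, ENNReal.ofReal (‖Pg 2 s f x - Pg 4 s f x‖ ^ 2 * (Pg 4 s W x) ^ (-a))) +
      ENNReal.ofReal (Csq a) * phiE a f W (s+1) ≤ ENNReal.ofReal (Csq a) * phiE a f W s := by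
  have hm : ∀ c, Measurable (fun y => Pg c s f y) := fun c => Pg_meas1 c s hf
  have hWm : ∀ c, Measurable (fun y => Pg c s W y) := fun c => Pg_meas1 c s hW
  have hm1 := hm 1
  have hm2 := hm 2
  have hm4 := hm 4
  have hW4 := hWm 4
  have hW1 := hWm 1
  have pos : ∀ c ≠ 0, ∀ x, 0 < Pg c s W x := fun c hc x => hε.trans_le (Pg_ge c hc s hW h1 h2 x).1
  have hC := Csq_pos ha1
  unfold phiE
  simp only [← Pg_shift]
  rw [← lintegral_const_mul _ (by fun_prop), ← lintegral_add_left (by fun_prop)]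
  rw [← lint_avg (γ := gaussianReal 0 (3 * Vr s)) (g := fun x => ‖Pg 1 s f x‖ ^ 2 * (Pg 1 s W x) ^ (-a))
    (B := R ^ 2 * ε ^ (-a)) (by fun_prop)
    (fun x => by have := pos 1 one_ne_zero x; positivity)]
  · rw [← lintegral_const_mul' _ _ ENNReal.ofReal_ne_top]
    apply lintegral_mono
    intro x
    have p4 := pos 4 (by norm_num) x
    beta_reduce
    rw [← ENNReal.ofReal_mul hC.le, ← ENNReal.ofReal_mul hC.le, ← ENNReal.ofReal_add (by positivity) (by positivity)]
    apply ENNReal.ofReal_le_ofReal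
    exact gap_point hf hR hW hε h1 h2 ha ha1 s x
  · intro x
    have h3 : Pg 1 s W x ^ (-a) ≤ ε ^ (-a) :=
      Real.rpow_le_rpow_of_nonpos hε (Pg_ge 1 one_ne_zero s hW h1 h2 x).1 (by linarith)
    have := Pg_bdd 1 one_ne_zero s hR x
    have := pos 1 one_ne_zero x
    gcongr

lemma phiE_meas (hf : Measurable f) (hW : Measurable W) : Measurable (phiE a f W) := by
  have h1 := Pg_meas 1 hf
  have h2 := Pg_meas 1 hW
  refine Measurable.lintegral_prod_right' (f := fun p : ℝ × ℝ =>
    ENNReal.ofReal (‖Pg 1 p.1 f p.2‖ ^ 2 * (Pg 1 p.1 W p.2) ^ (-a))) ?_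
  fun_prop

/-- Weighted one dimensional square function estimate. -/
lemma sq_one (hf : Measurable f) (hR : ∀ x, ‖f x‖ ≤ R) (hW : Measurable W) (hε : 0 < ε)
    (h1 : ∀ x, ε ≤ W x) (h2 : ∀ x, W x ≤ N) (ha : 1 / 2 ≤ a) (ha1 : a < 1) :
    (∫⁻ s, ∫⁻ x, ENNReal.ofReal (‖Pg 2 s f x - Pg 4 s f x‖ ^ 2 * (Pg 4 s W x) ^ (-a))) ≤
      ENNReal.ofReal (Csq a) * ∫⁻ x, ENNReal.ofReal (‖f x‖ ^ 2 * (W x) ^ (-a)) := by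
  have hC := Csq_pos ha1
  set Φ := ∫⁻ x, ENNReal.ofReal (‖f x‖ ^ 2 * (W x) ^ (-a)) with hΦ
  set A : ℝ → ENNReal := fun s => ∫⁻ x, ENNReal.ofReal (‖Pg 2 s f x - Pg 4 s f x‖ ^ 2 * (Pg 4 s W x) ^ (-a)) with hA
  by_cases hT : Φ = ⊤
  · rw [hT, ENNReal.mul_top (by simpa using hC)]; exact le_top
  set K := ENNReal.ofReal (Csq a) with hK
  have hKt : K ≠ ⊤ := ENNReal.ofReal_ne_top
  have hstep : ∀ s, A s + K * phiE a f W (s+1) ≤ K * phiE a f W s := phi_step hf hR hW hε h1 h2 ha ha1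
  have hle : ∀ s, phiE a f W s ≤ Φ := phiE_le hf hR hW hε h1 h2 ha ha1
  have hpm : Measurable (phiE a f W) := phiE_meas hf hW
  have main : ∀ m : ℕ, ∫⁻ s in Set.Ioc (-(m:ℝ)) m, A s ≤ K * Φ := by
    intro m
    have i1 : ∫⁻ s in Set.Ioc (-(m:ℝ)) m, (A s + K * phiE a f W (s+1)) ≤
        ∫⁻ s in Set.Ioc (-(m:ℝ)) m, K * phiE a f W s := lintegral_mono fun s => hstep s
    rw [lintegral_add_right _ (by fun_prop), lintegral_const_mul _ (by fun_prop), lintegral_const_mul _ (by fun_prop)] at i1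
    have i2 : ∫⁻ s in Set.Ioc (-(m:ℝ)) m, phiE a f W (s+1) = ∫⁻ s in Set.Ioc (-(m:ℝ)+1) (m+1), phiE a f W s := by
      have := (measurePreserving_add_right (volume : Measure ℝ) (1:ℝ)).setLIntegral_comp_preimage
        (measurableSet_Ioc (a := -(m:ℝ)+1) (b := m+1)) hpm
      rw [← this]
      congr 2
      ext x; simp
    have i3 : ∫⁻ s in Set.Ioc (-(m:ℝ)) m, phiE a f W s ≤
        Φ + ∫⁻ s in Set.Ioc (-(m:ℝ)+1) (m+1), phiE a f W s := by
      have hsub : Set.Ioc (-(m:ℝ)) m ⊆ Set.Ioc (-(m:ℝ)) (-(m:ℝ)+1) ∪ Set.Ioc (-(m:ℝ)+1) (m+1) := by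
        intro x hx
        rcases le_or_gt x (-(m:ℝ)+1) with h | h
        · left; exact ⟨hx.1, h⟩
        · right; exact ⟨h, by linarith [hx.2]⟩
      refine (lintegral_mono_set hsub).trans ((lintegral_union_le _ _ _).trans ?_)
      gcongr
      refine (lintegral_mono fun s => hle s).trans ?_
      simp
    have fin : K * ∫⁻ s in Set.Ioc (-(m:ℝ)+1) (m+1), phiE a f W s ≠ ⊤ := by
      apply ENNReal.mul_ne_top hKt
      refine ne_top_of_le_ne_top ?_ (lintegral_mono fun s => hle s)
      simp only [lintegral_const, MeasurableSet.univ, Measure.restrict_apply, Set.univ_inter, Real.volume_Ioc]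
      exact ENNReal.mul_ne_top hT ENNReal.ofReal_ne_top
    rw [i2] at i1
    have i4 := i1.trans (mul_le_mul_right i3 K)
    rw [mul_add] at i4
    exact (ENNReal.add_le_add_iff_right fin).mp i4
  have hun : (⋃ m : ℕ, Set.Ioc (-(m:ℝ)) m) = Set.univ := by
    ext x
    simp only [Set.mem_iUnion, Set.mem_univ, iff_true]
    obtain ⟨m, hm⟩ := exists_nat_gt |x|
    have := abs_lt.mp hm
    exact ⟨m, this.1, this.2.le⟩
  rw [← setLIntegral_univ, ← hun, setLIntegral_iUnion_of_directed]
  · exact iSup_le main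
  · apply Monotone.directed_le
    intro i j hij
    have : (i:ℝ) ≤ j := by exact_mod_cast hij
    apply Set.Ioc_subset_Ioc <;> linarith

end HeatSquare

section TensorSquare

lemma measPres_cons (n : ℕ) : MeasurePreserving
    (fun p : ℝ × (Fin n → ℝ) => (Fin.cons p.1 p.2 : Fin (n+1) → ℝ)) volume volume := by
  have h := (volume_preserving_piFinSuccAbove (fun _ : Fin (n+1) => ℝ) 0).symm
  have e : (⇑(MeasurableEquiv.piFinSuccAbove (fun _ : Fin (n+1) => ℝ) 0).symm) =
    (fun p : ℝ × (Fin n → ℝ) => (Fin.cons p.1 p.2 : Fin (n+1) → ℝ)) := by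
    funext p
    simp [MeasurableEquiv.piFinSuccAbove, Fin.insertNthEquiv]
  rw [e] at h
  exact h

lemma measEmb_cons (n : ℕ) : MeasurableEmbedding
    (fun p : ℝ × (Fin n → ℝ) => (Fin.cons p.1 p.2 : Fin (n+1) → ℝ)) := by
  have h := (MeasurableEquiv.piFinSuccAbove (fun _ : Fin (n+1) => ℝ) 0).symm.measurableEmbedding
  have e : (⇑(MeasurableEquiv.piFinSuccAbove (fun _ : Fin (n+1) => ℝ) 0).symm) =
    (fun p : ℝ × (Fin n → ℝ) => (Fin.cons p.1 p.2 : Fin (n+1) → ℝ)) := by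
    funext p
    simp [MeasurableEquiv.piFinSuccAbove, Fin.insertNthEquiv]
  rw [e] at h
  exact h

lemma meas_cons {n : ℕ} {τ : Type*} [MeasurableSpace τ] {t : τ → ℝ} {z : τ → Fin n → ℝ}
    (ht : Measurable t) (hz : Measurable z) :
    Measurable (fun p => (Fin.cons (t p) (z p) : Fin (n+1) → ℝ)) :=
  (measPres_cons n).measurable.comp (ht.prodMk hz)

variable {E : Type*} [NormedAddCommGroup E] [NormedSpace ℝ E]

lemma lintegral_cons {n : ℕ} {f : (Fin (n+1) → ℝ) → ENNReal} (hf : Measurable f) :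
    ∫⁻ y, f y = ∫⁻ t : ℝ, ∫⁻ z : Fin n → ℝ, f (Fin.cons t z) := by
  rw [← (measPres_cons n).lintegral_comp hf]
  exact lintegral_prod _ (hf.comp (measPres_cons n).measurable).aemeasurable

lemma lintegral_cons' {n : ℕ} {f : (Fin (n+1) → ℝ) → ENNReal} (hf : Measurable f) :
    ∫⁻ y, f y = ∫⁻ z : Fin n → ℝ, ∫⁻ t : ℝ, f (Fin.cons t z) := by
  rw [lintegral_cons hf, lintegral_lintegral_swap]
  exact (hf.comp (measPres_cons n).measurable).aemeasurable

lemma integrable_cons {n : ℕ} {f : (Fin (n+1) → ℝ) → E} (hf : Integrable f) :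
    Integrable (fun p : ℝ × (Fin n → ℝ) => f (Fin.cons p.1 p.2)) (volume.prod volume) := by
  exact ((measPres_cons n).integrable_comp_emb (measEmb_cons n)).mpr hf

lemma integral_cons {n : ℕ} {f : (Fin (n+1) → ℝ) → E} (hf : Integrable f) :
    ∫ y, f y = ∫ t : ℝ, ∫ z : Fin n → ℝ, f (Fin.cons t z) := by
  rw [← (measPres_cons n).integral_comp (measEmb_cons n)]
  exact integral_prod _ (integrable_cons hf)

/-- tensor convolution -/
def tconv {n : ℕ} (κ : Fin n → ℝ → ℝ) (F : (Fin n → ℝ) → E) (x : Fin n → ℝ) : E :=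
  ∫ y : Fin n → ℝ, (∏ i, κ i (y i)) • F (x + y)

lemma tconv_meas {n : ℕ} {τ : Type*} [MeasurableSpace τ] {κ : τ → Fin n → ℝ → ℝ}
    [SecondCountableTopology E] [MeasurableSpace E] [BorelSpace E]
    (hκ : ∀ i, Measurable (fun p : τ × ℝ => κ p.1 i p.2)) {G : τ → (Fin n → ℝ) → E}
    (hG : Measurable (fun p : τ × (Fin n → ℝ) => G p.1 p.2)) {X : τ → Fin n → ℝ} (hX : Measurable X) :
    Measurable (fun p => tconv (κ p) (G p) (X p)) := by
  apply StronglyMeasurable.measurable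
  refine StronglyMeasurable.integral_prod_right' (f := fun q : τ × (Fin n → ℝ) =>
    (∏ i, κ q.1 i (q.2 i)) • G q.1 (X q.1 + q.2)) ?_
  apply Measurable.stronglyMeasurable
  apply Measurable.smul
  · apply Finset.measurable_prod
    intro i _
    exact (hκ i).comp (measurable_fst.prodMk ((measurable_pi_apply i).comp measurable_snd))
  · exact hG.comp (measurable_fst.prodMk ((hX.comp measurable_fst).add measurable_snd))

lemma tprod_integrable {n : ℕ} {κ : Fin n → ℝ → ℝ} (hκ : ∀ i, Integrable (κ i)) :
    Integrable (fun y : Fin n → ℝ => ∏ i, κ i (y i)) :=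
  Integrable.fintype_prod hκ

lemma tconv_integrable {n : ℕ} {κ : Fin n → ℝ → ℝ} (hκ : ∀ i, Integrable (κ i))
    {F : (Fin n → ℝ) → E} [SecondCountableTopology E] [MeasurableSpace E] [BorelSpace E]
    (hF : Measurable F) {R : ℝ} (hR : ∀ x, ‖F x‖ ≤ R) (x : Fin n → ℝ) :
    Integrable (fun y : Fin n → ℝ => (∏ i, κ i (y i)) • F (x + y)) := by
  have h := tprod_integrable hκ
  refine Integrable.mono' (h.norm.mul_const R) ?_ ?_
  · exact h.aestronglyMeasurable.smul (hF.comp (measurable_const_add x)).stronglyMeasurable.aestronglyMeasurable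
  · refine Filter.Eventually.of_forall fun y => ?_
    rw [norm_smul]
    exact mul_le_mul_of_nonneg_left (hR _) (norm_nonneg _)

lemma tconv_bdd {n : ℕ} {κ : Fin n → ℝ → ℝ}
    {F : (Fin n → ℝ) → E} {R : ℝ} (hκ : ∀ i, Integrable (κ i)) (hR : ∀ x, ‖F x‖ ≤ R) (x : Fin n → ℝ) :
    ‖tconv κ F x‖ ≤ (∏ i, ∫ t, |κ i t|) * R := by
  have h := tprod_integrable hκ
  calc ‖tconv κ F x‖ ≤ ∫ y : Fin n → ℝ, ‖∏ i, κ i (y i)‖ * R := by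
        refine norm_integral_le_of_norm_le (h.norm.mul_const R) ?_
        refine Filter.Eventually.of_forall fun y => ?_
        rw [norm_smul]
        exact mul_le_mul_of_nonneg_left (hR _) (norm_nonneg _)
    _ = _ := by
        rw [integral_mul_const]
        congr 1
        rw [← integral_fintype_prod_volume_eq_prod]
        simp [Finset.abs_prod]

lemma tconv_cons {n : ℕ} {κ : Fin (n+1) → ℝ → ℝ} (hκ : ∀ i, Integrable (κ i))
    {F : (Fin (n+1) → ℝ) → E} [SecondCountableTopology E] [MeasurableSpace E] [BorelSpace E]
    (hF : Measurable F) {R : ℝ} (hR : ∀ x, ‖F x‖ ≤ R) (x0 : ℝ) (x : Fin n → ℝ) :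
    tconv κ F (Fin.cons x0 x) =
      ∫ t, κ 0 t • tconv (fun i => κ i.succ) (fun z => F (Fin.cons (x0 + t) z)) x := by
  unfold tconv
  rw [integral_cons (tconv_integrable hκ hF hR _)]
  congr 1
  funext t
  rw [← integral_smul]
  congr 1
  funext z
  rw [Fin.prod_univ_succ, smul_smul]
  simp only [Fin.cons_zero, Fin.cons_succ]
  congr 2
  funext i
  refine Fin.cases ?_ (fun j => ?_) i <;> simp

lemma tconv_ge {n : ℕ} {κ : Fin n → ℝ → ℝ} (hκ : ∀ i, Integrable (κ i)) (h0 : ∀ i t, 0 ≤ κ i t)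
    {W : (Fin n → ℝ) → ℝ} (hW : Measurable W) {ε N : ℝ} (hε : 0 < ε)
    (h1 : ∀ x, ε ≤ W x) (h2 : ∀ x, W x ≤ N) (x : Fin n → ℝ) :
    (∏ i, ∫ t, κ i t) * ε ≤ tconv κ W x ∧ tconv κ W x ≤ (∏ i, ∫ t, κ i t) * N := by
  have hi := tconv_integrable (E := ℝ) hκ hW (R := N) (fun x => by
    rw [Real.norm_of_nonneg (hε.le.trans (h1 x))]; exact h2 x) x
  have h := tprod_integrable hκ
  have hp : ∀ y : Fin n → ℝ, 0 ≤ ∏ i, κ i (y i) := fun y => Finset.prod_nonneg fun i _ => h0 _ _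
  rw [← integral_fintype_prod_volume_eq_prod, ← integral_mul_const, ← integral_mul_const]
  constructor
  · exact integral_mono (h.mul_const _) hi (fun y => mul_le_mul_of_nonneg_left (h1 _) (hp y))
  · exact integral_mono hi (h.mul_const _) (fun y => mul_le_mul_of_nonneg_left (h2 _) (hp y))

/-- the difference kernel -/
def qk (s y : ℝ) : ℝ := gk 2 s y - gk 4 s y

lemma qk_meas : Measurable (fun p : ℝ × ℝ => qk p.1 p.2) := (gk_meas 2).sub (gk_meas 4)
lemma qk_integrable (s : ℝ) : Integrable (fun y => qk s y) := (gk_integrable 2 s).sub (gk_integrable 4 s)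

/-- n-dimensional square function piece -/
def QN {n : ℕ} (s : Fin n → ℝ) (F : (Fin n → ℝ) → ℂ) (x : Fin n → ℝ) : ℂ :=
  tconv (fun i => qk (s i)) F x

/-- n-dimensional heat average -/
def PN {n : ℕ} (s : Fin n → ℝ) (W : (Fin n → ℝ) → ℝ) (x : Fin n → ℝ) : ℝ :=
  tconv (fun i => gk 4 (s i)) W x

lemma QN_meas {n : ℕ} {τ : Type*} [MeasurableSpace τ] {S X : τ → Fin n → ℝ} (hS : Measurable S)
    (hX : Measurable X) {G : τ → (Fin n → ℝ) → ℂ}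
    (hG : Measurable (fun p : τ × (Fin n → ℝ) => G p.1 p.2)) :
    Measurable (fun p => QN (S p) (G p) (X p)) := by
  refine tconv_meas (fun i => ?_) hG hX
  exact qk_meas.comp ((((measurable_pi_apply i).comp hS).comp measurable_fst).prodMk measurable_snd)

lemma PN_meas {n : ℕ} {τ : Type*} [MeasurableSpace τ] {S X : τ → Fin n → ℝ} (hS : Measurable S)
    (hX : Measurable X) {G : τ → (Fin n → ℝ) → ℝ}
    (hG : Measurable (fun p : τ × (Fin n → ℝ) => G p.1 p.2)) :
    Measurable (fun p => PN (S p) (G p) (X p)) := by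
  refine tconv_meas (fun i => ?_) hG hX
  exact (gk_meas 4).comp ((((measurable_pi_apply i).comp hS).comp measurable_fst).prodMk measurable_snd)

lemma PN_ge {n : ℕ} (s : Fin n → ℝ) {W : (Fin n → ℝ) → ℝ} (hW : Measurable W) {ε N : ℝ} (hε : 0 < ε)
    (h1 : ∀ x, ε ≤ W x) (h2 : ∀ x, W x ≤ N) (x : Fin n → ℝ) : ε ≤ PN s W x ∧ PN s W x ≤ N := by
  have := tconv_ge (κ := fun i => gk 4 (s i)) (fun i => gk_integrable 4 (s i))
    (fun i t => gk_nonneg _ _ _) hW hε h1 h2 x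
  simp only [gk_integral 4 (by norm_num), Finset.prod_const_one, one_mul] at this
  exact this

lemma qk_l1 (s : ℝ) : ∫ t, |qk s t| ≤ 2 := by
  calc ∫ t, |qk s t| ≤ ∫ t, (gk 2 s t + gk 4 s t) := by
        refine integral_mono (qk_integrable s).norm ((gk_integrable 2 s).add (gk_integrable 4 s)) fun t => ?_
        have h2 := gk_nonneg 2 s t
        have h4 := gk_nonneg 4 s t
        change |gk 2 s t - gk 4 s t| ≤ gk 2 s t + gk 4 s t
        rw [abs_le]; constructor <;> linarith
    _ = 2 := by
        rw [integral_add (gk_integrable 2 s) (gk_integrable 4 s), gk_integral 2 (by norm_num), gk_integral 4 (by norm_num)]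
        norm_num

lemma QN_bdd {n : ℕ} (s : Fin n → ℝ) {F : (Fin n → ℝ) → ℂ} {R : ℝ} (hR : ∀ x, ‖F x‖ ≤ R)
    (x : Fin n → ℝ) : ‖QN s F x‖ ≤ 2 ^ n * R := by
  have hR0 : 0 ≤ R := (norm_nonneg _).trans (hR 0)
  refine (tconv_bdd (κ := fun i => qk (s i)) (fun i => qk_integrable (s i)) hR x).trans ?_
  refine mul_le_mul_of_nonneg_right ?_ hR0
  calc ∏ i, ∫ t, |qk (s i) t| ≤ ∏ i : Fin n, (2:ℝ) :=
        Finset.prod_le_prod (fun i _ => integral_nonneg fun t => abs_nonneg _) (fun i _ => qk_l1 (s i))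
    _ = 2 ^ n := by simp

lemma QN_cons {n : ℕ} (s0 : ℝ) (s : Fin n → ℝ) {F : (Fin (n+1) → ℝ) → ℂ} (hF : Measurable F) {R : ℝ}
    (hR : ∀ x, ‖F x‖ ≤ R) (x0 : ℝ) (x : Fin n → ℝ) :
    QN (Fin.cons s0 s) F (Fin.cons x0 x) =
      Pg 2 s0 (fun t => QN s (fun z => F (Fin.cons t z)) x) x0 -
      Pg 4 s0 (fun t => QN s (fun z => F (Fin.cons t z)) x) x0 := by
  unfold QN
  rw [tconv_cons (fun i => qk_integrable _) hF hR]
  simp only [Fin.cons_zero, Fin.cons_succ]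
  unfold Pg
  have hm : Measurable (fun t => QN s (fun z => F (Fin.cons (x0 + t) z)) x) :=
    QN_meas measurable_const measurable_const (hF.comp (meas_cons (by fun_prop) measurable_snd))
  have hi : ∀ c, Integrable (fun t => gk c s0 t • QN s (fun z => F (Fin.cons (x0 + t) z)) x) := by
    intro c
    refine Integrable.mono' ((gk_integrable c s0).norm.mul_const (2 ^ n * R)) ?_ ?_
    · exact ((gk_meas1 c s0).smul hm).stronglyMeasurable.aestronglyMeasurable
    · refine Filter.Eventually.of_forall fun y => ?_
      rw [norm_smul]
      exact mul_le_mul_of_nonneg_left (QN_bdd s (fun z => hR _) x) (norm_nonneg _)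
  unfold QN at hi
  rw [← integral_sub (hi 2) (hi 4)]
  congr 1
  funext t
  rw [← sub_smul]; rfl

lemma PN_cons {n : ℕ} (s0 : ℝ) (s : Fin n → ℝ) {W : (Fin (n+1) → ℝ) → ℝ} (hW : Measurable W) {R : ℝ}
    (hR : ∀ x, ‖W x‖ ≤ R) (x0 : ℝ) (x : Fin n → ℝ) :
    PN (Fin.cons s0 s) W (Fin.cons x0 x) =
      Pg 4 s0 (fun t => PN s (fun z => W (Fin.cons t z)) x) x0 := by
  unfold PN
  rw [tconv_cons (fun i => gk_integrable 4 _) hW hR]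
  simp only [Fin.cons_zero, Fin.cons_succ]
  rfl

lemma vol_fin0 : (volume : Measure (Fin 0 → ℝ)) Set.univ = 1 := by
  rw [Measure.volume_pi_eq_dirac]; simp

lemma tconv_zero (κ : Fin 0 → ℝ → ℝ) (F : (Fin 0 → ℝ) → E) [CompleteSpace E] (x : Fin 0 → ℝ) : tconv κ F x = F x := by
  unfold tconv
  simp only [Finset.univ_eq_empty, Finset.prod_empty, one_smul]
  rw [integral_unique, Measure.real, vol_fin0, ENNReal.toReal_one, one_smul]
  exact congrArg F (Subsingleton.elim _ _)

lemma QN_zero (s : Fin 0 → ℝ) (F : (Fin 0 → ℝ) → ℂ) (x : Fin 0 → ℝ) : QN s F x = F x := tconv_zero _ _ _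
lemma PN_zero (s : Fin 0 → ℝ) (F : (Fin 0 → ℝ) → ℝ) (x : Fin 0 → ℝ) : PN s F x = F x := tconv_zero _ _ _

attribute [irreducible] QN PN

/-- Weighted multi-parameter square function estimate. -/
lemma sq_multi {a R ε N : ℝ} (hε : 0 < ε) (ha : 1 / 2 ≤ a) (ha1 : a < 1) : ∀ (n : ℕ)
    {F : (Fin n → ℝ) → ℂ} {W : (Fin n → ℝ) → ℝ} (_ : Measurable F) (_ : ∀ x, ‖F x‖ ≤ R)
    (_ : Measurable W) (_ : ∀ x, ε ≤ W x) (_ : ∀ x, W x ≤ N),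
    ∫⁻ s : Fin n → ℝ, ∫⁻ x, ENNReal.ofReal (‖QN s F x‖ ^ 2 * (PN s W x) ^ (-a)) ≤
      ENNReal.ofReal (Csq a) ^ n * ∫⁻ x, ENNReal.ofReal (‖F x‖ ^ 2 * (W x) ^ (-a)) := by
  intro n
  induction n with
  | zero =>
    intro F W hF hR hW h1 h2
    simp only [QN_zero, PN_zero, pow_zero, one_mul]
    rw [lintegral_const, vol_fin0, mul_one]
  | succ n ih =>
    intro F W hF hR hW h1 h2
    have hWR : ∀ x, ‖W x‖ ≤ N := fun x => by
      rw [Real.norm_of_nonneg (hε.le.trans (h1 x))]; exact h2 x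
    have hQm : Measurable (fun p : (Fin (n+1) → ℝ) × (Fin (n+1) → ℝ) =>
        ENNReal.ofReal (‖QN p.1 F p.2‖ ^ 2 * (PN p.1 W p.2) ^ (-a))) := by
      have := QN_meas (measurable_fst (α := Fin (n+1) → ℝ) (β := Fin (n+1) → ℝ)) measurable_snd
        (G := fun _ => F) (hF.comp measurable_snd)
      have := PN_meas (measurable_fst (α := Fin (n+1) → ℝ) (β := Fin (n+1) → ℝ)) measurable_snd
        (G := fun _ => W) (hW.comp measurable_snd)
      fun_prop
    have hFc : ∀ t, Measurable (fun z : Fin n → ℝ => F (Fin.cons t z)) := fun t =>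
      hF.comp (meas_cons measurable_const measurable_id)
    have hWc : ∀ t, Measurable (fun z : Fin n → ℝ => W (Fin.cons t z)) := fun t =>
      hW.comp (meas_cons measurable_const measurable_id)
    have hFW : Measurable (fun x => ENNReal.ofReal (‖F x‖ ^ 2 * (W x) ^ (-a))) := by fun_prop
    -- joint function
    have hH : Measurable (fun p : (Fin n → ℝ) × (Fin n → ℝ) × ℝ => ENNReal.ofReal
        (‖QN p.1 (fun z => F (Fin.cons p.2.2 z)) p.2.1‖ ^ 2 *
          (PN p.1 (fun z => W (Fin.cons p.2.2 z)) p.2.1) ^ (-a))) := by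
      have := QN_meas (τ := (Fin n → ℝ) × (Fin n → ℝ) × ℝ) measurable_fst measurable_snd.fst
        (G := fun p z => F (Fin.cons p.2.2 z))
        (hF.comp (meas_cons measurable_fst.snd.snd measurable_snd))
      have := PN_meas (τ := (Fin n → ℝ) × (Fin n → ℝ) × ℝ) measurable_fst measurable_snd.fst
        (G := fun p z => W (Fin.cons p.2.2 z))
        (hW.comp (meas_cons measurable_fst.snd.snd measurable_snd))
      fun_prop
    rw [lintegral_cons' (Measurable.lintegral_prod_right' hQm)]
    calc _ = ∫⁻ s : Fin n → ℝ, ∫⁻ s0 : ℝ, ∫⁻ x : Fin n → ℝ, ∫⁻ x0 : ℝ,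
            ENNReal.ofReal (‖QN (Fin.cons s0 s) F (Fin.cons x0 x)‖ ^ 2 *
              (PN (Fin.cons s0 s) W (Fin.cons x0 x)) ^ (-a)) := by
          refine lintegral_congr fun s => lintegral_congr fun s0 => ?_
          exact lintegral_cons' (hQm.comp (measurable_const.prodMk measurable_id))
      _ = ∫⁻ s : Fin n → ℝ, ∫⁻ x : Fin n → ℝ, ∫⁻ s0 : ℝ, ∫⁻ x0 : ℝ,
            ENNReal.ofReal (‖QN (Fin.cons s0 s) F (Fin.cons x0 x)‖ ^ 2 *
              (PN (Fin.cons s0 s) W (Fin.cons x0 x)) ^ (-a)) := by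
          refine lintegral_congr fun s => ?_
          rw [lintegral_lintegral_swap]
          apply Measurable.aemeasurable
          have hh : Measurable (fun p : (ℝ × (Fin n → ℝ)) × ℝ => ((Fin.cons p.1.1 s : Fin (n+1) → ℝ),
              (Fin.cons p.2 p.1.2 : Fin (n+1) → ℝ))) :=
            (meas_cons measurable_fst.fst measurable_const).prodMk
              (meas_cons measurable_snd measurable_fst.snd)
          have := hQm.comp hh
          exact Measurable.lintegral_prod_right' this
      _ ≤ ∫⁻ s : Fin n → ℝ, ∫⁻ x : Fin n → ℝ, ENNReal.ofReal (Csq a) * ∫⁻ t : ℝ, ENNReal.ofReal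
            (‖QN s (fun z => F (Fin.cons t z)) x‖ ^ 2 * (PN s (fun z => W (Fin.cons t z)) x) ^ (-a)) := by
          refine lintegral_mono fun s => lintegral_mono fun x => ?_
          have := sq_one (f := fun t => QN s (fun z => F (Fin.cons t z)) x)
            (W := fun t => PN s (fun z => W (Fin.cons t z)) x) (R := 2 ^ n * R) (ε := ε) (N := N)
            (QN_meas measurable_const measurable_const
              (hF.comp (meas_cons measurable_fst measurable_snd)))
            (fun t => QN_bdd s (fun z => hR _) x)
            (PN_meas measurable_const measurable_const
              (hW.comp (meas_cons measurable_fst measurable_snd)))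
            hε (fun t => (PN_ge s (hWc t) hε (fun z => h1 _) (fun z => h2 _) x).1)
            (fun t => (PN_ge s (hWc t) hε (fun z => h1 _) (fun z => h2 _) x).2) ha ha1
          refine le_trans (le_of_eq ?_) this
          simp only [QN_cons _ _ hF hR, PN_cons _ _ hW hWR]
      _ = ENNReal.ofReal (Csq a) * ∫⁻ s : Fin n → ℝ, ∫⁻ t : ℝ, ∫⁻ x : Fin n → ℝ, ENNReal.ofReal
            (‖QN s (fun z => F (Fin.cons t z)) x‖ ^ 2 * (PN s (fun z => W (Fin.cons t z)) x) ^ (-a)) := by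
          rw [← lintegral_const_mul' _ _ ENNReal.ofReal_ne_top]
          refine lintegral_congr fun s => ?_
          rw [lintegral_const_mul' _ _ ENNReal.ofReal_ne_top, lintegral_lintegral_swap]
          exact (hH.comp (measurable_const.prodMk measurable_id)).aemeasurable
      _ = ENNReal.ofReal (Csq a) * ∫⁻ t : ℝ, ∫⁻ s : Fin n → ℝ, ∫⁻ x : Fin n → ℝ, ENNReal.ofReal
            (‖QN s (fun z => F (Fin.cons t z)) x‖ ^ 2 * (PN s (fun z => W (Fin.cons t z)) x) ^ (-a)) := by
          rw [lintegral_lintegral_swap]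
          apply Measurable.aemeasurable
          have hh : Measurable (fun p : ((Fin n → ℝ) × ℝ) × (Fin n → ℝ) => (p.1.1, p.2, p.1.2)) :=
            measurable_fst.fst.prodMk (measurable_snd.prodMk measurable_fst.snd)
          have := hH.comp hh
          exact Measurable.lintegral_prod_right' this
      _ ≤ ENNReal.ofReal (Csq a) * ∫⁻ t : ℝ, ENNReal.ofReal (Csq a) ^ n * ∫⁻ x : Fin n → ℝ,
            ENNReal.ofReal (‖F (Fin.cons t x)‖ ^ 2 * (W (Fin.cons t x)) ^ (-a)) := by
          refine mul_le_mul_right (lintegral_mono fun t => ?_) _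
          exact ih (hFc t) (fun z => hR _) (hWc t) (fun z => h1 _) (fun z => h2 _)
      _ = _ := by
          rw [lintegral_const_mul' _ _ (ENNReal.pow_ne_top ENNReal.ofReal_ne_top), ← mul_assoc, ← pow_succ',
            lintegral_cons hFW]

end TensorSquare

section Maximal

/-- Cauchy-type kernel at scale `2^s`. -/
def kk (s y : ℝ) : ℝ := (2:ℝ) ^ s / (((2:ℝ) ^ s) ^ 2 + y ^ 2)

lemma kk_nonneg (s y : ℝ) : 0 ≤ kk s y := by unfold kk; positivity
lemma kk_pos (s y : ℝ) : 0 < kk s y := by unfold kk; positivity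

lemma kk_meas : Measurable (fun p : ℝ × ℝ => kk p.1 p.2) := by
  unfold kk; fun_prop

lemma kk_meas1 (s : ℝ) : Measurable (fun y => kk s y) := by
  unfold kk; fun_prop

lemma kk_neg (s y : ℝ) : kk s (-y) = kk s y := by unfold kk; simp

lemma kk_ceil (s y : ℝ) : kk s y ≤ 2 * kk (⌈s⌉ : ℤ) y := by
  unfold kk
  have h1 : (2:ℝ) ^ s ≤ (2:ℝ) ^ ((⌈s⌉ : ℤ) : ℝ) := Real.rpow_le_rpow_of_exponent_le (by norm_num) (Int.le_ceil s)
  have h2 : (2:ℝ) ^ ((⌈s⌉ : ℤ) : ℝ) ≤ 2 * (2:ℝ) ^ s := by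
    calc (2:ℝ) ^ ((⌈s⌉ : ℤ) : ℝ) ≤ 2 ^ (s + 1) :=
          Real.rpow_le_rpow_of_exponent_le (by norm_num) (Int.ceil_lt_add_one s).le
      _ = 2 * 2 ^ s := by rw [Real.rpow_add (by norm_num), Real.rpow_one]; ring
  have h0 : (0:ℝ) < 2 ^ s := by positivity
  generalize (2:ℝ) ^ s = σ at *
  generalize (2:ℝ) ^ ((⌈s⌉ : ℤ) : ℝ) = τ at *
  have h3 : 0 < τ := h0.trans_le h1
  rw [← mul_div_assoc, div_le_div_iff₀ (by positivity) (by positivity)]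
  nlinarith [mul_nonneg (mul_nonneg h0.le h3.le) (sub_nonneg.mpr h2), mul_nonneg (sub_nonneg.mpr h1) (sq_nonneg y), mul_nonneg h3.le (sq_nonneg y)]

/-- normalized average on the ball of radius `2^j` -/
def avg (j : ℤ) (w : ℝ → ENNReal) (x : ℝ) : ENNReal :=
  ENNReal.ofReal ((2:ℝ) ^ (-j)) * ∫⁻ y in Metric.closedBall x ((2:ℝ) ^ j), w y

lemma avg_const (j : ℤ) (c : ENNReal) (x : ℝ) : avg j (fun _ => c) x = 2 * c := by
  unfold avg
  simp only [lintegral_const, Measure.restrict_apply, MeasurableSet.univ, Set.univ_inter, Real.volume_closedBall]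
  rw [mul_comm c, ← mul_assoc, ← ENNReal.ofReal_mul (by positivity)]
  congr 1
  rw [zpow_neg]
  field_simp
  simp

lemma avg_mono {w v : ℝ → ENNReal} (h : ∀ x, w x ≤ v x) (j : ℤ) (x : ℝ) : avg j w x ≤ avg j v x := by
  unfold avg
  gcongr
  exact h _

lemma weak_fin {w : ℝ → ENNReal} {l : ℝ} (hl : 0 < l) (J : ℕ) :
    volume {x | ∃ j : ℤ, j ≤ J ∧ ENNReal.ofReal l < avg j w x} ≤ ENNReal.ofReal (10 / l) * ∫⁻ x, w x := by
  set E := {x | ∃ j : ℤ, j ≤ J ∧ ENNReal.ofReal l < avg j w x} with hE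
  have hch : ∀ x, ∃ j : ℤ, x ∈ E → j ≤ J ∧ ENNReal.ofReal l < avg j w x := by
    intro x
    by_cases hx : x ∈ E
    · obtain ⟨j, hj⟩ := hx; exact ⟨j, fun _ => hj⟩
    · exact ⟨0, fun h => absurd h hx⟩
  choose j hj using hch
  obtain ⟨u, hu, hd, hc⟩ := Vitali.exists_disjoint_subfamily_covering_enlargement_closedBall E (fun x => x)
    (fun x => (2:ℝ) ^ (j x)) ((2:ℝ) ^ (J:ℤ)) (fun a ha => zpow_le_zpow_right₀ (by norm_num) (hj a ha).1) 5 (by norm_num)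
  have hcount : u.Countable := by
    refine hd.countable_of_nonempty_interior ?_
    intro a ha
    have hp : (0:ℝ) < 2 ^ (j a) := by positivity
    exact ⟨a, Metric.ball_subset_interior_closedBall (Metric.mem_ball_self hp)⟩
  have hsub : E ⊆ ⋃ b ∈ u, Metric.closedBall b (5 * (2:ℝ) ^ (j b)) := by
    intro x hx
    obtain ⟨b, hb, hsb⟩ := hc x hx
    simp only [Set.mem_iUnion]
    exact ⟨b, hb, hsb (Metric.mem_closedBall_self (by positivity))⟩
  have hball : ∀ b ∈ u, volume (Metric.closedBall b (5 * (2:ℝ) ^ (j b))) ≤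
      ENNReal.ofReal (10 / l) * ∫⁻ y in Metric.closedBall b ((2:ℝ) ^ (j b)), w y := by
    intro b hb
    have h := (hj b (hu hb)).2
    have hp : (0:ℝ) < 2 ^ (j b) := by positivity
    unfold avg at h
    rw [Real.volume_closedBall]
    have e : 2 * (5 * (2:ℝ) ^ (j b)) = (10 / l) * ((2:ℝ) ^ (j b) * l) := by field_simp; ring
    rw [e, ENNReal.ofReal_mul (by positivity), ENNReal.ofReal_mul (by positivity)]
    gcongr
    calc ENNReal.ofReal (2 ^ j b) * ENNReal.ofReal l ≤ ENNReal.ofReal (2 ^ j b) *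
          (ENNReal.ofReal (2 ^ (-j b)) * ∫⁻ y in Metric.closedBall b ((2:ℝ) ^ (j b)), w y) := by gcongr
      _ = _ := by
        rw [← mul_assoc, ← ENNReal.ofReal_mul (by positivity), zpow_neg, mul_inv_cancel₀ hp.ne', ENNReal.ofReal_one, one_mul]
  calc volume E ≤ volume (⋃ b ∈ u, Metric.closedBall b (5 * (2:ℝ) ^ (j b))) := measure_mono hsub
    _ ≤ ∑' b : u, volume (Metric.closedBall (b:ℝ) (5 * (2:ℝ) ^ (j b))) := measure_biUnion_le _ hcount _
    _ ≤ ∑' b : u, ENNReal.ofReal (10 / l) * ∫⁻ y in Metric.closedBall (b:ℝ) ((2:ℝ) ^ (j b)), w y :=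
        ENNReal.tsum_le_tsum fun b => hball b b.2
    _ = ENNReal.ofReal (10 / l) * ∫⁻ y in ⋃ b ∈ u, Metric.closedBall b ((2:ℝ) ^ (j b)), w y := by
        rw [ENNReal.tsum_mul_left, lintegral_biUnion hcount (fun b _ => measurableSet_closedBall) hd]
    _ ≤ _ := by
        gcongr
        exact Measure.restrict_le_self

lemma weak_all (w : ℝ → ENNReal) {l : ℝ} (hl : 0 < l) :
    volume {x | ENNReal.ofReal l < ⨆ j : ℤ, avg j w x} ≤ ENNReal.ofReal (10 / l) * ∫⁻ x, w x := by
  have : {x | ENNReal.ofReal l < ⨆ j : ℤ, avg j w x} =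
      ⋃ J : ℕ, {x | ∃ j : ℤ, j ≤ J ∧ ENNReal.ofReal l < avg j w x} := by
    ext x
    simp only [Set.mem_setOf_eq, lt_iSup_iff, Set.mem_iUnion]
    constructor
    · rintro ⟨j, hj⟩; exact ⟨j.toNat, j, Int.self_le_toNat j, hj⟩
    · rintro ⟨J, j, _, hj⟩; exact ⟨j, hj⟩
  rw [this, Directed.measure_iUnion]
  · exact iSup_le fun J => weak_fin hl J
  · apply Monotone.directed_le
    intro a b hab x ⟨j, hj, h⟩
    exact ⟨j, hj.trans (by exact_mod_cast hab), h⟩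

lemma weak_trunc {w : ℝ → ENNReal} (hw : Measurable w) {l : ℝ} (hl : 0 < l) :
    volume {x | ENNReal.ofReal (3 * l) < ⨆ j : ℤ, avg j w x} ≤
      ENNReal.ofReal (10 / l) * ∫⁻ x in {x | ENNReal.ofReal l < w x}, w x := by
  have hS : MeasurableSet {x | ENNReal.ofReal l < w x} := measurableSet_lt measurable_const hw
  rw [← lintegral_indicator hS]
  refine le_trans (measure_mono ?_) (weak_all _ hl)
  intro x hx
  simp only [Set.mem_setOf_eq, lt_iSup_iff] at hx ⊢
  obtain ⟨j, hj⟩ := hx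
  refine ⟨j, ?_⟩
  by_contra hcon
  push Not at hcon
  have : avg j w x ≤ avg j ({x | ENNReal.ofReal l < w x}.indicator w) x + avg j (fun _ => ENNReal.ofReal l) x := by
    unfold avg
    rw [← mul_add, ← lintegral_add_right _ measurable_const]
    gcongr with y
    by_cases hy : ENNReal.ofReal l < w y
    · rw [Set.indicator_of_mem (by exact hy)]; exact le_self_add
    · rw [Set.indicator_of_notMem (by exact hy)]; simpa using hy
  rw [avg_const] at this
  have h3 : ENNReal.ofReal (3 * l) = ENNReal.ofReal l + 2 * ENNReal.ofReal l := by
    rw [ENNReal.ofReal_mul (by norm_num)]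
    have : ENNReal.ofReal 3 = 1 + 2 := by rw [show (3:ℝ) = 1 + 2 by norm_num, ENNReal.ofReal_add] <;> simp
    rw [this]; ring
  rw [h3] at hj
  exact absurd (hj.trans_le (this.trans (by gcongr))) (lt_irrefl _)

lemma lc_real {g r : ℝ} (hg : 0 ≤ g) (hr : 0 < r) :
    ∫⁻ t in Set.Ioo 0 g, ENNReal.ofReal (t ^ (r - 1)) = ENNReal.ofReal (g ^ r / r) := by
  have hI : IntervalIntegrable (fun t : ℝ => t ^ (r - 1)) volume 0 g :=
    intervalIntegral.intervalIntegrable_rpow' (by linarith)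
  rw [← ofReal_integral_eq_lintegral_ofReal]
  · rw [← integral_Ioc_eq_integral_Ioo, ← intervalIntegral.integral_of_le hg, integral_rpow (by left; linarith)]
    rw [sub_add_cancel, Real.zero_rpow hr.ne', sub_zero]
  · exact (hI.1).mono_set Set.Ioo_subset_Ioc_self
  · refine (ae_restrict_iff' measurableSet_Ioo).mpr (Filter.Eventually.of_forall fun t ht => ?_)
    exact Real.rpow_nonneg ht.1.le _

lemma lc (G : ENNReal) {r : ℝ} (hr : 0 < r) :
    ∫⁻ t in Set.Ioi (0:ℝ), {t : ℝ | ENNReal.ofReal t < G}.indicator (fun t => ENNReal.ofReal (t ^ (r - 1))) t =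
      ENNReal.ofReal (1 / r) * G ^ r := by
  have hm : MeasurableSet {t : ℝ | ENNReal.ofReal t < G} := measurableSet_lt (by fun_prop) measurable_const
  rw [setLIntegral_indicator hm]
  have fin : ∀ g : ℝ, 0 ≤ g → {t : ℝ | ENNReal.ofReal t < ENNReal.ofReal g} ∩ Set.Ioi 0 = Set.Ioo 0 g := by
    intro g hg
    ext t
    simp only [Set.mem_inter_iff, Set.mem_setOf_eq, Set.mem_Ioi, Set.mem_Ioo]
    constructor
    · rintro ⟨h1, h2⟩
      exact ⟨h2, (ENNReal.ofReal_lt_ofReal_iff_of_nonneg h2.le).mp h1⟩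
    · rintro ⟨h1, h2⟩
      exact ⟨(ENNReal.ofReal_lt_ofReal_iff_of_nonneg h1.le).mpr h2, h1⟩
  by_cases hG : G = ⊤
  · subst hG
    rw [ENNReal.top_rpow_of_pos hr, ENNReal.mul_top (by simpa using hr)]
    rw [eq_top_iff]
    refine ENNReal.le_of_forall_nnreal_lt fun N _ => ?_
    have h1 : (N : ENNReal) = ENNReal.ofReal (((N * r) ^ (1/r)) ^ r / r) := by
      rw [← Real.rpow_mul (by positivity), one_div_mul_cancel hr.ne', Real.rpow_one, mul_div_assoc, div_self hr.ne', mul_one]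
      simp
    rw [h1, ← lc_real (by positivity) hr]
    refine lintegral_mono_set ?_
    intro t ht
    exact ⟨by simp, ht.1⟩
  · lift G to NNReal using hG
    have h : (G : ENNReal) = ENNReal.ofReal G := by simp
    rw [h, fin _ G.coe_nonneg, lc_real G.coe_nonneg hr, ENNReal.ofReal_rpow_of_nonneg G.coe_nonneg hr.le, ← ENNReal.ofReal_mul (by positivity)]
    congr 1
    ring

/-- constant in the strong type bound -/
def Cst (r : ℝ) : ENNReal := ENNReal.ofReal (30 * r * (1 / (r - 1))) * 3 ^ (r - 1)

lemma Cst_ne_top {r : ℝ} : Cst r ≠ ⊤ := by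
  unfold Cst
  apply ENNReal.mul_ne_top ENNReal.ofReal_ne_top
  by_cases h : 0 ≤ r - 1
  · exact ENNReal.rpow_ne_top_of_nonneg h (by simp)
  · push Not at h
    intro h3
    rw [ENNReal.rpow_eq_top_iff] at h3
    rcases h3 with h3 | h3
    · simp at h3
    · simp at h3

lemma avg_meas (j : ℤ) {w : ℝ → ENNReal} (hw : Measurable w) : Measurable (avg j w) := by
  unfold avg
  have : ∀ x, ∫⁻ y in Metric.closedBall x ((2:ℝ) ^ j), w y =
      ∫⁻ y, {p : ℝ × ℝ | |p.2 - p.1| ≤ (2:ℝ) ^ j}.indicator (fun p => w p.2) (x, y) := by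
    intro x
    rw [← lintegral_indicator measurableSet_closedBall]
    refine lintegral_congr fun y => ?_
    by_cases h : |y - x| ≤ (2:ℝ) ^ j
    · rw [Set.indicator_of_mem (by simpa [Real.dist_eq] using h), Set.indicator_of_mem (by simpa using h)]
    · rw [Set.indicator_of_notMem (by simpa [Real.dist_eq] using h), Set.indicator_of_notMem (by simpa using h)]
  simp only [this]
  apply Measurable.const_mul
  apply Measurable.lintegral_prod_right'
  apply Measurable.indicator (hw.comp measurable_snd)
  exact measurableSet_le (by fun_prop) measurable_const

lemma strong_avg {r : ℝ} (hr : 1 < r) {w : ℝ → ENNReal} (hw : Measurable w) :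
    ∫⁻ x, (⨆ j : ℤ, avg j w x) ^ r ≤ Cst r * ∫⁻ x, w x ^ r := by
  have hr0 : 0 < r := by linarith
  have hM : Measurable (fun x => ⨆ j : ℤ, avg j w x) := Measurable.iSup fun j => avg_meas j hw
  have e1 : ∀ G : ENNReal, G ^ r = ENNReal.ofReal r * ∫⁻ t in Set.Ioi (0:ℝ), {t : ℝ | ENNReal.ofReal t < G}.indicator
      (fun t => ENNReal.ofReal (t ^ (r - 1))) t := by
    intro G
    rw [lc G hr0, ← mul_assoc, ← ENNReal.ofReal_mul hr0.le, mul_one_div_cancel hr0.ne']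
    simp
  calc ∫⁻ x, (⨆ j : ℤ, avg j w x) ^ r = ENNReal.ofReal r * ∫⁻ x, ∫⁻ t in Set.Ioi (0:ℝ),
        {t : ℝ | ENNReal.ofReal t < ⨆ j : ℤ, avg j w x}.indicator (fun t => ENNReal.ofReal (t ^ (r - 1))) t := by
        rw [← lintegral_const_mul' _ _ ENNReal.ofReal_ne_top]
        exact lintegral_congr fun x => e1 _
    _ = ENNReal.ofReal r * ∫⁻ t in Set.Ioi (0:ℝ), ∫⁻ x,
        {t : ℝ | ENNReal.ofReal t < ⨆ j : ℤ, avg j w x}.indicator (fun t => ENNReal.ofReal (t ^ (r - 1))) t := by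
        rw [lintegral_lintegral_swap]
        apply Measurable.aemeasurable
        have : Measurable ({p : ℝ × ℝ | ENNReal.ofReal p.2 < ⨆ j : ℤ, avg j w p.1}.indicator
          (fun p => ENNReal.ofReal (p.2 ^ (r - 1)))) := by
          apply Measurable.indicator (by fun_prop)
          exact measurableSet_lt (by fun_prop) (hM.comp measurable_fst)
        exact this
    _ ≤ ENNReal.ofReal r * ∫⁻ t in Set.Ioi (0:ℝ), ENNReal.ofReal 30 * ∫⁻ x,
          w x * {t : ℝ | ENNReal.ofReal t < 3 * w x}.indicator (fun t => ENNReal.ofReal (t ^ (r - 1 - 1))) t := by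
        refine mul_le_mul_right (setLIntegral_mono' measurableSet_Ioi fun t ht => ?_) _
        have ht : 0 < t := ht
        have h3 : (3:ENNReal) = ENNReal.ofReal 3 := by simp
        have hset : ∀ x, ENNReal.ofReal t < 3 * w x ↔ ENNReal.ofReal (t/3) < w x := by
          intro x
          rw [ENNReal.ofReal_div_of_pos (by norm_num), ← h3, ENNReal.div_lt_iff (by simp) (by simp), mul_comm]
        have hS : MeasurableSet {x | ENNReal.ofReal (t/3) < w x} := measurableSet_lt measurable_const hw
        calc _ = ∫⁻ x in {x | ENNReal.ofReal t < ⨆ j : ℤ, avg j w x}, ENNReal.ofReal (t ^ (r - 1)) := by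
              rw [← lintegral_indicator (measurableSet_lt measurable_const hM)]
              rfl
          _ = ENNReal.ofReal (t ^ (r - 1)) * volume {x | ENNReal.ofReal t < ⨆ j : ℤ, avg j w x} := by simp
          _ ≤ ENNReal.ofReal (t ^ (r - 1)) * (ENNReal.ofReal (10 / (t/3)) * ∫⁻ x in {x | ENNReal.ofReal (t/3) < w x}, w x) := by
              have := weak_trunc hw (l := t/3) (by positivity)
              rw [mul_div_cancel₀ t (by norm_num : (3:ℝ) ≠ 0)] at this
              gcongr
          _ = ENNReal.ofReal 30 * (ENNReal.ofReal (t ^ (r - 1 - 1)) * ∫⁻ x in {x | ENNReal.ofReal (t/3) < w x}, w x) := by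
              rw [← mul_assoc, ← mul_assoc, ← ENNReal.ofReal_mul (by positivity), ← ENNReal.ofReal_mul (by positivity)]
              congr 2
              rw [Real.rpow_sub_one ht.ne' (r-1)]
              field_simp
              norm_num
          _ = _ := by
              congr 1
              rw [← lintegral_const_mul' _ _ ENNReal.ofReal_ne_top, ← lintegral_indicator hS]
              refine lintegral_congr fun x => ?_
              by_cases hx : ENNReal.ofReal (t/3) < w x
              · rw [Set.indicator_of_mem (by exact hx), Set.indicator_of_mem (by exact (hset x).mpr hx), mul_comm]
              · rw [Set.indicator_of_notMem (by exact hx), Set.indicator_of_notMem (by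
                  intro h; exact hx ((hset x).mp h)), mul_zero]
    _ = ENNReal.ofReal r * (ENNReal.ofReal 30 * ∫⁻ x, ∫⁻ t in Set.Ioi (0:ℝ),
          w x * {t : ℝ | ENNReal.ofReal t < 3 * w x}.indicator (fun t => ENNReal.ofReal (t ^ (r - 1 - 1))) t) := by
        rw [lintegral_const_mul' _ _ ENNReal.ofReal_ne_top, lintegral_lintegral_swap]
        apply Measurable.aemeasurable
        have : Measurable ({p : ℝ × ℝ | ENNReal.ofReal p.1 < 3 * w p.2}.indicator
          (fun p => ENNReal.ofReal (p.1 ^ (r - 1 - 1)))) := by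
          apply Measurable.indicator (by fun_prop)
          exact measurableSet_lt (by fun_prop) (by fun_prop)
        exact (hw.comp measurable_snd).mul this
    _ = Cst r * ∫⁻ x, w x ^ r := by
        have : ∀ x, ∫⁻ t in Set.Ioi (0:ℝ),
          w x * {t : ℝ | ENNReal.ofReal t < 3 * w x}.indicator (fun t => ENNReal.ofReal (t ^ (r - 1 - 1))) t
            = ENNReal.ofReal (1 / (r - 1)) * 3 ^ (r - 1) * w x ^ r := by
          intro x
          rw [lintegral_const_mul, lc _ (by linarith), ENNReal.mul_rpow_of_nonneg _ _ (by linarith)]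
          · have : w x * w x ^ (r - 1) = w x ^ r := by
              conv_rhs => rw [show r = 1 + (r - 1) by ring, ENNReal.rpow_add_of_nonneg _ _ (by norm_num) (by linarith), ENNReal.rpow_one]
            rw [← this]; ring
          · apply Measurable.indicator (by fun_prop)
            exact measurableSet_lt (by fun_prop) measurable_const
        simp only [this]
        rw [lintegral_const_mul _ (by fun_prop)]
        unfold Cst
        rw [ENNReal.ofReal_mul (by positivity), mul_comm (30:ℝ), ENNReal.ofReal_mul (by positivity)]
        ring

end Maximal

section MaximalN

lemma kk_le_series (j : ℤ) (y : ℝ) : ENNReal.ofReal (kk j y) ≤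
    ∑' m : ℕ, 4 * (2⁻¹ : ENNReal) ^ m * (ENNReal.ofReal ((2:ℝ) ^ (-(j + m))) *
      (Metric.closedBall (0:ℝ) ((2:ℝ) ^ (j + m))).indicator (fun _ => (1:ENNReal)) y) := by
  have hex : ∃ m : ℕ, |y| ≤ (2:ℝ) ^ (j + m) := by
    obtain ⟨m, hm⟩ := pow_unbounded_of_one_lt (|y| / (2:ℝ) ^ j) (one_lt_two (α := ℝ))
    refine ⟨m, ?_⟩
    rw [zpow_add₀ (by norm_num), zpow_natCast]
    rw [div_lt_iff₀ (by positivity)] at hm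
    linarith
  classical
  set m := Nat.find hex with hm
  have h1 : |y| ≤ (2:ℝ) ^ (j + m) := Nat.find_spec hex
  refine le_trans ?_ (ENNReal.le_tsum m)
  rw [Set.indicator_of_mem (by simpa using h1), mul_one]
  have e : 4 * (2⁻¹ : ENNReal) ^ m * ENNReal.ofReal ((2:ℝ) ^ (-(j + m))) =
      ENNReal.ofReal (4 * (2⁻¹:ℝ) ^ m * (2:ℝ) ^ (-(j + m : ℤ))) := by
    rw [ENNReal.ofReal_mul (by positivity), ENNReal.ofReal_mul (by norm_num), ENNReal.ofReal_pow (by norm_num),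
      ENNReal.ofReal_inv_of_pos (by norm_num)]
    simp
  rw [e]
  apply ENNReal.ofReal_le_ofReal
  unfold kk
  rw [Real.rpow_intCast]
  have hs : (0:ℝ) < (2:ℝ) ^ j := by positivity
  rw [neg_add, zpow_add₀ (by norm_num), zpow_neg, zpow_neg, zpow_natCast]
  set σ := (2:ℝ) ^ j with hσ
  rw [div_le_iff₀ (by positivity)]
  by_cases h0 : m = 0
  · rw [h0]
    simp only [pow_zero, mul_one, inv_one]
    have : σ ≤ σ⁻¹ * σ ^ 2 := by field_simp; exact le_refl _
    have h5 : 0 ≤ σ⁻¹ * y ^ 2 := by positivity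
    nlinarith
  · have h2 := Nat.find_min hex (m := m - 1) (by omega)
    push Not at h2
    have h3 : (2:ℝ) ^ (j + ((m - 1 : ℕ) : ℤ)) = σ * 2 ^ m / 2 := by
      rw [zpow_add₀ (by norm_num), zpow_natCast, ← hσ]
      obtain ⟨k, hk⟩ := Nat.exists_eq_succ_of_ne_zero h0
      rw [hk]
      simp [pow_succ]
      ring
    rw [h3] at h2
    have h4 : (σ * 2 ^ m / 2) ^ 2 ≤ y ^ 2 := by
      rw [← sq_abs y]
      gcongr
    have h6 : σ = 4 * (2⁻¹:ℝ) ^ m * (σ⁻¹ * (2 ^ m)⁻¹) * (σ * 2 ^ m / 2) ^ 2 := by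
      rw [inv_pow]; field_simp; norm_num
    calc σ = 4 * (2⁻¹:ℝ) ^ m * (σ⁻¹ * (2 ^ m)⁻¹) * (σ * 2 ^ m / 2) ^ 2 := h6
      _ ≤ 4 * (2⁻¹:ℝ) ^ m * (σ⁻¹ * (2 ^ m)⁻¹) * (σ ^ 2 + y ^ 2) := by
        gcongr
        nlinarith [sq_nonneg σ]

lemma kk_avg {w : ℝ → ENNReal} (hw : Measurable w) (j : ℤ) (x : ℝ) :
    ∫⁻ y, ENNReal.ofReal (kk j y) * w (x + y) ≤ 8 * ⨆ i : ℤ, avg i w x := by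
  have hb : ∀ r : ℝ, ∫⁻ y, (Metric.closedBall (0:ℝ) r).indicator (fun _ => (1:ENNReal)) y * w (x + y) =
      ∫⁻ y in Metric.closedBall x r, w y := by
    intro r
    rw [← lintegral_indicator measurableSet_closedBall, ← lintegral_add_left_eq_self ((Metric.closedBall x r).indicator w) x]
    refine lintegral_congr fun y => ?_
    by_cases h : |y| ≤ r
    · rw [Set.indicator_of_mem (by simpa using h), Set.indicator_of_mem (by simpa [Real.dist_eq] using h), one_mul]
    · rw [Set.indicator_of_notMem (by simpa using h), Set.indicator_of_notMem (by simpa [Real.dist_eq] using h), zero_mul]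
  calc ∫⁻ y, ENNReal.ofReal (kk j y) * w (x + y) ≤ ∫⁻ y, ∑' m : ℕ, 4 * (2⁻¹ : ENNReal) ^ m * (ENNReal.ofReal ((2:ℝ) ^ (-(j + m))) *
      ((Metric.closedBall (0:ℝ) ((2:ℝ) ^ (j + m))).indicator (fun _ => (1:ENNReal)) y * w (x + y))) := by
        refine lintegral_mono fun y => ?_
        refine (mul_le_mul_left (kk_le_series j y) _).trans (le_of_eq ?_)
        rw [← ENNReal.tsum_mul_right]
        congr 1
        funext m
        ring
    _ = ∑' m : ℕ, 4 * (2⁻¹ : ENNReal) ^ m * avg (j + m) w x := by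
        have hm : ∀ m : ℕ, Measurable (fun y => ((Metric.closedBall (0:ℝ) ((2:ℝ) ^ (j + m))).indicator (fun _ => (1:ENNReal)) y * w (x + y))) := fun m =>
          (measurable_const.indicator measurableSet_closedBall).mul (hw.comp (by fun_prop))
        rw [lintegral_tsum]
        · congr 1
          funext m
          rw [lintegral_const_mul _ ((hm m).const_mul _), lintegral_const_mul _ (hm m), hb]
          rfl
        · intro m
          exact (((hm m).const_mul _).const_mul _).aemeasurable
    _ ≤ ∑' m : ℕ, 4 * (2⁻¹ : ENNReal) ^ m * ⨆ i : ℤ, avg i w x := by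
        refine ENNReal.tsum_le_tsum fun m => ?_
        gcongr
        exact le_iSup (fun i => avg i w x) (j + m)
    _ = 8 * ⨆ i : ℤ, avg i w x := by
        rw [ENNReal.tsum_mul_right, ENNReal.tsum_mul_left, ENNReal.tsum_geometric, ENNReal.one_sub_inv_two, inv_inv]
        norm_num

/-- one-dimensional maximal operator -/
def M1 (w : ℝ → ENNReal) (x : ℝ) : ENNReal := ⨆ j : ℤ, ∫⁻ y, ENNReal.ofReal (kk j y) * w (x + y)

/-- strong maximal operator -/
def Mn {n : ℕ} (w : (Fin n → ℝ) → ENNReal) (x : Fin n → ℝ) : ENNReal :=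
  ⨆ j : Fin n → ℤ, ∫⁻ y : Fin n → ℝ, (∏ i, ENNReal.ofReal (kk (j i) (y i))) * w (x + y)

/-- constant -/
def Cst8 (r : ℝ) : ENNReal := 8 ^ r * Cst r

lemma Cst8_ne_top {r : ℝ} (hr : 1 < r) : Cst8 r ≠ ⊤ :=
  ENNReal.mul_ne_top (ENNReal.rpow_ne_top_of_nonneg (by linarith) (by simp)) Cst_ne_top

lemma strong_M1 {r : ℝ} (hr : 1 < r) {w : ℝ → ENNReal} (hw : Measurable w) :
    ∫⁻ x, M1 w x ^ r ≤ Cst8 r * ∫⁻ x, w x ^ r := by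
  unfold Cst8
  rw [mul_assoc]
  refine le_trans ?_ (mul_le_mul_right (strong_avg hr hw) _)
  rw [← lintegral_const_mul' _ _ (ENNReal.rpow_ne_top_of_nonneg (by linarith) (by simp))]
  refine lintegral_mono fun x => ?_
  rw [← ENNReal.mul_rpow_of_nonneg _ _ (by linarith)]
  exact ENNReal.rpow_le_rpow (iSup_le fun j => kk_avg hw j x) (by linarith)

lemma Mn_meas {n : ℕ} {τ : Type*} [MeasurableSpace τ] {G : τ → (Fin n → ℝ) → ENNReal}
    (hG : Measurable (fun p : τ × (Fin n → ℝ) => G p.1 p.2)) {X : τ → Fin n → ℝ} (hX : Measurable X) :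
    Measurable (fun p => Mn (G p) (X p)) := by
  unfold Mn
  apply Measurable.iSup
  intro j
  refine Measurable.lintegral_prod_right' (f := fun q : τ × (Fin n → ℝ) =>
    (∏ i, ENNReal.ofReal (kk (j i) (q.2 i))) * G q.1 (X q.1 + q.2)) ?_
  apply Measurable.mul
  · apply Finset.measurable_prod
    intro i _
    exact ((kk_meas1 _).comp ((measurable_pi_apply i).comp measurable_snd)).ennreal_ofReal
  · exact hG.comp (measurable_fst.prodMk ((hX.comp measurable_fst).add measurable_snd))

lemma Mn_zero (w : (Fin 0 → ℝ) → ENNReal) (x : Fin 0 → ℝ) : Mn w x = w x := by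
  unfold Mn
  simp only [Finset.univ_eq_empty, Finset.prod_empty, one_mul]
  rw [ciSup_unique]
  have : ∀ y : Fin 0 → ℝ, w (x + y) = w x := fun y => congrArg w (Subsingleton.elim _ _)
  simp only [this]
  rw [lintegral_const, vol_fin0, mul_one]

lemma kprod_meas {n : ℕ} (s : Fin n → ℝ) : Measurable (fun y : Fin n → ℝ => ∏ i, ENNReal.ofReal (kk (s i) (y i))) := by
  apply Finset.measurable_prod
  intro i _
  exact ((kk_meas1 _).comp (measurable_pi_apply i)).ennreal_ofReal

lemma Mn_cons {n : ℕ} {w : (Fin (n+1) → ℝ) → ENNReal} (hw : Measurable w) (x0 : ℝ) (x : Fin n → ℝ) :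
    Mn w (Fin.cons x0 x) ≤ M1 (fun t => Mn (fun z => w (Fin.cons t z)) x) x0 := by
  refine iSup_le fun j => ?_
  have hmm : Measurable (fun y : Fin (n+1) → ℝ => (∏ i, ENNReal.ofReal (kk (j i) (y i))) *
      w (Fin.cons x0 x + y)) := (kprod_meas _).mul (hw.comp (measurable_const_add _))
  rw [lintegral_cons hmm]
  refine le_trans ?_ (le_iSup (fun j : ℤ => ∫⁻ y, ENNReal.ofReal (kk j y) * (fun t => Mn (fun z => w (Fin.cons t z)) x) (x0 + y)) (j 0))
  refine lintegral_mono fun t => ?_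
  have : ∀ z : Fin n → ℝ, (∏ i, ENNReal.ofReal (kk (j i) ((Fin.cons t z : Fin (n+1) → ℝ) i))) *
      w (Fin.cons x0 x + Fin.cons t z) = ENNReal.ofReal (kk (j 0) t) * ((∏ i : Fin n, ENNReal.ofReal (kk (j i.succ) (z i))) *
        w (Fin.cons (x0 + t) (x + z))) := by
    intro z
    rw [Fin.prod_univ_succ, mul_assoc]
    simp only [Fin.cons_zero, Fin.cons_succ]
    congr 3
    funext i
    refine Fin.cases ?_ (fun j => ?_) i <;> simp
  simp only [this]
  rw [lintegral_const_mul' _ _ ENNReal.ofReal_ne_top]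
  gcongr
  exact le_iSup (fun j : Fin n → ℤ => ∫⁻ y : Fin n → ℝ, (∏ i, ENNReal.ofReal (kk (j i) (y i))) * w (Fin.cons (x0 + t) (x + y))) (fun i => j i.succ)

lemma strong_Mn {r : ℝ} (hr : 1 < r) : ∀ (n : ℕ) {w : (Fin n → ℝ) → ENNReal} (_ : Measurable w),
    ∫⁻ x, Mn w x ^ r ≤ Cst8 r ^ n * ∫⁻ x, w x ^ r := by
  intro n
  induction n with
  | zero => intro w hw; simp [Mn_zero]
  | succ n ih =>
    intro w hw
    have hM : Measurable (fun x => Mn w x) := Mn_meas (G := fun _ => w) (hw.comp measurable_snd) measurable_id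
    have hJ : Measurable (fun p : (Fin n → ℝ) × ℝ => Mn (fun z => w (Fin.cons p.2 z)) p.1) :=
      Mn_meas (G := fun p z => w (Fin.cons p.2 z)) (hw.comp (meas_cons measurable_fst.snd measurable_snd)) measurable_fst
    rw [lintegral_cons' (hM.pow_const r)]
    calc _ ≤ ∫⁻ x : Fin n → ℝ, ∫⁻ x0, M1 (fun t => Mn (fun z => w (Fin.cons t z)) x) x0 ^ r := by
          refine lintegral_mono fun x => lintegral_mono fun x0 => ?_
          exact ENNReal.rpow_le_rpow (Mn_cons hw x0 x) (by linarith)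
      _ ≤ ∫⁻ x : Fin n → ℝ, Cst8 r * ∫⁻ t : ℝ, Mn (fun z => w (Fin.cons t z)) x ^ r := by
          refine lintegral_mono fun x => strong_M1 hr ?_
          have := hJ.comp (measurable_const.prodMk measurable_id : Measurable (fun t : ℝ => (x, t)))
          exact this
      _ = Cst8 r * ∫⁻ t : ℝ, ∫⁻ x : Fin n → ℝ, Mn (fun z => w (Fin.cons t z)) x ^ r := by
          rw [lintegral_const_mul' _ _ (Cst8_ne_top hr), lintegral_lintegral_swap]
          exact (hJ.pow_const r).aemeasurable
      _ ≤ Cst8 r * ∫⁻ t : ℝ, Cst8 r ^ n * ∫⁻ z : Fin n → ℝ, w (Fin.cons t z) ^ r := by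
          refine mul_le_mul_right (lintegral_mono fun t => ?_) _
          exact ih (hw.comp (meas_cons measurable_const measurable_id))
      _ = _ := by
          rw [lintegral_const_mul' _ _ (ENNReal.pow_ne_top (Cst8_ne_top hr)), ← mul_assoc, ← pow_succ',
            lintegral_cons (hw.pow_const r)]

lemma Mn_dom {n : ℕ} (s : Fin n → ℝ) (w : (Fin n → ℝ) → ENNReal) (x : Fin n → ℝ) :
    ∫⁻ y : Fin n → ℝ, (∏ i, ENNReal.ofReal (kk (s i) (y i))) * w (x + y) ≤ 2 ^ n * Mn w x := by
  calc _ ≤ ∫⁻ y : Fin n → ℝ, 2 ^ n * ((∏ i, ENNReal.ofReal (kk ((⌈s i⌉ : ℤ) : ℝ) (y i))) * w (x + y)) := by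
        refine lintegral_mono fun y => ?_
        rw [← mul_assoc]
        gcongr
        calc ∏ i, ENNReal.ofReal (kk (s i) (y i)) ≤ ∏ i, (2 * ENNReal.ofReal (kk ((⌈s i⌉ : ℤ) : ℝ) (y i))) := by
              refine Finset.prod_le_prod' fun i _ => ?_
              refine (ENNReal.ofReal_le_ofReal (kk_ceil (s i) (y i))).trans (le_of_eq ?_)
              rw [ENNReal.ofReal_mul (by norm_num)]; simp
          _ = _ := by rw [Finset.prod_mul_distrib]; simp
    _ = 2 ^ n * ∫⁻ y : Fin n → ℝ, (∏ i, ENNReal.ofReal (kk ((⌈s i⌉ : ℤ) : ℝ) (y i))) * w (x + y) := by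
        rw [lintegral_const_mul' _ _ (by simp)]
    _ ≤ _ := by
        gcongr
        exact le_iSup (fun j : Fin n → ℤ => ∫⁻ y : Fin n → ℝ, (∏ i, ENNReal.ofReal (kk (j i) (y i))) * w (x + y)) (fun i => ⌈s i⌉)

end MaximalN

section Bilinear

lemma lintegral_tprod : ∀ {n : ℕ} {f : Fin n → ℝ → ENNReal} (_ : ∀ i, Measurable (f i)),
    ∫⁻ y : Fin n → ℝ, ∏ i, f i (y i) = ∏ i, ∫⁻ t, f i t := by
  intro n
  induction n with
  | zero => intro f hf; simp [vol_fin0]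
  | succ n ih =>
    intro f hf
    have hm : Measurable (fun y : Fin (n+1) → ℝ => ∏ i, f i (y i)) :=
      Finset.measurable_prod _ fun i _ => (hf i).comp (measurable_pi_apply i)
    have hm' : Measurable (fun y : Fin n → ℝ => ∏ i : Fin n, f i.succ (y i)) :=
      Finset.measurable_prod _ fun i _ => (hf i.succ).comp (measurable_pi_apply i)
    rw [lintegral_cons hm, Fin.prod_univ_succ, ← ih (fun i => hf i.succ), ← lintegral_mul_const _ (hf 0)]
    refine lintegral_congr fun t => ?_
    rw [← lintegral_const_mul _ hm']
    refine lintegral_congr fun z => ?_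
    rw [Fin.prod_univ_succ]
    simp

lemma kk_eq (s y : ℝ) : kk s y = ((2:ℝ) ^ s)⁻¹ * (1 + (y / (2:ℝ) ^ s) ^ 2)⁻¹ := by
  unfold kk
  have : (0:ℝ) < 2 ^ s := by positivity
  field_simp

lemma kk_integrable (s : ℝ) : Integrable (fun y => kk s y) := by
  simp only [kk_eq]
  exact (integrable_inv_one_add_sq.comp_div (by positivity)).const_mul _

lemma kk_integral (s : ℝ) : ∫ y, kk s y = Real.pi := by
  simp only [kk_eq]
  have hs : (0:ℝ) < 2 ^ s := by positivity
  rw [integral_const_mul, Measure.integral_comp_div (fun x : ℝ => (1 + x ^ 2)⁻¹), integral_univ_inv_one_add_sq,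
    abs_of_pos hs, smul_eq_mul, ← mul_assoc, inv_mul_cancel₀ hs.ne', one_mul]

lemma kk_lintegral (s : ℝ) : ∫⁻ y, ENNReal.ofReal (kk s y) = ENNReal.ofReal Real.pi := by
  rw [← ofReal_integral_eq_lintegral_ofReal (kk_integrable s) (Filter.Eventually.of_forall fun y => kk_nonneg s y), kk_integral]

/-- tensor kernel -/
def KP {n : ℕ} (s y : Fin n → ℝ) : ENNReal := ∏ i, ENNReal.ofReal (kk (s i) (y i))
/-- tensor Gaussian -/
def GP {n : ℕ} (s y : Fin n → ℝ) : ENNReal := ∏ i, ENNReal.ofReal (gk 4 (s i) (y i))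
/-- growth factor -/
def HP {n : ℕ} (s y : Fin n → ℝ) : ENNReal := ∏ i, ENNReal.ofReal (1 + (y i) ^ 2 / (4:ℝ) ^ (s i))

lemma KP_meas {n : ℕ} : Measurable (fun p : (Fin n → ℝ) × (Fin n → ℝ) => KP p.1 p.2) := by
  apply Finset.measurable_prod
  intro i _
  have hh : Measurable (fun p : (Fin n → ℝ) × (Fin n → ℝ) => (p.1 i, p.2 i)) := by fun_prop
  have := (kk_meas.comp hh).ennreal_ofReal
  exact this

lemma GP_meas {n : ℕ} : Measurable (fun p : (Fin n → ℝ) × (Fin n → ℝ) => GP p.1 p.2) := by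
  apply Finset.measurable_prod
  intro i _
  have hh : Measurable (fun p : (Fin n → ℝ) × (Fin n → ℝ) => (p.1 i, p.2 i)) := by fun_prop
  have := ((gk_meas 4).comp hh).ennreal_ofReal
  exact this

lemma KP_meas1 {n : ℕ} (s : Fin n → ℝ) : Measurable (fun y => KP s y) := by
  have := KP_meas.comp (measurable_const.prodMk measurable_id : Measurable (fun y : Fin n → ℝ => (s, y)))
  exact this
lemma GP_meas1 {n : ℕ} (s : Fin n → ℝ) : Measurable (fun y => GP s y) := by
  have := GP_meas.comp (measurable_const.prodMk measurable_id : Measurable (fun y : Fin n → ℝ => (s, y)))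
  exact this
lemma HP_meas1 {n : ℕ} (s : Fin n → ℝ) : Measurable (fun y => HP s y) := by
  unfold HP
  fun_prop

lemma KP_neg {n : ℕ} (s y : Fin n → ℝ) : KP s (-y) = KP s y := by
  unfold KP; simp [kk_neg]

lemma KP_lintegral {n : ℕ} (s : Fin n → ℝ) : ∫⁻ y, KP s y = ENNReal.ofReal Real.pi ^ n := by
  unfold KP
  rw [lintegral_tprod (f := fun i y => ENNReal.ofReal (kk (s i) y)) (fun i => (kk_meas1 _).ennreal_ofReal)]
  simp [kk_lintegral]

lemma kk_shift (s u z : ℝ) : kk s (u - z) ≤ 2 * (1 + z ^ 2 / (4:ℝ) ^ s) * kk s u := by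
  unfold kk
  have h4 : (4:ℝ) ^ s = ((2:ℝ) ^ s) ^ 2 := by
    rw [show (4:ℝ) = 2 ^ (2:ℝ) by norm_num, ← Real.rpow_natCast, ← Real.rpow_mul (by norm_num), ← Real.rpow_mul (by norm_num)]
    congr 1; push_cast; ring
  rw [h4]
  have : (0:ℝ) < 2 ^ s := by positivity
  generalize (2:ℝ) ^ s = σ at *
  have e : 2 * (1 + z ^ 2 / σ ^ 2) * (σ / (σ ^ 2 + u ^ 2)) = σ * (2 * (1 + z ^ 2 / σ ^ 2)) / (σ ^ 2 + u ^ 2) := by ring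
  rw [e, div_le_div_iff₀ (by positivity) (by positivity), mul_assoc]
  refine mul_le_mul_of_nonneg_left ?_ this.le
  have e2 : 2 * (1 + z ^ 2 / σ ^ 2) * (σ ^ 2 + (u - z) ^ 2) = 2 * σ ^ 2 + 2 * (u-z)^2 + 2 * z ^ 2 + 2 * (z ^ 2 / σ ^ 2) * (u - z) ^ 2 := by
    field_simp; ring
  rw [e2]
  have : 0 ≤ 2 * (z ^ 2 / σ ^ 2) * (u - z) ^ 2 := by positivity
  nlinarith [sq_nonneg (u - 2 * z), sq_nonneg σ]

lemma KP_shift {n : ℕ} (s u z : Fin n → ℝ) : KP s (u - z) ≤ 2 ^ n * HP s z * KP s u := by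
  unfold KP HP
  calc ∏ i, ENNReal.ofReal (kk (s i) ((u - z) i)) ≤
      ∏ i, (2 * ENNReal.ofReal (1 + (z i) ^ 2 / (4:ℝ) ^ (s i)) * ENNReal.ofReal (kk (s i) (u i))) := by
        refine Finset.prod_le_prod' fun i _ => ?_
        refine (ENNReal.ofReal_le_ofReal (kk_shift (s i) (u i) (z i))).trans (le_of_eq ?_)
        rw [ENNReal.ofReal_mul (by positivity), ENNReal.ofReal_mul (by norm_num)]; simp
    _ = _ := by rw [Finset.prod_mul_distrib, Finset.prod_mul_distrib]; simp

lemma gk_moment (s z : ℝ) : (1 + z ^ 2 / (4:ℝ) ^ s) * gk 4 s z ≤ 32 * gk 8 s z := by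
  rw [gk_eq, gk_eq]
  have hV : (0:ℝ) < 4 ^ s := by positivity
  set V := (4:ℝ) ^ s
  have hp := Real.pi_pos
  set t := z ^ 2 / V with ht
  have ht0 : 0 ≤ t := by positivity
  have e1 : -z ^ 2 / (2 * (((4:NNReal):ℝ) * V)) = - t / 8 := by rw [ht]; push_cast; field_simp; ring
  have e2 : -z ^ 2 / (2 * (((8:NNReal):ℝ) * V)) = - t / 16 := by rw [ht]; push_cast; field_simp; ring
  rw [e1, e2]
  have h1 : 1 + t ≤ 16 * Real.exp (t / 16) := by
    have := Real.add_one_le_exp (t / 16); linarith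
  have h2 : (1 + t) * Real.exp (-t / 8) ≤ 16 * Real.exp (-t/16) := by
    calc (1 + t) * Real.exp (-t / 8) ≤ 16 * Real.exp (t / 16) * Real.exp (-t / 8) := by gcongr
      _ = _ := by rw [mul_assoc, ← Real.exp_add]; congr 2; ring
  have h3 : (Real.sqrt (2 * Real.pi * (((4:NNReal):ℝ) * V)))⁻¹ ≤
      2 * (Real.sqrt (2 * Real.pi * (((8:NNReal):ℝ) * V)))⁻¹ := by
    have : Real.sqrt (2 * Real.pi * (((8:NNReal):ℝ) * V)) ≤ 2 * Real.sqrt (2 * Real.pi * (((4:NNReal):ℝ) * V)) := by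
      apply Real.sqrt_le_iff.mpr
      constructor
      · positivity
      · rw [mul_pow, Real.sq_sqrt (by positivity)]
        push_cast
        have := mul_pos hp hV
        nlinarith
    rw [← div_eq_mul_inv, inv_eq_one_div, div_le_div_iff₀ (by apply Real.sqrt_pos.mpr; push_cast; positivity) (by
      apply Real.sqrt_pos.mpr; push_cast; positivity)]
    linarith
  calc _ = (Real.sqrt (2 * Real.pi * (((4:NNReal):ℝ) * V)))⁻¹ * ((1 + t) * Real.exp (-t / 8)) := by ring
    _ ≤ (2 * (Real.sqrt (2 * Real.pi * (((8:NNReal):ℝ) * V)))⁻¹) * (16 * Real.exp (-t/16)) := by gcongr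
    _ = _ := by ring

lemma GPHP {n : ℕ} (s : Fin n → ℝ) : ∫⁻ z, HP s z * GP s z ≤ 32 ^ n := by
  have : ∀ z, HP s z * GP s z = ∏ i, (ENNReal.ofReal (1 + (z i) ^ 2 / (4:ℝ) ^ (s i)) * ENNReal.ofReal (gk 4 (s i) (z i))) := by
    intro z; unfold HP GP; rw [Finset.prod_mul_distrib]
  simp only [this]
  rw [lintegral_tprod (f := fun i y => ENNReal.ofReal (1 + y ^ 2 / (4:ℝ) ^ (s i)) * ENNReal.ofReal (gk 4 (s i) y))]
  · calc _ ≤ ∏ i : Fin n, (32 : ENNReal) := by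
          refine Finset.prod_le_prod' fun i _ => ?_
          calc _ ≤ ∫⁻ t, ENNReal.ofReal (32 * gk 8 (s i) t) := by
                refine lintegral_mono fun t => ?_
                beta_reduce
                rw [← ENNReal.ofReal_mul (by positivity)]
                exact ENNReal.ofReal_le_ofReal (gk_moment _ _)
            _ = 32 := by
                rw [← ofReal_integral_eq_lintegral_ofReal ((gk_integrable 8 _).const_mul _)
                  (Filter.Eventually.of_forall fun y => mul_nonneg (by norm_num) (gk_nonneg _ _ _)), integral_const_mul,
                  gk_integral 8 (by norm_num)]
                simp
      _ = _ := by simp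
  · intro i
    have := gk_meas1 4 (s i)
    fun_prop

lemma ofReal_PN {n : ℕ} (s : Fin n → ℝ) {W : (Fin n → ℝ) → ℝ} (hW : Measurable W) {N : ℝ}
    (h1 : ∀ x, 0 ≤ W x) (h2 : ∀ x, W x ≤ N) (x : Fin n → ℝ) :
    ENNReal.ofReal (PN s W x) = ∫⁻ z, GP s z * ENNReal.ofReal (W (x + z)) := by
  unfold PN tconv
  rw [ofReal_integral_eq_lintegral_ofReal]
  · refine lintegral_congr fun z => ?_
    rw [smul_eq_mul, ENNReal.ofReal_mul (Finset.prod_nonneg fun i _ => gk_nonneg _ _ _),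
      ENNReal.ofReal_prod_of_nonneg (fun i _ => gk_nonneg _ _ _)]
    rfl
  · exact tconv_integrable (fun i => gk_integrable 4 (s i)) hW (fun x => by
      rw [Real.norm_of_nonneg (h1 x)]; exact h2 x) x
  · exact Filter.Eventually.of_forall fun z => mul_nonneg (Finset.prod_nonneg fun i _ => gk_nonneg _ _ _) (h1 _)

section
variable {n : ℕ} {w U : (Fin n → ℝ) → ℝ} {ε N ε' N' : ℝ}

lemma conv_PN_le (s : Fin n → ℝ) (hw : Measurable w) (h1 : ∀ x, 0 ≤ w x) (h2 : ∀ x, w x ≤ N) (x : Fin n → ℝ) :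
    ∫⁻ y, KP s y * ENNReal.ofReal (PN s w (x + y)) ≤ 64 ^ n * ∫⁻ u, KP s u * ENNReal.ofReal (w (x + u)) := by
  have hK := KP_meas1 s
  have hG := GP_meas1 s
  have hH := HP_meas1 s
  calc ∫⁻ y, KP s y * ENNReal.ofReal (PN s w (x + y))
      = ∫⁻ y, ∫⁻ z, KP s y * (GP s z * ENNReal.ofReal (w (x + y + z))) := by
        refine lintegral_congr fun y => ?_
        rw [ofReal_PN s hw h1 h2, lintegral_const_mul]
        exact hG.mul (hw.comp (measurable_const_add _)).ennreal_ofReal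
    _ = ∫⁻ z, ∫⁻ y, KP s y * (GP s z * ENNReal.ofReal (w (x + y + z))) := by
        rw [lintegral_lintegral_swap]
        apply Measurable.aemeasurable
        exact (hK.comp measurable_fst).mul ((hG.comp measurable_snd).mul (hw.comp (by fun_prop)).ennreal_ofReal)
    _ = ∫⁻ z, ∫⁻ u, KP s (u - z) * (GP s z * ENNReal.ofReal (w (x + u))) := by
        refine lintegral_congr fun z => ?_
        rw [← lintegral_sub_right_eq_self _ z]
        refine lintegral_congr fun u => ?_
        rw [add_assoc, sub_add_cancel]
    _ ≤ ∫⁻ z, ∫⁻ u, (2 ^ n * (HP s z * GP s z)) * (KP s u * ENNReal.ofReal (w (x + u))) := by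
        refine lintegral_mono fun z => lintegral_mono fun u => ?_
        refine (mul_le_mul_left (KP_shift s u z) _).trans (le_of_eq ?_)
        ring
    _ = ∫⁻ z, (2 ^ n * (HP s z * GP s z)) * ∫⁻ u, (KP s u * ENNReal.ofReal (w (x + u))) := by
        refine lintegral_congr fun z => ?_
        rw [lintegral_const_mul]
        exact hK.mul (hw.comp (measurable_const_add _)).ennreal_ofReal
    _ = 2 ^ n * (∫⁻ z, (HP s z * GP s z)) * ∫⁻ u, (KP s u * ENNReal.ofReal (w (x + u))) := by
        have hHG : Measurable (fun z => HP s z * GP s z) := hH.mul hG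
        have hHG2 : Measurable (fun z => 2 ^ n * (HP s z * GP s z)) := hHG.const_mul _
        rw [lintegral_mul_const _ hHG2, lintegral_const_mul _ hHG]
    _ ≤ 2 ^ n * 32 ^ n * ∫⁻ u, (KP s u * ENNReal.ofReal (w (x + u))) := by
        gcongr
        exact GPHP s
    _ = _ := by rw [← mul_pow]; norm_num

/-- step (3) -/
lemma conv_mul_PN_le (s : Fin n → ℝ) (hw : Measurable w) (hU : Measurable U) (hε' : 0 < ε')
    (hU1 : ∀ x, ε' ≤ U x)
    (hwU : ∀ x, ∫⁻ u, KP s u * ENNReal.ofReal (w (x + u)) ≤ ENNReal.ofReal (U x)) (x : Fin n → ℝ) :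
    (∫⁻ u, KP s u * ENNReal.ofReal (w (x + u))) * ENNReal.ofReal (PN s (fun x => (U x)⁻¹) x) ≤ 64 ^ n := by
  have hK := KP_meas1 s
  have hG := GP_meas1 s
  have hH := HP_meas1 s
  have hUp : ∀ x, 0 < U x := fun x => hε'.trans_le (hU1 x)
  set κ := ∫⁻ u, KP s u * ENNReal.ofReal (w (x + u)) with hκ
  have hz : ∀ z, κ ≤ 2 ^ n * HP s z * ENNReal.ofReal (U (x + z)) := by
    intro z
    refine le_trans ?_ (mul_le_mul_right (hwU (x + z)) _)
    rw [← lintegral_const_mul]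
    · rw [hκ, ← lintegral_add_right_eq_self _ z]
      refine lintegral_mono fun u => ?_
      rw [← mul_assoc]
      have h := KP_shift s u (-z)
      rw [sub_neg_eq_add] at h
      have h' : HP s (-z) = HP s z := by unfold HP; simp
      rw [h'] at h
      refine (mul_le_mul_left h _).trans (le_of_eq ?_)
      rw [show x + (u + z) = x + z + u by abel]
    · exact hK.mul (hw.comp (measurable_const_add _)).ennreal_ofReal
  have hUi : Measurable (fun x => (U x)⁻¹) := hU.inv
  rw [ofReal_PN s hUi (N := ε'⁻¹) (fun x => inv_nonneg.mpr (hUp x).le) (fun x => inv_anti₀ hε' (hU1 x)),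
    ← lintegral_const_mul]
  · calc _ ≤ ∫⁻ z, 2 ^ n * (HP s z * GP s z) := by
          refine lintegral_mono fun z => ?_
          calc κ * (GP s z * ENNReal.ofReal (U (x + z))⁻¹) ≤
              (2 ^ n * HP s z * ENNReal.ofReal (U (x + z))) * (GP s z * ENNReal.ofReal (U (x + z))⁻¹) := by
                gcongr; exact hz z
            _ = 2 ^ n * (HP s z * GP s z) * (ENNReal.ofReal (U (x + z)) * ENNReal.ofReal (U (x + z))⁻¹) := by ring
            _ = _ := by
              rw [← ENNReal.ofReal_mul (hUp _).le, mul_inv_cancel₀ (hUp _).ne', ENNReal.ofReal_one, mul_one]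
      _ ≤ 2 ^ n * 32 ^ n := by
          have hHG : Measurable (fun z => HP s z * GP s z) := hH.mul hG
          rw [lintegral_const_mul _ hHG]
          gcongr
          exact GPHP s
      _ = _ := by rw [← mul_pow]; norm_num
  · exact hG.mul (hU.inv.comp (measurable_const_add _)).ennreal_ofReal

lemma rpow_tangent {v τ a : ℝ} (hv : 0 < v) (hτ : 0 < τ) (ha : 0 < a) (ha1 : a < 1) :
    v ^ a ≤ τ ^ a + τ ^ (a - 1) * v := by
  rcases le_total v τ with h | h
  · have := Real.rpow_le_rpow hv.le h ha.le
    have : 0 ≤ τ ^ (a - 1) * v := by positivity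
    linarith
  · have h1 : v ^ (a - 1) ≤ τ ^ (a - 1) := Real.rpow_le_rpow_of_nonpos hτ h (by linarith)
    have h2 : v ^ a = v ^ (a - 1) * v := by rw [Real.rpow_sub_one hv.ne']; field_simp
    rw [h2]
    have : 0 ≤ τ ^ a := by positivity
    nlinarith

/-- constant of `conv_rpow_le` -/
def Ccv (n : ℕ) : ENNReal := ENNReal.ofReal Real.pi ^ n + 64 ^ n * 64 ^ n

lemma conv_rpow_le {a : ℝ} (ha : 0 < a) (ha1 : a < 1) (s : Fin n → ℝ) (hw : Measurable w) (hε : 0 < ε)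
    (h1 : ∀ x, ε ≤ w x) (h2 : ∀ x, w x ≤ N) (hU : Measurable U) (hε' : 0 < ε')
    (hU1 : ∀ x, ε' ≤ U x) (hU2 : ∀ x, U x ≤ N')
    (hwU : ∀ x, ∫⁻ u, KP s u * ENNReal.ofReal (w (x + u)) ≤ ENNReal.ofReal (U x)) (x : Fin n → ℝ) :
    ∫⁻ y, KP s y * ENNReal.ofReal ((PN s w (x + y)) ^ a) ≤
      Ccv n * ENNReal.ofReal ((PN s (fun x => (U x)⁻¹) x) ^ (-a)) := by
  have hN' : 0 < N' := hε'.trans_le ((hU1 0).trans (hU2 0))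
  have hUp : ∀ x, 0 < U x := fun x => hε'.trans_le (hU1 x)
  set p := PN s (fun x => (U x)⁻¹) x with hp
  have hp0 : 0 < p := lt_of_lt_of_le (inv_pos.mpr hN') (PN_ge s hU.inv (inv_pos.mpr hN')
    (fun x => inv_anti₀ (hUp x) (hU2 x)) (fun x => inv_anti₀ hε' (hU1 x)) x).1
  have hv0 : ∀ y, 0 < PN s w y := fun y => hε.trans_le (PN_ge s hw hε h1 h2 y).1
  have hK := KP_meas1 s
  have hPm : Measurable (fun y => ENNReal.ofReal (PN s w (x + y))) :=
    (PN_meas measurable_const (measurable_const_add x) (G := fun _ => w) (hw.comp measurable_snd)).ennreal_ofReal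
  have hτ : 0 < p⁻¹ := inv_pos.mpr hp0
  calc _ ≤ ∫⁻ y, (ENNReal.ofReal (p⁻¹ ^ a) * KP s y + ENNReal.ofReal (p⁻¹ ^ (a - 1)) * (KP s y * ENNReal.ofReal (PN s w (x + y)))) := by
        refine lintegral_mono fun y => ?_
        calc _ ≤ KP s y * ENNReal.ofReal (p⁻¹ ^ a + p⁻¹ ^ (a - 1) * PN s w (x + y)) := by
              gcongr; exact rpow_tangent (hv0 _) hτ ha ha1
          _ = _ := by
              rw [ENNReal.ofReal_add (by positivity) (mul_nonneg (by positivity) (hv0 _).le),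
                ENNReal.ofReal_mul (by positivity)]
              ring
    _ = ENNReal.ofReal (p⁻¹ ^ a) * ENNReal.ofReal Real.pi ^ n + ENNReal.ofReal (p⁻¹ ^ (a - 1)) *
          ∫⁻ y, KP s y * ENNReal.ofReal (PN s w (x + y)) := by
        have hKP : Measurable (fun y => KP s y * ENNReal.ofReal (PN s w (x + y))) := hK.mul hPm
        have hKc : Measurable (fun y => ENNReal.ofReal (p⁻¹ ^ a) * KP s y) := hK.const_mul _
        rw [lintegral_add_left hKc, lintegral_const_mul _ hK, lintegral_const_mul _ hKP, KP_lintegral]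
    _ ≤ ENNReal.ofReal (p⁻¹ ^ a) * ENNReal.ofReal Real.pi ^ n + ENNReal.ofReal (p⁻¹ ^ (a - 1)) *
          (64 ^ n * (64 ^ n * ENNReal.ofReal p⁻¹)) := by
        gcongr
        refine (conv_PN_le s hw (fun x => hε.le.trans (h1 x)) h2 x).trans ?_
        gcongr
        have := conv_mul_PN_le s hw hU hε' hU1 hwU x
        rw [← hp] at this
        rw [ENNReal.ofReal_inv_of_pos hp0, ← div_eq_mul_inv]
        rwa [ENNReal.le_div_iff_mul_le (by left; simpa using hp0) (by left; simp)]
    _ = _ := by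
        have e1 : p ^ (-a) = p⁻¹ ^ a := by rw [Real.rpow_neg hp0.le, Real.inv_rpow hp0.le]
        have e2 : ENNReal.ofReal (p⁻¹ ^ a) = ENNReal.ofReal (p⁻¹ ^ (a - 1)) * ENNReal.ofReal p⁻¹ := by
          rw [← ENNReal.ofReal_mul (by positivity), Real.rpow_sub_one hτ.ne', div_mul_cancel₀ _ hτ.ne']
        rw [e1, Ccv, add_mul]
        rw [e2]
        ring
end

/-- the bilinear form controlling the multiplier -/
def Bf {n : ℕ} (f g : (Fin n → ℝ) → ℂ) : ENNReal :=
  ∫⁻ s : Fin n → ℝ, ∫⁻ x, ∫⁻ y, KP s y * (‖QN s f (x + y)‖ₑ * ‖QN s g x‖ₑ)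

lemma Bf_symm {n : ℕ} {f g : (Fin n → ℝ) → ℂ} (hf : Measurable f) (hg : Measurable g) : Bf f g = Bf g f := by
  unfold Bf
  refine lintegral_congr fun s => ?_
  have hK := KP_meas1 s
  have hfm : Measurable (fun x => ‖QN s f x‖ₑ) := (QN_meas measurable_const measurable_id (G := fun _ => f) (hf.comp measurable_snd)).enorm
  have hgm : Measurable (fun x => ‖QN s g x‖ₑ) := (QN_meas measurable_const measurable_id (G := fun _ => g) (hg.comp measurable_snd)).enorm
  rw [lintegral_lintegral_swap]
  · have : ∀ y, ∫⁻ x, KP s y * (‖QN s f (x + y)‖ₑ * ‖QN s g x‖ₑ) = ∫⁻ x, KP s (-y) * (‖QN s g (x + -y)‖ₑ * ‖QN s f x‖ₑ) := by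
      intro y
      rw [← lintegral_add_right_eq_self (fun x => KP s (-y) * (‖QN s g (x + -y)‖ₑ * ‖QN s f x‖ₑ)) y]
      refine lintegral_congr fun x => ?_
      rw [add_neg_cancel_right, KP_neg, mul_comm ‖QN s g x‖ₑ]
    simp only [this]
    rw [lintegral_neg_eq_self (fun y => ∫⁻ x, KP s y * (‖QN s g (x + y)‖ₑ * ‖QN s f x‖ₑ)), lintegral_lintegral_swap]
    apply Measurable.aemeasurable
    exact (hK.comp measurable_fst).mul ((hgm.comp (measurable_snd.add measurable_fst)).mul (hfm.comp measurable_snd))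
  · apply Measurable.aemeasurable
    exact (hK.comp measurable_snd).mul ((hfm.comp (measurable_fst.add measurable_snd)).mul (hgm.comp measurable_fst))

lemma amgm_enn {A B : ENNReal} {v l : ℝ} (hv : 0 < v) (hl : 0 < l) :
    A * B ≤ ENNReal.ofReal l * (A ^ 2 * ENNReal.ofReal v) + ENNReal.ofReal l⁻¹ * (B ^ 2 * ENNReal.ofReal v⁻¹) := by
  have hlv : 0 < l * v := mul_pos hl hv
  by_cases hA : A = ⊤
  · subst hA
    by_cases hB : B = 0
    · simp [hB]
    · have : ENNReal.ofReal l * ((⊤:ENNReal) ^ 2 * ENNReal.ofReal v) = ⊤ := by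
        rw [ENNReal.top_pow (by norm_num), ENNReal.top_mul (by simpa using hv), ENNReal.mul_top (by simpa using hl)]
      rw [this]; simp
  by_cases hB : B = ⊤
  · subst hB
    have : ENNReal.ofReal l⁻¹ * ((⊤:ENNReal) ^ 2 * ENNReal.ofReal v⁻¹) = ⊤ := by
        rw [ENNReal.top_pow (by norm_num), ENNReal.top_mul (by simpa using hv), ENNReal.mul_top (by simpa using hl)]
    rw [this]; simp
  lift A to NNReal using hA
  lift B to NNReal using hB
  rw [← ENNReal.ofReal_coe_nnreal (p := A), ← ENNReal.ofReal_coe_nnreal (p := B), ← ENNReal.ofReal_pow A.coe_nonneg,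
    ← ENNReal.ofReal_pow B.coe_nonneg, ← ENNReal.ofReal_mul (by positivity), ← ENNReal.ofReal_mul (by positivity),
    ← ENNReal.ofReal_mul (by positivity), ← ENNReal.ofReal_mul (by positivity), ← ENNReal.ofReal_mul (by positivity),
    ← ENNReal.ofReal_add (by positivity) (by positivity)]
  apply ENNReal.ofReal_le_ofReal
  have e : l * ((A:ℝ) ^ 2 * v) + l⁻¹ * ((B:ℝ) ^ 2 * v⁻¹) - A * B = (l * v)⁻¹ * ((l * v * A - B / 2) ^ 2 + 3 / 4 * B ^ 2) := by
    field_simp; ring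
  have : 0 ≤ (l * v)⁻¹ * ((l * v * A - B / 2) ^ 2 + 3 / 4 * (B:ℝ) ^ 2) := by positivity
  linarith

attribute [irreducible] KP GP HP

set_option maxHeartbeats 1000000 in
/-- Weighted estimate for the bilinear form. -/
lemma Bf_le {n : ℕ} {f g : (Fin n → ℝ) → ℂ} {w U : (Fin n → ℝ) → ℝ} {R ε N ε' N' a l : ℝ}
    (hf : Measurable f) (hfR : ∀ x, ‖f x‖ ≤ R) (hg : Measurable g) (hgR : ∀ x, ‖g x‖ ≤ R)
    (ha : 1 / 2 ≤ a) (ha1 : a < 1) (hl : 0 < l) (hw : Measurable w) (hε : 0 < ε)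
    (h1 : ∀ x, ε ≤ w x) (h2 : ∀ x, w x ≤ N) (hU : Measurable U) (hε' : 0 < ε')
    (hU1 : ∀ x, ε' ≤ U x) (hU2 : ∀ x, U x ≤ N')
    (hwU : ∀ s x, ∫⁻ u, KP s u * ENNReal.ofReal (w (x + u)) ≤ ENNReal.ofReal (U x)) :
    Bf f g ≤ ENNReal.ofReal l * (Ccv n * ENNReal.ofReal (Csq a) ^ n * ∫⁻ x, ENNReal.ofReal (‖f x‖ ^ 2 * (U x) ^ a)) +
      ENNReal.ofReal l⁻¹ * (ENNReal.ofReal Real.pi ^ n * ENNReal.ofReal (Csq a) ^ n *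
        ∫⁻ x, ENNReal.ofReal (‖g x‖ ^ 2 * (w x) ^ (-a))) := by
  have hN' : 0 < N' := hε'.trans_le ((hU1 0).trans (hU2 0))
  have hUp : ∀ x, 0 < U x := fun x => hε'.trans_le (hU1 x)
  have hv0 : ∀ s y, 0 < PN s w y := fun s y => hε.trans_le (PN_ge s hw hε h1 h2 y).1
  have hPm : Measurable (fun p : (Fin n → ℝ) × (Fin n → ℝ) => PN p.1 w p.2) :=
    PN_meas measurable_fst measurable_snd (G := fun _ => w) (hw.comp measurable_snd)
  have hfm : Measurable (fun p : (Fin n → ℝ) × (Fin n → ℝ) => ‖QN p.1 f p.2‖ₑ) :=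
    (QN_meas measurable_fst measurable_snd (G := fun _ => f) (hf.comp measurable_snd)).enorm
  have hgm : Measurable (fun p : (Fin n → ℝ) × (Fin n → ℝ) => ‖QN p.1 g p.2‖ₑ) :=
    (QN_meas measurable_fst measurable_snd (G := fun _ => g) (hg.comp measurable_snd)).enorm
  have hT1m : Measurable (fun p : (Fin n → ℝ) × (Fin n → ℝ) × (Fin n → ℝ) =>
      KP p.1 p.2.2 * (‖QN p.1 f (p.2.1 + p.2.2)‖ₑ ^ 2 * ENNReal.ofReal (PN p.1 w p.2.1 ^ a))) := by
    apply Measurable.mul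
    · have hh : Measurable (fun p : (Fin n → ℝ) × (Fin n → ℝ) × (Fin n → ℝ) => (p.1, p.2.2)) := by fun_prop
      have := KP_meas.comp hh
      exact this
    apply Measurable.mul (M := ENNReal) (f := fun p : (Fin n → ℝ) × (Fin n → ℝ) × (Fin n → ℝ) => ‖QN p.1 f (p.2.1 + p.2.2)‖ₑ ^ 2)
      (g := fun p => ENNReal.ofReal (PN p.1 w p.2.1 ^ a))
    · have hh : Measurable (fun p : (Fin n → ℝ) × (Fin n → ℝ) × (Fin n → ℝ) => (p.1, p.2.1 + p.2.2)) := by fun_prop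
      have := (hfm.comp hh).pow_const 2
      exact this
    · have hh : Measurable (fun p : (Fin n → ℝ) × (Fin n → ℝ) × (Fin n → ℝ) => (p.1, p.2.1)) := by fun_prop
      have := ((hPm.comp hh).pow_const a).ennreal_ofReal
      exact this
  -- pointwise
  have hpt : ∀ s x y, KP s y * (‖QN s f (x + y)‖ₑ * ‖QN s g x‖ₑ) ≤
      ENNReal.ofReal l * (KP s y * (‖QN s f (x + y)‖ₑ ^ 2 * ENNReal.ofReal (PN s w x ^ a))) +
      ENNReal.ofReal l⁻¹ * (KP s y * (‖QN s g x‖ₑ ^ 2 * ENNReal.ofReal (PN s w x ^ (-a)))) := by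
    intro s x y
    have hva : 0 < PN s w x ^ a := Real.rpow_pos_of_pos (hv0 s x) _
    have := amgm_enn (A := ‖QN s f (x + y)‖ₑ) (B := ‖QN s g x‖ₑ) hva hl
    rw [← Real.rpow_neg (hv0 s x).le] at this
    refine (mul_le_mul_right this _).trans (le_of_eq ?_)
    ring
  have hconv : ∀ (s : Fin n → ℝ) (F : (Fin n → ℝ) → ℂ) (t : ℝ) (x : Fin n → ℝ),
      ‖QN s F x‖ₑ ^ 2 * ENNReal.ofReal t = ENNReal.ofReal (‖QN s F x‖ ^ 2 * t) := by
    intro s F t x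
    rw [ENNReal.ofReal_mul (by positivity), ENNReal.ofReal_pow (norm_nonneg _), ofReal_norm]
  calc Bf f g ≤ ∫⁻ s : Fin n → ℝ, ∫⁻ x, ∫⁻ y, (ENNReal.ofReal l * (KP s y * (‖QN s f (x + y)‖ₑ ^ 2 * ENNReal.ofReal (PN s w x ^ a))) +
      ENNReal.ofReal l⁻¹ * (KP s y * (‖QN s g x‖ₑ ^ 2 * ENNReal.ofReal (PN s w x ^ (-a))))) :=
        lintegral_mono fun s => lintegral_mono fun x => lintegral_mono fun y => hpt s x y
    _ = ENNReal.ofReal l * (∫⁻ s : Fin n → ℝ, ∫⁻ x, ∫⁻ y, KP s y * (‖QN s f (x + y)‖ₑ ^ 2 * ENNReal.ofReal (PN s w x ^ a))) +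
      ENNReal.ofReal l⁻¹ * ∫⁻ s : Fin n → ℝ, ∫⁻ x, ∫⁻ y, KP s y * (‖QN s g x‖ₑ ^ 2 * ENNReal.ofReal (PN s w x ^ (-a))) := by
        have m1 : ∀ s x, Measurable (fun y => KP s y * (‖QN s f (x + y)‖ₑ ^ 2 * ENNReal.ofReal (PN s w x ^ a))) := by
          intro s x
          have := hT1m.comp (measurable_const.prodMk (measurable_const.prodMk measurable_id) : Measurable (fun y : Fin n → ℝ => (s, x, y)))
          exact this
        have m2 : ∀ s, Measurable (fun x => ∫⁻ y, KP s y * (‖QN s f (x + y)‖ₑ ^ 2 * ENNReal.ofReal (PN s w x ^ a))) := by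
          intro s
          have := hT1m.comp (measurable_const.prodMk measurable_id : Measurable (fun p : (Fin n → ℝ) × (Fin n → ℝ) => (s, p)))
          exact Measurable.lintegral_prod_right' this
        have m3 : Measurable (fun s : Fin n → ℝ => ∫⁻ x, ∫⁻ y, KP s y * (‖QN s f (x + y)‖ₑ ^ 2 * ENNReal.ofReal (PN s w x ^ a))) := by
          have hh : Measurable (fun p : ((Fin n → ℝ) × (Fin n → ℝ)) × (Fin n → ℝ) => (p.1.1, p.1.2, p.2)) := by fun_prop
          have h2 := hT1m.comp hh
          have h3 : Measurable (fun p : (Fin n → ℝ) × (Fin n → ℝ) => ∫⁻ y, KP p.1 y * (‖QN p.1 f (p.2 + y)‖ₑ ^ 2 * ENNReal.ofReal (PN p.1 w p.2 ^ a))) :=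
            Measurable.lintegral_prod_right' h2
          exact Measurable.lintegral_prod_right' h3
        rw [← lintegral_const_mul' _ _ ENNReal.ofReal_ne_top, ← lintegral_const_mul' _ _ ENNReal.ofReal_ne_top,
          ← lintegral_add_left (m3.const_mul _)]
        refine lintegral_congr fun s => ?_
        rw [← lintegral_const_mul' _ _ ENNReal.ofReal_ne_top, ← lintegral_const_mul' _ _ ENNReal.ofReal_ne_top,
          ← lintegral_add_left ((m2 s).const_mul _)]
        refine lintegral_congr fun x => ?_
        rw [← lintegral_const_mul' _ _ ENNReal.ofReal_ne_top, ← lintegral_const_mul' _ _ ENNReal.ofReal_ne_top,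
          ← lintegral_add_left ((m1 s x).const_mul _)]
    _ ≤ _ := by
        refine add_le_add (mul_le_mul_right ?_ _) (mul_le_mul_right ?_ _)
        · calc _ = ∫⁻ s : Fin n → ℝ, ∫⁻ x, ‖QN s f x‖ₑ ^ 2 * ∫⁻ y, KP s y * ENNReal.ofReal (PN s w (x + y) ^ a) := by
                refine lintegral_congr fun s => ?_
                have m2 := hT1m.comp (measurable_const.prodMk measurable_id : Measurable (fun p : (Fin n → ℝ) × (Fin n → ℝ) => (s, p)))
                have hPs : Measurable (fun x => PN s w x) :=
                  hPm.comp (measurable_const.prodMk measurable_id : Measurable (fun y : Fin n → ℝ => (s, y)))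
                have hfs : Measurable (fun x => ‖QN s f x‖ₑ) :=
                  hfm.comp (measurable_const.prodMk measurable_id : Measurable (fun y : Fin n → ℝ => (s, y)))
                have hK := KP_meas1 s
                have m3 : AEMeasurable (Function.uncurry (fun x y => KP s y * (‖QN s f (x + y)‖ₑ ^ 2 * ENNReal.ofReal (PN s w x ^ a)))) (volume.prod volume) := m2.aemeasurable
                rw [lintegral_lintegral_swap m3]
                have : ∀ y, ∫⁻ x, KP s y * (‖QN s f (x + y)‖ₑ ^ 2 * ENNReal.ofReal (PN s w x ^ a)) =
                    ∫⁻ x, KP s (-y) * (‖QN s f x‖ₑ ^ 2 * ENNReal.ofReal (PN s w (x + -y) ^ a)) := by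
                  intro y
                  rw [← lintegral_add_right_eq_self (fun x => KP s (-y) * (‖QN s f x‖ₑ ^ 2 * ENNReal.ofReal (PN s w (x + -y) ^ a))) y]
                  refine lintegral_congr fun x => ?_
                  rw [add_neg_cancel_right, KP_neg]
                simp only [this]
                rw [lintegral_neg_eq_self (fun y => ∫⁻ x, KP s y * (‖QN s f x‖ₑ ^ 2 * ENNReal.ofReal (PN s w (x + y) ^ a))), lintegral_lintegral_swap]
                · refine lintegral_congr fun x => ?_
                  rw [← lintegral_const_mul]
                  · refine lintegral_congr fun y => ?_
                    ring
                  · exact hK.mul ((hPs.comp (measurable_const_add x)).pow_const a).ennreal_ofReal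
                · apply Measurable.aemeasurable
                  exact (hK.comp measurable_fst).mul (((hfs.comp measurable_snd).pow_const 2).mul
                    ((hPs.comp (measurable_snd.add measurable_fst)).pow_const a).ennreal_ofReal)
            _ ≤ ∫⁻ s : Fin n → ℝ, ∫⁻ x, Ccv n * ENNReal.ofReal (‖QN s f x‖ ^ 2 * (PN s (fun x => (U x)⁻¹) x) ^ (-a)) := by
                refine lintegral_mono fun s => lintegral_mono fun x => ?_
                beta_reduce
                rw [← hconv, mul_left_comm]
                gcongr
                exact conv_rpow_le (by linarith) ha1 s hw hε h1 h2 hU hε' hU1 hU2 (hwU s) x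
            _ = Ccv n * ∫⁻ s : Fin n → ℝ, ∫⁻ x, ENNReal.ofReal (‖QN s f x‖ ^ 2 * (PN s (fun x => (U x)⁻¹) x) ^ (-a)) := by
                have : Ccv n ≠ ⊤ := by
                  unfold Ccv
                  exact ENNReal.add_ne_top.mpr ⟨ENNReal.pow_ne_top ENNReal.ofReal_ne_top, ENNReal.mul_ne_top (by simp) (by simp)⟩
                rw [← lintegral_const_mul' _ _ this]
                refine lintegral_congr fun s => ?_
                rw [← lintegral_const_mul' _ _ this]
            _ ≤ Ccv n * (ENNReal.ofReal (Csq a) ^ n * ∫⁻ x, ENNReal.ofReal (‖f x‖ ^ 2 * ((U x)⁻¹) ^ (-a))) := by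
                gcongr
                exact sq_multi (inv_pos.mpr hN') ha ha1 n hf hfR (hU.inv : Measurable (fun x => (U x)⁻¹)) (fun x => inv_anti₀ (hUp x) (hU2 x)) (fun x => inv_anti₀ hε' (hU1 x))
            _ = _ := by
                rw [mul_assoc]
                congr 3
                funext x
                rw [Real.inv_rpow (hUp x).le, Real.rpow_neg (hUp x).le, inv_inv]
        · calc _ = ∫⁻ s : Fin n → ℝ, ∫⁻ x, ENNReal.ofReal Real.pi ^ n * ENNReal.ofReal (‖QN s g x‖ ^ 2 * (PN s w x) ^ (-a)) := by
                refine lintegral_congr fun s => lintegral_congr fun x => ?_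
                rw [lintegral_mul_const _ (KP_meas1 s), KP_lintegral, hconv]
            _ = ENNReal.ofReal Real.pi ^ n * ∫⁻ s : Fin n → ℝ, ∫⁻ x, ENNReal.ofReal (‖QN s g x‖ ^ 2 * (PN s w x) ^ (-a)) := by
                rw [← lintegral_const_mul' _ _ (ENNReal.pow_ne_top ENNReal.ofReal_ne_top)]
                refine lintegral_congr fun s => ?_
                rw [← lintegral_const_mul' _ _ (ENNReal.pow_ne_top ENNReal.ofReal_ne_top)]
            _ ≤ _ := by
                rw [mul_assoc]
                gcongr
                exact sq_multi hε ha ha1 n hg hgR hw h1 h2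

end Bilinear

section BilinearLq

lemma opt_lambda {B C1 C2 X Y : ENNReal} (hC1 : C1 ≠ ⊤) (hC2 : C2 ≠ ⊤) (hX : X ≠ ⊤) (hY : Y ≠ ⊤)
    (h : ∀ l : ℝ, 0 < l → B ≤ ENNReal.ofReal l * (C1 * X) + ENNReal.ofReal l⁻¹ * (C2 * Y)) :
    B ≤ (C1 + C2) * (X * Y) ^ (1 / 2 : ℝ) := by
  lift C1 to NNReal using hC1
  lift C2 to NNReal using hC2
  lift X to NNReal using hX
  lift Y to NNReal using hY
  have hB : B ≠ ⊤ := by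
    refine ne_top_of_le_ne_top ?_ (h 1 one_pos)
    simp [ENNReal.mul_eq_top]
  lift B to NNReal using hB
  have h' : ∀ l : ℝ, 0 < l → (B:ℝ) ≤ l * (C1 * X) + l⁻¹ * (C2 * Y) := by
    intro l hl
    have := h l hl
    have e : ENNReal.ofReal l * (C1 * X) + ENNReal.ofReal l⁻¹ * (C2 * Y) =
        ENNReal.ofReal (l * (C1 * X) + l⁻¹ * (C2 * Y)) := by
      rw [ENNReal.ofReal_add (by positivity) (by positivity), ENNReal.ofReal_mul hl.le,
        ENNReal.ofReal_mul (inv_pos.mpr hl).le, ENNReal.ofReal_mul C1.coe_nonneg, ENNReal.ofReal_mul C2.coe_nonneg]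
      simp
    rw [e, ← ENNReal.ofReal_coe_nnreal] at this
    exact (ENNReal.ofReal_le_ofReal_iff (by positivity)).mp this
  have key : (B:ℝ) ≤ (C1 + C2) * Real.sqrt (X * Y) := by
    rcases eq_or_lt_of_le X.coe_nonneg with hx | hx
    · rw [← hx] at h' ⊢
      simp only [mul_zero, zero_mul, zero_add, Real.sqrt_zero] at h' ⊢
      by_contra hb
      push Not at hb
      have h2 := h' ((2 * (C2 * Y + 1)) / B) (by positivity)
      rw [inv_div] at h2
      have : (B:ℝ) / (2 * (C2 * Y + 1)) * (C2 * Y) ≤ B / 2 := by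
        rw [div_mul_eq_mul_div, div_le_div_iff₀ (by positivity) (by positivity)]
        nlinarith
      linarith
    rcases eq_or_lt_of_le Y.coe_nonneg with hy | hy
    · rw [← hy] at h' ⊢
      simp only [mul_zero, add_zero, Real.sqrt_zero] at h' ⊢
      by_contra hb
      push Not at hb
      have h2 := h' (B / (2 * (C1 * X + 1))) (by positivity)
      have : (B:ℝ) / (2 * (C1 * X + 1)) * (C1 * X) ≤ B / 2 := by
        rw [div_mul_eq_mul_div, div_le_div_iff₀ (by positivity) (by positivity)]
        nlinarith
      linarith
    · have h2 := h' (Real.sqrt Y / Real.sqrt X) (by positivity)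
      refine h2.trans (le_of_eq ?_)
      have ex := Real.mul_self_sqrt hx.le
      have ey := Real.mul_self_sqrt hy.le
      rw [Real.sqrt_mul hx.le]
      have : 0 < Real.sqrt X := by positivity
      have : 0 < Real.sqrt Y := by positivity
      generalize Real.sqrt X = u at *
      generalize Real.sqrt Y = v at *
      rw [← ex, ← ey]
      field_simp
  rw [← ENNReal.ofReal_coe_nnreal]
  refine (ENNReal.ofReal_le_ofReal key).trans (le_of_eq ?_)
  rw [ENNReal.ofReal_mul (by positivity), ENNReal.ofReal_add (by positivity) (by positivity), Real.sqrt_eq_rpow,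
    ← ENNReal.ofReal_rpow_of_nonneg (by positivity) (by norm_num), ENNReal.ofReal_mul (by positivity)]
  simp

lemma Mn_le_const {n : ℕ} {w : (Fin n → ℝ) → ENNReal} {A : ENNReal} (hA : ∀ x, w x ≤ A) (x : Fin n → ℝ) :
    Mn w x ≤ ENNReal.ofReal Real.pi ^ n * A := by
  unfold Mn
  refine iSup_le fun j => ?_
  have hk := KP_lintegral (fun i => ((j i : ℤ) : ℝ))
  have hm := KP_meas1 (fun i => ((j i : ℤ) : ℝ))
  rw [← hk, ← lintegral_mul_const _ hm]
  refine lintegral_mono fun y => ?_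
  have e : KP (fun i => ((j i : ℤ) : ℝ)) y = ∏ i, ENNReal.ofReal (kk (j i) (y i)) := by unfold KP; rfl
  rw [e]
  gcongr
  exact hA _

lemma KP_Mn {n : ℕ} (s : Fin n → ℝ) (w : (Fin n → ℝ) → ENNReal) (x : Fin n → ℝ) :
    ∫⁻ y, KP s y * w (x + y) ≤ 2 ^ n * Mn w x := by
  have := Mn_dom s w x
  unfold KP; exact this

lemma Ccv_ne_top (n : ℕ) : Ccv n ≠ ⊤ := by
  unfold Ccv
  exact ENNReal.add_ne_top.mpr ⟨ENNReal.pow_ne_top ENNReal.ofReal_ne_top, ENNReal.mul_ne_top (by simp) (by simp)⟩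

lemma le_of_delta {B X K : ENNReal} (hK : K ≠ ⊤) (h : ∀ δ : ℝ, 0 < δ → B ≤ X + ENNReal.ofReal δ * K) : B ≤ X := by
  refine ENNReal.le_of_forall_pos_le_add fun ε hε _ => ?_
  lift K to NNReal using hK
  refine (h (ε / (K + 1)) (by positivity)).trans ?_
  gcongr
  rw [← ENNReal.ofReal_coe_nnreal, ← ENNReal.ofReal_coe_nnreal, ← ENNReal.ofReal_mul (by positivity)]
  apply ENNReal.ofReal_le_ofReal
  rw [div_mul_eq_mul_div, div_le_iff₀ (by positivity)]
  nlinarith [ε.coe_nonneg, K.coe_nonneg]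

lemma Bf_two {n : ℕ} {f g : (Fin n → ℝ) → ℂ} {R : ℝ}
    (hf : Measurable f) (hfR : ∀ x, ‖f x‖ ≤ R) (hg : Measurable g) (hgR : ∀ x, ‖g x‖ ≤ R)
    (hF : ∫⁻ x, ‖f x‖ₑ ^ (2:ℝ) ≠ ⊤) (hG : ∫⁻ x, ‖g x‖ₑ ^ (2:ℝ) ≠ ⊤) :
    Bf f g ≤ (Ccv n * ENNReal.ofReal (Csq (1/2)) ^ n * ENNReal.ofReal ((Real.pi ^ n) ^ (1/2:ℝ)) +
      ENNReal.ofReal Real.pi ^ n * ENNReal.ofReal (Csq (1/2)) ^ n) *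
        ((∫⁻ x, ‖f x‖ₑ ^ (2:ℝ)) ^ (1 / 2 : ℝ) * (∫⁻ x, ‖g x‖ₑ ^ (2:ℝ)) ^ (1 / 2 : ℝ)) := by
  rw [← ENNReal.mul_rpow_of_nonneg _ _ (by norm_num)]
  have hpi := Real.pi_pos
  refine opt_lambda ?_ ?_ hF hG ?_
  · exact ENNReal.mul_ne_top (ENNReal.mul_ne_top (Ccv_ne_top n) (by simp)) (by simp)
  · exact ENNReal.mul_ne_top (by simp) (by simp)
  intro l hl
  have := Bf_le (w := fun _ => 1) (U := fun _ => Real.pi ^ n) (a := 1/2) (ε := 1) (N := 1) (ε' := Real.pi ^ n) (N' := Real.pi ^ n) hf hfR hg hgR le_rfl (by norm_num) hl measurable_const one_pos (fun _ => le_rfl) (fun _ => le_rfl)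
    measurable_const (by positivity) (fun _ => le_rfl) (fun _ => le_rfl) (by
      intro s x
      rw [lintegral_mul_const _ (KP_meas1 s), KP_lintegral, ENNReal.ofReal_pow hpi.le]; simp)
  refine this.trans (le_of_eq ?_)
  have e1 : ∀ x, ENNReal.ofReal (‖f x‖ ^ 2 * (Real.pi ^ n) ^ (1/2:ℝ)) = ENNReal.ofReal ((Real.pi ^ n) ^ (1/2:ℝ)) * ‖f x‖ₑ ^ (2:ℝ) := by
    intro x
    rw [mul_comm, ENNReal.ofReal_mul (by positivity), ENNReal.ofReal_pow (norm_nonneg _), ofReal_norm]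
    norm_cast
  have e2 : ∀ x, ENNReal.ofReal (‖g x‖ ^ 2 * (1:ℝ) ^ (-(1/2:ℝ))) = ‖g x‖ₑ ^ (2:ℝ) := by
    intro x
    rw [Real.one_rpow, mul_one, ENNReal.ofReal_pow (norm_nonneg _), ofReal_norm]
    norm_cast
  simp only [e1, e2]
  rw [lintegral_const_mul' _ _ ENNReal.ofReal_ne_top]
  ring

set_option maxHeartbeats 1000000 in
lemma Bf_gt_two {n : ℕ} {q : ℝ} (hq : 2 < q) : ∃ C : ENNReal, C ≠ ⊤ ∧ ∀ {f g : (Fin n → ℝ) → ℂ} {R : ℝ}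
    (_ : Measurable f) (_ : ∀ x, ‖f x‖ ≤ R) (_ : Measurable g) (_ : ∀ x, ‖g x‖ ≤ R)
    (_ : ∫⁻ x, ‖f x‖ₑ ^ (2:ℝ) ≠ ⊤)
    (_ : ∫⁻ x, ‖f x‖ₑ ^ q ≠ ⊤) (_ : ∫⁻ x, ‖g x‖ₑ ^ (q / (q - 1)) ≠ ⊤),
    Bf f g ≤ C * ((∫⁻ x, ‖f x‖ₑ ^ q) ^ (1 / q) * (∫⁻ x, ‖g x‖ₑ ^ (q / (q - 1))) ^ (1 - 1 / q)) := by
  have hq0 : 0 < q := by linarith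
  have hq1 : 0 < q - 1 := by linarith
  have hq2 : 0 < q - 2 := by linarith
  set a : ℝ := 1 - 1 / q with ha
  set r : ℝ := q / (q - 2) with hr
  set b : ℝ := q * (q - 2) / (q - 1) ^ 2 with hb
  have haq : a = (q - 1) / q := by rw [ha]; field_simp
  have ha0 : 0 < a := by rw [haq]; positivity
  have ha1 : a < 1 := by rw [ha]; have : 0 < 1 / q := by positivity
                         linarith
  have hah : 1 / 2 ≤ a := by rw [haq, div_le_div_iff₀ (by norm_num) hq0]; linarith
  have hb0 : 0 < b := by positivity
  have hr0 : 0 < r := by positivity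
  have har : a * r = (q - 1) / (q - 2) := by rw [haq, hr]; field_simp
  have har1 : 1 < a * r := by rw [har, lt_div_iff₀ hq2]; linarith
  have hab : b * a = 2 - q / (q - 1) := by rw [haq, hb]; field_simp; ring
  have hbar : b * (a * r) = q / (q - 1) := by rw [har, hb]; field_simp
  have hconj : (q / 2).HolderConjugate r := by
    rw [Real.holderConjugate_iff]
    refine ⟨by linarith, ?_⟩
    rw [hr]; field_simp; ring
  have hpi := Real.pi_pos
  set C1 : ENNReal := Ccv n * ENNReal.ofReal (Csq a) ^ n with hC1
  set C2 : ENNReal := ENNReal.ofReal Real.pi ^ n * ENNReal.ofReal (Csq a) ^ n with hC2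
  set C3 : ENNReal := (((2:ENNReal) ^ n) ^ (a * r) * Cst8 (a * r) ^ n) ^ (1 / r) with hC3
  have hC1t : C1 ≠ ⊤ := ENNReal.mul_ne_top (Ccv_ne_top n) (by simp)
  have hC2t : C2 ≠ ⊤ := ENNReal.mul_ne_top (by simp) (by simp)
  have hC3t : C3 ≠ ⊤ := ENNReal.rpow_ne_top_of_nonneg (by positivity) (ENNReal.mul_ne_top
    (ENNReal.rpow_ne_top_of_nonneg (by positivity) (by simp)) (ENNReal.pow_ne_top (Cst8_ne_top har1)))
  refine ⟨C1 * C3 + C2, ENNReal.add_ne_top.mpr ⟨ENNReal.mul_ne_top hC1t hC3t, hC2t⟩, ?_⟩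
  intro f g R hf hfR hg hgR hF2 hF hG
  set F := ∫⁻ x, ‖f x‖ₑ ^ q with hFd
  set G := ∫⁻ x, ‖g x‖ₑ ^ (q / (q - 1)) with hGd
  have hXY : F ^ (1 / q) * G ^ (1 - 1 / q) = (F ^ (2 / q) * G ^ (1 / r) * G) ^ (1 / 2 : ℝ) := by
    rw [mul_assoc, ENNReal.mul_rpow_of_nonneg _ _ (by norm_num), ← ENNReal.rpow_mul]
    congr 1
    · congr 1; field_simp
    · nth_rewrite 3 [← ENNReal.rpow_one G]
      rw [← ENNReal.rpow_add_of_nonneg _ _ (by positivity) (by norm_num), ← ENNReal.rpow_mul]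
      congr 1; rw [hr]; field_simp; ring
  rw [ha.symm] at *
  rw [hXY]
  have hR0 : 0 ≤ R := (norm_nonneg _).trans (hfR 0)
  refine opt_lambda (ENNReal.mul_ne_top hC1t hC3t) hC2t (ENNReal.mul_ne_top (ENNReal.rpow_ne_top_of_nonneg (by positivity) hF) (ENNReal.rpow_ne_top_of_nonneg (by positivity) hG)) hG ?_
  intro l hl
  set w0 : (Fin n → ℝ) → ENNReal := fun x => ENNReal.ofReal (‖g x‖ ^ b) with hw0
  have hw0m : Measurable w0 := (hg.norm.pow_const b).ennreal_ofReal
  have hMm : Measurable (Mn w0) := by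
    have : Measurable (fun x => Mn w0 x) := Mn_meas (G := fun _ => w0) (hw0m.comp measurable_snd) measurable_id
    exact this
  have hMb : ∀ x, Mn w0 x ≤ ENNReal.ofReal (Real.pi ^ n * R ^ b) := by
    intro x
    rw [ENNReal.ofReal_mul (by positivity), ENNReal.ofReal_pow hpi.le]
    refine Mn_le_const (fun y => ENNReal.ofReal_le_ofReal ?_) x
    exact Real.rpow_le_rpow (norm_nonneg _) (hgR y) hb0.le
  have hMt : ∀ x, Mn w0 x ≠ ⊤ := fun x => ne_top_of_le_ne_top ENNReal.ofReal_ne_top (hMb x)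
  -- Hölder
  have hH : ∫⁻ x, ‖f x‖ₑ ^ (2:ℝ) * (2 ^ n * Mn w0 x) ^ a ≤ F ^ (2 / q) * (C3 * G ^ (1 / r)) := by
    have h2m : Measurable (fun x => (2 ^ n * Mn w0 x) ^ a) := (hMm.const_mul _).pow_const a
    have h := ENNReal.lintegral_mul_le_Lp_mul_Lq volume hconj (f := fun x => ‖f x‖ₑ ^ (2:ℝ))
      (g := fun x => (2 ^ n * Mn w0 x) ^ a) (hf.enorm.pow_const _).aemeasurable h2m.aemeasurable
    refine h.trans ?_
    have e1 : ∀ x, (‖f x‖ₑ ^ (2:ℝ)) ^ (q / 2) = ‖f x‖ₑ ^ q := by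
      intro x; rw [← ENNReal.rpow_mul]; congr 1; ring
    have e2 : ∀ x, ((2 ^ n * Mn w0 x) ^ a) ^ r = ((2:ENNReal) ^ n) ^ (a * r) * Mn w0 x ^ (a * r) := by
      intro x; rw [← ENNReal.rpow_mul, ENNReal.mul_rpow_of_nonneg _ _ (by positivity)]
    simp only [e1, e2]
    rw [one_div_div, hC3, ← ENNReal.mul_rpow_of_nonneg _ _ (by positivity)]
    gcongr
    rw [lintegral_const_mul' _ _ (ENNReal.rpow_ne_top_of_nonneg (by positivity) (by simp)), mul_assoc]
    gcongr
    refine (strong_Mn har1 n hw0m).trans (le_of_eq ?_)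
    congr 1
    refine lintegral_congr fun x => ?_
    rw [hw0]
    beta_reduce
    rw [← ENNReal.ofReal_rpow_of_nonneg (norm_nonneg _) hb0.le, ← ENNReal.rpow_mul, hbar, ofReal_norm]
  set K := ENNReal.ofReal l * (C1 * ∫⁻ x, ‖f x‖ₑ ^ (2:ℝ)) with hK
  have hKt : K ≠ ⊤ := ENNReal.mul_ne_top (by simp) (ENNReal.mul_ne_top hC1t hF2)
  refine le_of_delta hKt fun δ hδ => ?_
  set ε : ℝ := δ ^ a⁻¹ / Real.pi ^ n with hε
  have hε0 : 0 < ε := by positivity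
  have hεδ : (Real.pi ^ n * ε) ^ a = δ := by
    rw [hε, mul_div_cancel₀ _ (by positivity), Real.rpow_inv_rpow hδ.le ha0.ne']
  have hwm : Measurable (fun x => ‖g x‖ ^ b + ε) := (hg.norm.pow_const b).add_const _
  have hUm : Measurable (fun x => 2 ^ n * (Mn w0 x).toReal + Real.pi ^ n * ε) := (hMm.ennreal_toReal.const_mul _).add_const _
  have hUof : ∀ x, ENNReal.ofReal (2 ^ n * (Mn w0 x).toReal + Real.pi ^ n * ε) = 2 ^ n * Mn w0 x + ENNReal.ofReal (Real.pi ^ n * ε) := by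
    intro x
    rw [ENNReal.ofReal_add (by positivity) (by positivity), ENNReal.ofReal_mul (by positivity), ENNReal.ofReal_toReal (hMt x)]
    simp
  have main := Bf_le (l := l) (a := a) (w := fun x => ‖g x‖ ^ b + ε) (U := fun x => 2 ^ n * (Mn w0 x).toReal + Real.pi ^ n * ε)
    (ε := ε) (N := R ^ b + ε) (ε' := Real.pi ^ n * ε) (N' := 2 ^ n * (Real.pi ^ n * R ^ b) + Real.pi ^ n * ε) hf hfR hg hgR hah ha1 hl hwm hε0
    (fun x => by have : 0 ≤ ‖g x‖ ^ b := by positivity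
                 linarith)
    (fun x => by have := Real.rpow_le_rpow (norm_nonneg _) (hgR x) hb0.le
                 linarith) hUm (by positivity)
    (fun x => by have : 0 ≤ 2 ^ n * (Mn w0 x).toReal := by positivity
                 linarith)
    (fun x => by have : (Mn w0 x).toReal ≤ Real.pi ^ n * R ^ b := ENNReal.toReal_le_of_le_ofReal (by positivity) (hMb x)
                 gcongr)
    (by
      intro s x
      rw [hUof]
      have e : ∀ u, KP s u * ENNReal.ofReal (‖g (x + u)‖ ^ b + ε) = KP s u * w0 (x + u) + KP s u * ENNReal.ofReal ε := by
        intro u; rw [ENNReal.ofReal_add (by positivity) hε0.le, mul_add]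
      simp only [e]
      have hm2 : Measurable (fun u => KP s u * ENNReal.ofReal ε) := (KP_meas1 s).mul_const _
      rw [lintegral_add_right _ hm2, lintegral_mul_const _ (KP_meas1 s), KP_lintegral, ENNReal.ofReal_mul (by positivity), ENNReal.ofReal_pow hpi.le]
      gcongr
      exact KP_Mn s w0 x)
  refine main.trans ?_
  have hT1 : ∫⁻ x, ENNReal.ofReal (‖f x‖ ^ 2 * (2 ^ n * (Mn w0 x).toReal + Real.pi ^ n * ε) ^ a) ≤ C3 * (F ^ (2 / q) * G ^ (1 / r)) + ENNReal.ofReal δ * ∫⁻ x, ‖f x‖ₑ ^ (2:ℝ) := by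
    calc _ ≤ ∫⁻ x, (‖f x‖ₑ ^ (2:ℝ) * (2 ^ n * Mn w0 x) ^ a + ENNReal.ofReal δ * ‖f x‖ₑ ^ (2:ℝ)) := by
          refine lintegral_mono fun x => ?_
          rw [ENNReal.ofReal_mul (by positivity), ENNReal.ofReal_pow (norm_nonneg _), ofReal_norm,
            ← ENNReal.ofReal_rpow_of_nonneg (by positivity) ha0.le, hUof, mul_comm (ENNReal.ofReal δ), ← mul_add,
            ← ENNReal.rpow_natCast]
          refine mul_le_mul_right ?_ _
          rw [← hεδ, ← ENNReal.ofReal_rpow_of_nonneg (by positivity) ha0.le]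
          exact ENNReal.rpow_add_le_add_rpow _ _ ha0.le ha1.le
      _ = (∫⁻ x, ‖f x‖ₑ ^ (2:ℝ) * (2 ^ n * Mn w0 x) ^ a) + ENNReal.ofReal δ * ∫⁻ x, ‖f x‖ₑ ^ (2:ℝ) := by
          have hm2 : Measurable (fun x => ENNReal.ofReal δ * ‖f x‖ₑ ^ (2:ℝ)) := (hf.enorm.pow_const _).const_mul _
          rw [lintegral_add_right _ hm2, lintegral_const_mul' _ _ ENNReal.ofReal_ne_top]
      _ ≤ _ := by
          refine add_le_add (hH.trans (le_of_eq ?_)) le_rfl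
          ring
  have hT2 : ∫⁻ x, ENNReal.ofReal (‖g x‖ ^ 2 * (‖g x‖ ^ b + ε) ^ (-a)) ≤ G := by
    refine lintegral_mono fun x => ?_
    rw [← ofReal_norm, ENNReal.ofReal_rpow_of_nonneg (norm_nonneg _) (by positivity)]
    apply ENNReal.ofReal_le_ofReal
    rcases eq_or_lt_of_le (norm_nonneg (g x)) with h0 | h0
    · rw [← h0]; simp; positivity
    · calc ‖g x‖ ^ 2 * (‖g x‖ ^ b + ε) ^ (-a) ≤ ‖g x‖ ^ 2 * (‖g x‖ ^ b) ^ (-a) := by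
            refine mul_le_mul_of_nonneg_left ?_ (by positivity)
            exact Real.rpow_le_rpow_of_nonpos (by positivity) (by linarith) (by linarith)
        _ = _ := by
            rw [← Real.rpow_mul h0.le, ← Real.rpow_natCast, ← Real.rpow_add h0]
            congr 1; push_cast; linarith
  calc _ ≤ ENNReal.ofReal l * (C1 * (C3 * (F ^ (2 / q) * G ^ (1 / r)) + ENNReal.ofReal δ * ∫⁻ x, ‖f x‖ₑ ^ (2:ℝ))) + ENNReal.ofReal l⁻¹ * (C2 * G) :=
        add_le_add (mul_le_mul_right (mul_le_mul_right hT1 _) _) (mul_le_mul_right (mul_le_mul_right hT2 _) _)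
    _ = _ := by rw [hK]; ring

lemma Bf_Lq {n : ℕ} {q : ℝ} (hq : 1 < q) : ∃ C : ENNReal, C ≠ ⊤ ∧ ∀ {f g : (Fin n → ℝ) → ℂ} {R : ℝ}
    (_ : Measurable f) (_ : ∀ x, ‖f x‖ ≤ R) (_ : Measurable g) (_ : ∀ x, ‖g x‖ ≤ R)
    (_ : ∫⁻ x, ‖f x‖ₑ ^ (2:ℝ) ≠ ⊤) (_ : ∫⁻ x, ‖g x‖ₑ ^ (2:ℝ) ≠ ⊤)
    (_ : ∫⁻ x, ‖f x‖ₑ ^ q ≠ ⊤) (_ : ∫⁻ x, ‖g x‖ₑ ^ (q / (q - 1)) ≠ ⊤),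
    Bf f g ≤ C * ((∫⁻ x, ‖f x‖ₑ ^ q) ^ (1 / q) * (∫⁻ x, ‖g x‖ₑ ^ (q / (q - 1))) ^ (1 - 1 / q)) := by
  have hq1 : 0 < q - 1 := by linarith
  rcases lt_trichotomy q 2 with h | h | h
  · obtain ⟨C, hC, H⟩ := Bf_gt_two (n := n) (q := q / (q - 1)) (by rw [lt_div_iff₀ hq1]; linarith)
    refine ⟨C, hC, ?_⟩
    intro f g R hf hfR hg hgR hF2 hG2 hF hG
    have e1 : q / (q - 1) / (q / (q - 1) - 1) = q := by
      have : q / (q-1) - 1 = 1 / (q - 1) := by field_simp; ring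
      rw [this]; field_simp
    have e2 : 1 / (q / (q - 1)) = 1 - 1 / q := by field_simp
    have := H hg hgR hf hfR hG2 hG (by rw [e1]; exact hF)
    rw [e1, e2, sub_sub_cancel, mul_comm (_ ^ _)] at this
    rw [Bf_symm hf hg]
    exact this
  · subst h
    refine ⟨(Ccv n * ENNReal.ofReal (Csq (1/2)) ^ n * ENNReal.ofReal ((Real.pi ^ n) ^ (1/2:ℝ)) +
      ENNReal.ofReal Real.pi ^ n * ENNReal.ofReal (Csq (1/2)) ^ n), ?_, fun {f g R} hf hfR hg hgR hF2 hG2 _ _ => ?_⟩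
    rotate_left
    · have e : (2:ℝ) / (2 - 1) = 2 := by norm_num
      have e2 : (1:ℝ) - 1 / 2 = 1 / 2 := by norm_num
      rw [e, e2]
      exact Bf_two hf hfR hg hgR hF2 hG2
    · exact ENNReal.add_ne_top.mpr ⟨ENNReal.mul_ne_top (ENNReal.mul_ne_top (Ccv_ne_top n) (by simp)) (by simp), ENNReal.mul_ne_top (by simp) (by simp)⟩
  · obtain ⟨C, hC, H⟩ := Bf_gt_two (n := n) h
    exact ⟨C, hC, fun {f g R} hf hfR hg hgR hF2 _ hF hG => H hf hfR hg hgR hF2 hF hG⟩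

end BilinearLq

section KernelOne

/-- the auxiliary bump `r² e^{-r²/2}` -/
def eta (r : ℝ) : ℝ := r ^ 2 * Real.exp (-(1 / 2) * r ^ 2)
def eta1 (r : ℝ) : ℝ := (2 * r - r ^ 3) * Real.exp (-(1 / 2) * r ^ 2)
def eta2 (r : ℝ) : ℝ := (2 - 5 * r ^ 2 + r ^ 4) * Real.exp (-(1 / 2) * r ^ 2)
def hmaj (r : ℝ) : ℝ := (7 + 8 * r ^ 2 + r ^ 4) * Real.exp (-(1 / 2) * r ^ 2)
def Chm : ℝ := ∫ r, hmaj r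

lemma eta_cont : Continuous eta := by unfold eta; fun_prop
lemma eta1_cont : Continuous eta1 := by unfold eta1; fun_prop
lemma eta2_cont : Continuous eta2 := by unfold eta2; fun_prop
lemma hmaj_cont : Continuous hmaj := by unfold hmaj; fun_prop
lemma eta_nonneg (r : ℝ) : 0 ≤ eta r := by unfold eta; positivity
lemma hmaj_nonneg (r : ℝ) : 0 ≤ hmaj r := by unfold hmaj; positivity
lemma Chm_nonneg : 0 ≤ Chm := integral_nonneg fun r => hmaj_nonneg r

lemma hmaj_integrable : Integrable hmaj := by
  have h0 := integrable_exp_neg_mul_sq (b := 1 / 2) (by norm_num)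
  have h2 := integrable_rpow_mul_exp_neg_mul_sq (b := 1 / 2) (by norm_num) (s := 2) (by norm_num)
  have h4 := integrable_rpow_mul_exp_neg_mul_sq (b := 1 / 2) (by norm_num) (s := 4) (by norm_num)
  have := ((h0.const_mul 7).add (h2.const_mul 8)).add h4
  refine this.congr (Filter.Eventually.of_forall fun r => ?_)
  simp only [Pi.add_apply, hmaj]
  norm_cast
  ring

lemma eta_le_hmaj (r : ℝ) : eta r ≤ hmaj r := by
  unfold eta hmaj
  gcongr
  nlinarith [sq_nonneg r, sq_nonneg (r ^ 2)]

lemma eta_integrable : Integrable eta := hmaj_integrable.mono' eta_cont.aestronglyMeasurable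
  (Filter.Eventually.of_forall fun r => by rw [Real.norm_of_nonneg (eta_nonneg r)]; exact eta_le_hmaj r)

lemma eta_deriv (r : ℝ) : HasDerivAt eta (eta1 r) r := by
  have h1 : HasDerivAt (fun r : ℝ => Real.exp (-(1 / 2) * r ^ 2)) (Real.exp (-(1 / 2) * r ^ 2) * (-(1/2) * (2 * r))) r := by
    have := ((hasDerivAt_pow 2 r).const_mul (-(1/2:ℝ))).exp
    simpa using this
  have h2 := (hasDerivAt_pow 2 r).mul h1
  refine h2.congr_deriv ?_
  unfold eta1; push_cast; ring

lemma eta1_deriv (r : ℝ) : HasDerivAt eta1 (eta2 r) r := by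
  have h1 : HasDerivAt (fun r : ℝ => Real.exp (-(1 / 2) * r ^ 2)) (Real.exp (-(1 / 2) * r ^ 2) * (-(1/2) * (2 * r))) r := by
    have := ((hasDerivAt_pow 2 r).const_mul (-(1/2:ℝ))).exp
    simpa using this
  have h2 := (((hasDerivAt_id r).const_mul 2).sub (hasDerivAt_pow 3 r)).mul h1
  refine h2.congr_deriv ?_
  unfold eta2; simp; ring

lemma kernel_one {P0 P1 P2 : ℝ → ℂ} {B σ x : ℝ} (hσ : 0 < σ)
    (h01 : ∀ t, HasDerivAt P0 (P1 t) t) (h12 : ∀ t, HasDerivAt P1 (P2 t) t)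
    (b0 : ∀ t, ‖P0 t‖ ≤ B) (b1 : ∀ t, |t| * ‖P1 t‖ ≤ B) (b2 : ∀ t, t ^ 2 * ‖P2 t‖ ≤ B) :
    ‖∫ t : ℝ, Complex.exp (Complex.I * ((x * t : ℝ) : ℂ)) * ((eta (σ * t) : ℝ) * P0 t)‖ ≤
      Chm * B * (σ / (σ ^ 2 + x ^ 2)) := by
  have hB : 0 ≤ B := (norm_nonneg _).trans (b0 0)
  set E : ℝ → ℂ := fun t => Complex.exp (Complex.I * ((x * t : ℝ) : ℂ)) with hE
  set u : ℝ → ℂ := fun t => (eta (σ * t) : ℝ) * P0 t with hu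
  set u1 : ℝ → ℂ := fun t => (eta1 (σ * t) * σ : ℝ) * P0 t + (eta (σ * t) : ℝ) * P1 t with hu1
  set u2 : ℝ → ℂ := fun t => (eta2 (σ * t) * σ * σ : ℝ) * P0 t + 2 * ((eta1 (σ * t) * σ : ℝ) * P1 t) + (eta (σ * t) : ℝ) * P2 t with hu2
  have hEn : ∀ t, ‖E t‖ = 1 := by
    intro t; rw [hE]; beta_reduce; rw [mul_comm, Complex.norm_exp_ofReal_mul_I]
  have hEd : ∀ t, HasDerivAt E (Complex.I * x * E t) t := by
    intro t
    have h1 : HasDerivAt (fun t : ℝ => ((x * t : ℝ) : ℂ)) ((x * 1 : ℝ) : ℂ) t := ((hasDerivAt_id t).const_mul x).ofReal_comp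
    refine ((h1.const_mul Complex.I).cexp).congr_deriv ?_
    rw [hE]; push_cast; ring
  have hEc : Continuous E := by rw [hE]; fun_prop
  have hlin : ∀ t, HasDerivAt (fun t : ℝ => σ * t) σ t := fun t => by simpa using (hasDerivAt_id t).const_mul σ
  have de : ∀ t, HasDerivAt (fun t : ℝ => ((eta (σ * t) : ℝ) : ℂ)) ((eta1 (σ * t) * σ : ℝ) : ℂ) t := fun t =>
    (((eta_deriv (σ * t)).comp t (hlin t))).ofReal_comp
  have de1 : ∀ t, HasDerivAt (fun t : ℝ => ((eta1 (σ * t) * σ : ℝ) : ℂ)) ((eta2 (σ * t) * σ * σ : ℝ) : ℂ) t := fun t =>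
    ((((eta1_deriv (σ * t)).comp t (hlin t))).mul_const σ).ofReal_comp
  have hud : ∀ t, HasDerivAt u (u1 t) t := fun t => (de t).mul (h01 t)
  have hu1d : ∀ t, HasDerivAt u1 (u2 t) t := fun t => by
    refine (((de1 t).mul (h01 t)).add ((de t).mul (h12 t))).congr_deriv ?_
    rw [hu2]; ring
  have hex : ∀ t : ℝ, 0 < Real.exp (-(1 / 2) * (σ * t) ^ 2) := fun t => Real.exp_pos _
  -- bounds
  have c0 : ∀ t, ‖u t‖ ≤ B * eta (σ * t) := by
    intro t
    rw [hu]; beta_reduce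
    rw [norm_mul, Complex.norm_real, Real.norm_of_nonneg (eta_nonneg _), mul_comm]
    exact mul_le_mul_of_nonneg_right (b0 t) (eta_nonneg _)
  have n1 : ∀ t, ‖((eta (σ * t) : ℝ) : ℂ) * P1 t‖ ≤ σ * (B * (|σ * t| * Real.exp (-(1 / 2) * (σ * t) ^ 2))) := by
    intro t
    rw [norm_mul, Complex.norm_real, Real.norm_of_nonneg (eta_nonneg _)]
    unfold eta
    have : (σ * t) ^ 2 = σ * |σ * t| * |t| := by
      rw [abs_mul, abs_of_pos hσ]; have := abs_mul_abs_self t; linear_combination -σ ^ 2 * this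
    calc _ = σ * |σ * t| * Real.exp (-(1 / 2) * (σ * t) ^ 2) * (|t| * ‖P1 t‖) := by nth_rewrite 1 [this]; ring
      _ ≤ σ * |σ * t| * Real.exp (-(1 / 2) * (σ * t) ^ 2) * B := by gcongr; exact b1 t
      _ = _ := by ring
  have n1' : ∀ t, ‖((eta1 (σ * t) * σ : ℝ) : ℂ) * P1 t‖ ≤ σ ^ 2 * (B * ((2 + (σ * t) ^ 2) * Real.exp (-(1 / 2) * (σ * t) ^ 2))) := by
    intro t
    rw [norm_mul, Complex.norm_real, Real.norm_eq_abs]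
    unfold eta1
    have : |(2 * (σ * t) - (σ * t) ^ 3) * Real.exp (-(1 / 2) * (σ * t) ^ 2) * σ| ≤ σ ^ 2 * |t| * ((2 + (σ * t) ^ 2) * Real.exp (-(1 / 2) * (σ * t) ^ 2)) := by
      rw [show 2 * (σ * t) - (σ * t) ^ 3 = σ * t * (2 - (σ * t) ^ 2) by ring, abs_mul, abs_mul, abs_mul, abs_mul, abs_of_pos hσ, abs_of_pos (hex t)]
      have : |2 - (σ * t) ^ 2| ≤ 2 + (σ * t) ^ 2 := by rw [abs_le]; constructor <;> nlinarith [sq_nonneg (σ * t)]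
      calc σ * |t| * |2 - (σ * t) ^ 2| * Real.exp (-(1 / 2) * (σ * t) ^ 2) * σ ≤ σ * |t| * (2 + (σ * t) ^ 2) * Real.exp (-(1 / 2) * (σ * t) ^ 2) * σ := by gcongr
        _ = _ := by ring
    calc _ ≤ σ ^ 2 * |t| * ((2 + (σ * t) ^ 2) * Real.exp (-(1 / 2) * (σ * t) ^ 2)) * ‖P1 t‖ := by gcongr
      _ = σ ^ 2 * ((2 + (σ * t) ^ 2) * Real.exp (-(1 / 2) * (σ * t) ^ 2)) * (|t| * ‖P1 t‖) := by ring
      _ ≤ σ ^ 2 * ((2 + (σ * t) ^ 2) * Real.exp (-(1 / 2) * (σ * t) ^ 2)) * B := by gcongr; exact b1 t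
      _ = _ := by ring
  have n2 : ∀ t, ‖((eta (σ * t) : ℝ) : ℂ) * P2 t‖ ≤ σ ^ 2 * (B * Real.exp (-(1 / 2) * (σ * t) ^ 2)) := by
    intro t
    rw [norm_mul, Complex.norm_real, Real.norm_of_nonneg (eta_nonneg _)]
    unfold eta
    calc _ = σ ^ 2 * Real.exp (-(1 / 2) * (σ * t) ^ 2) * (t ^ 2 * ‖P2 t‖) := by ring
      _ ≤ σ ^ 2 * Real.exp (-(1 / 2) * (σ * t) ^ 2) * B := by gcongr; exact b2 t
      _ = _ := by ring
  have m1 : ∀ t, ‖((eta1 (σ * t) * σ : ℝ) : ℂ) * P0 t‖ ≤ σ * (B * ((2 * |σ * t| + |σ * t| ^ 3) * Real.exp (-(1 / 2) * (σ * t) ^ 2))) := by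
    intro t
    rw [norm_mul, Complex.norm_real, Real.norm_eq_abs]
    unfold eta1
    rw [abs_mul, abs_mul, abs_of_pos hσ, abs_of_pos (hex t)]
    have h : |2 * (σ * t) - (σ * t) ^ 3| ≤ 2 * |σ * t| + |σ * t| ^ 3 := by
      refine (abs_sub _ _).trans ?_
      rw [abs_mul, abs_pow, abs_two]
    calc _ ≤ (2 * |σ * t| + |σ * t| ^ 3) * Real.exp (-(1 / 2) * (σ * t) ^ 2) * σ * B := by gcongr; exact b0 t
      _ = _ := by ring
  have m2 : ∀ t, ‖((eta2 (σ * t) * σ * σ : ℝ) : ℂ) * P0 t‖ ≤ σ ^ 2 * (B * ((2 + 5 * (σ * t) ^ 2 + (σ * t) ^ 4) * Real.exp (-(1 / 2) * (σ * t) ^ 2))) := by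
    intro t
    rw [norm_mul, Complex.norm_real, Real.norm_eq_abs]
    unfold eta2
    rw [abs_mul, abs_mul, abs_mul, abs_of_pos hσ, abs_of_pos (hex t)]
    have h : |2 - 5 * (σ * t) ^ 2 + (σ * t) ^ 4| ≤ 2 + 5 * (σ * t) ^ 2 + (σ * t) ^ 4 := by
      rw [abs_le]; constructor <;> nlinarith [sq_nonneg (σ * t), sq_nonneg ((σ * t) ^ 2)]
    calc _ ≤ (2 + 5 * (σ * t) ^ 2 + (σ * t) ^ 4) * Real.exp (-(1 / 2) * (σ * t) ^ 2) * σ * σ * B := by gcongr; exact b0 t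
      _ = _ := by ring
  have c1 : ∀ t, ‖u1 t‖ ≤ σ * (B * hmaj (σ * t)) := by
    intro t
    refine (norm_add_le _ _).trans ((add_le_add (m1 t) (n1 t)).trans ?_)
    unfold hmaj
    rw [← mul_add, ← mul_add, ← add_mul]
    refine mul_le_mul_of_nonneg_left (mul_le_mul_of_nonneg_left (mul_le_mul_of_nonneg_right ?_ (hex t).le) hB) hσ.le
    have h2 := sq_abs (σ * t)
    have h4 : (σ * t) ^ 4 = |σ * t| ^ 4 := by rw [← abs_pow, abs_of_nonneg (by positivity)]
    rw [h4, ← h2]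
    nlinarith [sq_nonneg (|σ * t| - 1), sq_nonneg (|σ * t| ^ 2 - |σ * t|), abs_nonneg (σ * t), sq_nonneg (|σ * t|)]
  have c2 : ∀ t, ‖u2 t‖ ≤ σ ^ 2 * (B * (hmaj (σ * t) - eta (σ * t))) := by
    intro t
    refine (norm_add_le _ _).trans ((add_le_add ((norm_add_le _ _).trans (add_le_add (m2 t) (?_ : _ ≤ 2 * (σ ^ 2 * (B * ((2 + (σ * t) ^ 2) * Real.exp (-(1 / 2) * (σ * t) ^ 2)))) ))) (n2 t)).trans (le_of_eq ?_))
    · rw [norm_mul, Complex.norm_ofNat]; gcongr; exact n1' t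
    · unfold hmaj eta; ring
  have hmi : Integrable (fun t => hmaj (σ * t)) := hmaj_integrable.comp_mul_left' hσ.ne'
  have hei : Integrable (fun t => eta (σ * t)) := eta_integrable.comp_mul_left' hσ.ne'
  have P0c : Continuous P0 := continuous_iff_continuousAt.mpr fun t => (h01 t).continuousAt
  have P1c : Continuous P1 := continuous_iff_continuousAt.mpr fun t => (h12 t).continuousAt
  have P2m : Measurable P2 := by
    have : P2 = deriv P1 := funext fun t => (h12 t).deriv.symm
    rw [this]; exact measurable_deriv P1
  have ec : Continuous (fun t => ((eta (σ * t) : ℝ) : ℂ)) := Complex.continuous_ofReal.comp (eta_cont.comp (continuous_const.mul continuous_id))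
  have ec1 : Continuous (fun t => ((eta1 (σ * t) * σ : ℝ) : ℂ)) := Complex.continuous_ofReal.comp ((eta1_cont.comp (continuous_const.mul continuous_id)).mul continuous_const)
  have ec2 : Continuous (fun t => ((eta2 (σ * t) * σ * σ : ℝ) : ℂ)) := Complex.continuous_ofReal.comp (((eta2_cont.comp (continuous_const.mul continuous_id)).mul continuous_const).mul continuous_const)
  have iu : Integrable u := (hei.const_mul B).mono' (ec.mul P0c).aestronglyMeasurable (Filter.Eventually.of_forall c0)
  have iu1 : Integrable u1 := ((hmi.const_mul B).const_mul σ).mono' ((ec1.mul P0c).add (ec.mul P1c)).aestronglyMeasurable (Filter.Eventually.of_forall c1)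
  have u2m : Measurable u2 := (((ec2.mul P0c).measurable).add (((ec1.mul P1c).measurable).const_mul 2)).add (ec.measurable.mul P2m)
  have iu2 : Integrable u2 := (((hmi.sub hei).const_mul B).const_mul (σ ^ 2)).mono' u2m.aestronglyMeasurable (Filter.Eventually.of_forall c2)
  have iE : ∀ v : ℝ → ℂ, Integrable v → Integrable (fun t => E t * v t) := fun v hv =>
    hv.bdd_mul hEc.aestronglyMeasurable (Filter.Eventually.of_forall fun t => (hEn t).le)
  have iE' : ∀ v : ℝ → ℂ, Integrable v → Integrable (fun t => Complex.I * x * E t * v t) := fun v hv => by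
    have := (iE v hv).const_mul (Complex.I * x)
    refine this.congr (Filter.Eventually.of_forall fun t => ?_)
    simp only [mul_assoc]
  have p1 : ∫ t, E t * u1 t = - ∫ t, Complex.I * x * E t * u t :=
    integral_mul_deriv_eq_deriv_mul_of_integrable (fun t _ => hEd t) (fun t _ => hud t) (iE _ iu1) (iE' _ iu) (iE _ iu)
  have p2 : ∫ t, E t * u2 t = - ∫ t, Complex.I * x * E t * u1 t :=
    integral_mul_deriv_eq_deriv_mul_of_integrable (fun t _ => hEd t) (fun t _ => hu1d t) (iE _ iu2) (iE' _ iu1) (iE _ iu1)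
  have hc : ∀ v : ℝ → ℂ, ∫ t, Complex.I * x * E t * v t = Complex.I * x * ∫ t, E t * v t := by
    intro v; rw [← integral_const_mul]; congr 1; funext t; ring
  have p3 : ∫ t, E t * u2 t = - (x:ℂ) ^ 2 * ∫ t, E t * u t := by
    rw [p2, hc, p1, hc]
    have := Complex.I_sq
    linear_combination (x:ℂ) ^ 2 * (∫ t, E t * u t) * this
  have hfin : ‖((σ ^ 2 + x ^ 2 : ℝ) : ℂ) * ∫ t, E t * u t‖ ≤ σ * Chm * B := by
    have e : ((σ ^ 2 + x ^ 2 : ℝ) : ℂ) * ∫ t, E t * u t = ∫ t, E t * ((σ:ℂ) ^ 2 * u t - u2 t) := by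
      have e1 : ∀ t, E t * ((σ:ℂ) ^ 2 * u t - u2 t) = (σ:ℂ) ^ 2 * (E t * u t) - E t * u2 t := fun t => by ring
      simp only [e1]
      rw [integral_sub ((iE _ iu).const_mul _) (iE _ iu2), integral_const_mul, p3]
      push_cast; ring
    rw [e]
    calc _ ≤ ∫ t, σ ^ 2 * B * hmaj (σ * t) := by
          refine norm_integral_le_of_norm_le (hmi.const_mul _) (Filter.Eventually.of_forall fun t => ?_)
          rw [norm_mul, hEn, one_mul]
          refine (norm_sub_le _ _).trans ?_
          rw [norm_mul, norm_pow, Complex.norm_real, Real.norm_of_nonneg hσ.le]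
          calc _ ≤ σ ^ 2 * (B * eta (σ * t)) + σ ^ 2 * (B * (hmaj (σ * t) - eta (σ * t))) := by
                gcongr
                · exact c0 t
                · exact c2 t
            _ = _ := by ring
      _ = σ * Chm * B := by
          rw [integral_const_mul, Measure.integral_comp_mul_left, abs_of_pos (inv_pos.mpr hσ), smul_eq_mul, ← Chm]
          field_simp
  rw [norm_mul, Complex.norm_real, Real.norm_of_nonneg (by positivity)] at hfin
  have hp : 0 < σ ^ 2 + x ^ 2 := by positivity
  calc _ ≤ σ * Chm * B / (σ ^ 2 + x ^ 2) := by rw [le_div_iff₀ hp, mul_comm]; exact hfin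
    _ = _ := by ring

end KernelOne

section KernelMulti

/-- character -/
def EX {n : ℕ} (x ξ : Fin n → ℝ) : ℂ := Complex.exp (Complex.I * ((∑ i, x i * ξ i : ℝ) : ℂ))
/-- tensor cutoff -/
def ET {n : ℕ} (s ξ : Fin n → ℝ) : ℝ := ∏ i, eta ((2:ℝ) ^ (s i) * ξ i)

lemma EX_norm {n : ℕ} (x ξ : Fin n → ℝ) : ‖EX x ξ‖ = 1 := by
  unfold EX; rw [mul_comm, Complex.norm_exp_ofReal_mul_I]
lemma EX_cont {n : ℕ} : Continuous (fun p : (Fin n → ℝ) × (Fin n → ℝ) => EX p.1 p.2) := by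
  unfold EX; fun_prop
lemma EX_cont1 {n : ℕ} (x : Fin n → ℝ) : Continuous (EX x) := by
  unfold EX; fun_prop
lemma EX_cons {n : ℕ} (x : Fin (n+1) → ℝ) (t : ℝ) (z : Fin n → ℝ) :
    EX x (Fin.cons t z) = Complex.exp (Complex.I * ((x 0 * t : ℝ) : ℂ)) * EX (fun i => x i.succ) z := by
  unfold EX
  rw [← Complex.exp_add, Fin.sum_univ_succ]
  simp [mul_add]
lemma ET_cont {n : ℕ} (s : Fin n → ℝ) : Continuous (ET s) := by
  unfold ET
  have := eta_cont
  fun_prop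
lemma ET_nonneg {n : ℕ} (s ξ : Fin n → ℝ) : 0 ≤ ET s ξ := Finset.prod_nonneg fun i _ => eta_nonneg _
lemma ET_integrable {n : ℕ} (s : Fin n → ℝ) : Integrable (ET s) :=
  tprod_integrable (κ := fun i t => eta ((2:ℝ) ^ (s i) * t)) fun i => eta_integrable.comp_mul_left' (by positivity)
lemma ET_cons {n : ℕ} (s : Fin (n+1) → ℝ) (t : ℝ) (z : Fin n → ℝ) :
    ET s (Fin.cons t z) = eta ((2:ℝ) ^ (s 0) * t) * ET (fun i => s i.succ) z := by
  unfold ET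
  rw [Fin.prod_univ_succ]
  simp

lemma ker_integrable {n : ℕ} {Q : (Fin n → ℝ) → ℂ} (hQ : Continuous Q) {B : ℝ} (hB : ∀ ξ, ‖Q ξ‖ ≤ B) (s x : Fin n → ℝ) :
    Integrable (fun ξ => EX x ξ * ((ET s ξ : ℝ) * Q ξ)) := by
  refine ((ET_integrable s).const_mul B).mono' ((EX_cont1 x).mul ((Complex.continuous_ofReal.comp (ET_cont s)).mul hQ)).aestronglyMeasurable
    (Filter.Eventually.of_forall fun ξ => ?_)
  rw [norm_mul, EX_norm, one_mul, norm_mul, Complex.norm_real, Real.norm_of_nonneg (ET_nonneg _ _), mul_comm]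
  exact mul_le_mul_of_nonneg_right (hB ξ) (ET_nonneg _ _)

lemma kernel_multi : ∀ (n : ℕ) {B : ℝ} {P : (Fin n → ℕ) → (Fin n → ℝ) → ℂ} (_ : 0 ≤ B)
    (_ : ∀ α, Continuous (P α)) (_ : ∀ α, ∃ B', ∀ ξ, ‖P α ξ‖ ≤ B')
    (_ : ∀ α : Fin n → ℕ, (∀ i, α i ≤ 2) → ∀ ξ, (∏ i, |ξ i| ^ (α i)) * ‖P α ξ‖ ≤ B)
    (_ : ∀ α m ξ, HasDerivAt (fun t => P α (Function.update ξ m t)) (P (Function.update α m (α m + 1)) ξ) (ξ m))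
    (s x : Fin n → ℝ),
    ‖∫ ξ, EX x ξ * ((ET s ξ : ℝ) * P 0 ξ)‖ ≤ Chm ^ n * B * ∏ i, kk (s i) (x i) := by
  intro n
  induction n with
  | zero =>
    intro B P hB hc hb' hb hd s x
    have h := hb 0 (fun i => by simp) 0
    simp only [Finset.univ_eq_empty, Finset.prod_empty, one_mul] at h
    have e : ∀ ξ : Fin 0 → ℝ, EX x ξ * ((ET s ξ : ℝ) * P 0 ξ) = P 0 0 := by
      intro ξ
      rw [Subsingleton.elim ξ 0]
      simp [EX, ET]
    simp only [e]
    have hv : (volume : Measure (Fin 0 → ℝ)).real Set.univ = 1 := by simp [Measure.real, vol_fin0]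
    rw [integral_const, hv, one_smul]
    refine h.trans (le_of_eq ?_)
    simp
  | succ n ih =>
    intro B P hB hc hb' hb hd s x
    set sS : Fin n → ℝ := fun i => s i.succ
    set xS : Fin n → ℝ := fun i => x i.succ
    set A : ℝ := Chm ^ n * B * ∏ i, kk (sS i) (xS i) with hA
    set J : ℕ → ℝ → ℂ := fun k t => ∫ z, EX xS z * ((ET sS z : ℝ) * P (Fin.cons k 0) (Fin.cons t z)) with hJ
    have hcc : ∀ t : ℝ, Continuous (fun z : Fin n → ℝ => (Fin.cons t z : Fin (n+1) → ℝ)) := fun t => by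
      refine continuous_pi fun i => ?_
      refine Fin.cases ?_ (fun j => ?_) i
      · simpa using continuous_const
      · simpa using continuous_apply j
    have hP0 : 0 ≤ ∏ i, kk (sS i) (xS i) := Finset.prod_nonneg fun i _ => kk_nonneg _ _
    have hA0 : 0 ≤ A := by have := Chm_nonneg; positivity
    have hJb : ∀ k, k ≤ 2 → ∀ t, |t| ^ k * ‖J k t‖ ≤ A := by
      intro k hk t
      rcases eq_or_ne (|t| ^ k) 0 with h0 | h0
      · rw [h0, zero_mul]; exact hA0
      have hp : 0 < |t| ^ k := lt_of_le_of_ne (by positivity) h0.symm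
      have := ih (B := B / |t| ^ k) (P := fun α z => P (Fin.cons k α) (Fin.cons t z)) (by positivity)
        (fun α => (hc _).comp (hcc t)) (fun α => by obtain ⟨B', h⟩ := hb' (Fin.cons k α); exact ⟨B', fun z => h _⟩)
        (fun α hα z => by
          have := hb (Fin.cons k α) (fun i => by refine Fin.cases ?_ (fun j => ?_) i <;> simp [hk, hα]) (Fin.cons t z)
          rw [Fin.prod_univ_succ] at this
          simp only [Fin.cons_zero, Fin.cons_succ] at this
          rw [le_div_iff₀ hp]
          refine le_trans (le_of_eq ?_) this
          ring)
        (fun α m z => by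
          have := hd (Fin.cons k α) m.succ (Fin.cons t z)
          simp only [← Fin.cons_update, Fin.cons_succ] at this
          exact this) sS xS
      calc _ ≤ |t| ^ k * (Chm ^ n * (B / |t| ^ k) * ∏ i, kk (sS i) (xS i)) := by gcongr
        _ = A := by rw [hA]; field_simp
    have hJd : ∀ k t, HasDerivAt (J k) (J (k+1) t) t := by
      intro k t
      obtain ⟨B1, hB1⟩ := hb' (Fin.cons (k+1) 0)
      obtain ⟨B0, hB0⟩ := hb' (Fin.cons k 0)
      refine (hasDerivAt_integral_of_dominated_loc_of_deriv_le (s := Set.univ) Filter.univ_mem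
        (F := fun t z => EX xS z * ((ET sS z : ℝ) * P (Fin.cons k 0) (Fin.cons t z)))
        (F' := fun t z => EX xS z * ((ET sS z : ℝ) * P (Fin.cons (k+1) 0) (Fin.cons t z)))
        (bound := fun z => B1 * ET sS z) (μ := volume) (x₀ := t) ?_ ?_ ?_ ?_ ?_ ?_).2
      · exact Filter.Eventually.of_forall fun u => (ker_integrable ((hc _).comp (hcc u)) (fun z => hB0 _) sS xS).aestronglyMeasurable
      · exact ker_integrable ((hc _).comp (hcc t)) (fun z => hB0 _) sS xS
      · exact (ker_integrable ((hc _).comp (hcc t)) (fun z => hB1 _) sS xS).aestronglyMeasurable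
      · refine Filter.Eventually.of_forall fun z u _ => ?_
        rw [norm_mul, EX_norm, one_mul, norm_mul, Complex.norm_real, Real.norm_of_nonneg (ET_nonneg _ _), mul_comm]
        exact mul_le_mul_of_nonneg_right (hB1 _) (ET_nonneg _ _)
      · exact (ET_integrable sS).const_mul _
      · refine Filter.Eventually.of_forall fun z u _ => ?_
        have := hd (Fin.cons k 0) 0 (Fin.cons u z)
        simp only [Fin.update_cons_zero, Fin.cons_zero] at this
        exact (this.const_mul _).const_mul _
    obtain ⟨B0, hB0⟩ := hb' 0
    have hIcons := ker_integrable (hc 0) hB0 s x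
    rw [integral_cons hIcons]
    have e : ∀ t, ∫ z, EX x (Fin.cons t z) * ((ET s (Fin.cons t z) : ℝ) * P 0 (Fin.cons t z)) =
        Complex.exp (Complex.I * ((x 0 * t : ℝ) : ℂ)) * ((eta ((2:ℝ) ^ (s 0) * t) : ℝ) * J 0 t) := by
      intro t
      rw [hJ]; beta_reduce
      rw [← integral_const_mul, ← integral_const_mul]
      refine integral_congr_ae (Filter.Eventually.of_forall fun z => ?_)
      have h0 : (Fin.cons 0 0 : Fin (n+1) → ℕ) = 0 := by
        funext i; refine Fin.cases ?_ (fun j => ?_) i <;> simp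
      beta_reduce
      rw [EX_cons, ET_cons, h0]
      push_cast; ring
    simp only [e]
    have := kernel_one (P0 := J 0) (P1 := J 1) (P2 := J 2) (B := A) (σ := (2:ℝ) ^ (s 0)) (x := x 0) (by positivity)
      (hJd 0) (hJd 1) (fun t => by simpa using hJb 0 (by norm_num) t) (fun t => by simpa using hJb 1 (by norm_num) t)
      (fun t => by simpa using hJb 2 (by norm_num) t)
    refine this.trans (le_of_eq ?_)
    rw [hA, Fin.prod_univ_succ, kk]
    ring

end KernelMulti

section PdCalc

lemma pd_contDiff {n : ℕ} (j : Fin n) {f : Euc n → ℂ} (hf : ContDiff ℝ (⊤ : ℕ∞) f) :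
    ContDiff ℝ (⊤ : ℕ∞) (pd j f) := by
  unfold pd
  have h := hf.fderiv_right (m := (⊤ : ℕ∞)) (by simp)
  exact h.clm_apply contDiff_const

lemma pd_iter_contDiff {n : ℕ} (j : Fin n) (k : ℕ) : ∀ {f : Euc n → ℂ} (_ : ContDiff ℝ (⊤ : ℕ∞) f),
    ContDiff ℝ (⊤ : ℕ∞) ((pd j)^[k] f) := by
  induction k with
  | zero => intro f hf; exact hf
  | succ k ih => intro f hf; rw [Function.iterate_succ_apply]; exact ih (pd_contDiff j hf)

lemma pd_comm {n : ℕ} (i j : Fin n) {f : Euc n → ℂ} (hf : ContDiff ℝ (⊤ : ℕ∞) f) :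
    pd i (pd j f) = pd j (pd i f) := by
  funext ξ
  have h1 : ContDiff ℝ (⊤ : ℕ∞) (fderiv ℝ f) := hf.fderiv_right (m := (⊤ : ℕ∞)) (by simp)
  have h2 : DifferentiableAt ℝ (fderiv ℝ f) ξ := (h1.differentiable (by simp)) ξ
  have key : ∀ a b : Fin n, pd a (pd b f) ξ = fderiv ℝ (fderiv ℝ f) ξ (EuclideanSpace.single a 1) (EuclideanSpace.single b 1) := by
    intro a b
    unfold pd
    rw [fderiv_clm_apply h2 (differentiableAt_const _)]
    simp
  rw [key, key]
  have hs : IsSymmSndFDerivAt ℝ f ξ := hf.contDiffAt.isSymmSndFDerivAt (by simp only [minSmoothness_of_isRCLikeNormedField]; exact WithTop.coe_le_coe.2 (le_top : (2:ℕ∞) ≤ ⊤))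
  exact hs _ _

lemma pd_iter_comm {n : ℕ} (i j : Fin n) (k : ℕ) : ∀ {f : Euc n → ℂ} (_ : ContDiff ℝ (⊤ : ℕ∞) f),
    pd i ((pd j)^[k] f) = (pd j)^[k] (pd i f) := by
  induction k with
  | zero => intro f hf; rfl
  | succ k ih =>
    intro f hf
    rw [Function.iterate_succ_apply, Function.iterate_succ_apply, ih (pd_contDiff j hf), pd_comm i j hf]

lemma fold_contDiff {n : ℕ} (α : Fin n → ℕ) {f : Euc n → ℂ} (hf : ContDiff ℝ (⊤ : ℕ∞) f) (l : List (Fin n)) :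
    ContDiff ℝ (⊤ : ℕ∞) (l.foldr (fun j g => (pd j)^[α j] g) f) := by
  induction l with
  | nil => exact hf
  | cons a l ih => exact pd_iter_contDiff a _ ih

lemma mpd_contDiff {n : ℕ} (α : Fin n → ℕ) {f : Euc n → ℂ} (hf : ContDiff ℝ (⊤ : ℕ∞) f) :
    ContDiff ℝ (⊤ : ℕ∞) (mpd α f) := fold_contDiff α hf _

lemma fold_upd_notmem {n : ℕ} (α : Fin n → ℕ) (f : Euc n → ℂ) (m : Fin n) (k : ℕ) (l : List (Fin n)) (hm : m ∉ l) :
    l.foldr (fun j g => (pd j)^[Function.update α m k j] g) f = l.foldr (fun j g => (pd j)^[α j] g) f := by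
  induction l with
  | nil => rfl
  | cons a l ih =>
    simp only [List.mem_cons, not_or] at hm
    simp only [List.foldr_cons]
    rw [ih hm.2, Function.update_of_ne (Ne.symm hm.1)]

lemma fold_upd_mem {n : ℕ} (α : Fin n → ℕ) {f : Euc n → ℂ} (hf : ContDiff ℝ (⊤ : ℕ∞) f) (m : Fin n) (l : List (Fin n))
    (hm : m ∈ l) (hl : l.Nodup) :
    l.foldr (fun j g => (pd j)^[Function.update α m (α m + 1) j] g) f = pd m (l.foldr (fun j g => (pd j)^[α j] g) f) := by
  induction l with
  | nil => simp at hm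
  | cons a l ih =>
    simp only [List.foldr_cons]
    rw [List.nodup_cons] at hl
    by_cases h : m = a
    · subst h
      rw [fold_upd_notmem _ _ _ _ _ hl.1, Function.update_self, Function.iterate_succ_apply']
    · have hm2 : m ∈ l := by
        rcases List.mem_cons.1 hm with h2 | h2
        · exact absurd h2 h
        · exact h2
      rw [ih hm2 hl.2, Function.update_of_ne (Ne.symm h), pd_iter_comm _ _ _ (fold_contDiff α hf l)]

lemma mpd_upd {n : ℕ} (α : Fin n → ℕ) {f : Euc n → ℂ} (hf : ContDiff ℝ (⊤ : ℕ∞) f) (m : Fin n) :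
    mpd (Function.update α m (α m + 1)) f = pd m (mpd α f) :=
  fold_upd_mem α hf m _ (List.mem_finRange m) (List.nodup_finRange n)

lemma mpd_zero {n : ℕ} (f : Euc n → ℂ) : mpd (0 : Fin n → ℕ) f = f := by
  unfold mpd
  generalize List.finRange n = l
  induction l with
  | nil => rfl
  | cons a l ih => rw [List.foldr_cons, ih]; rfl

lemma coord_deriv {n : ℕ} {g : Euc n → ℂ} (hg : ContDiff ℝ (⊤ : ℕ∞) g) (m : Fin n) (ξ : Fin n → ℝ) :
    HasDerivAt (fun t => g (WithLp.toLp 2 (Function.update ξ m t))) (pd m g (WithLp.toLp 2 ξ)) (ξ m) := by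
  have e : ∀ t, (WithLp.toLp 2 (Function.update ξ m t) : Euc n) = WithLp.toLp 2 ξ + (t - ξ m) • EuclideanSpace.single m (1:ℝ) := by
    intro t
    ext i
    by_cases h : i = m
    · subst h; simp
    · simp [h]
  simp_rw [e]
  have h1 : HasDerivAt (fun t : ℝ => (WithLp.toLp 2 ξ : Euc n) + (t - ξ m) • EuclideanSpace.single m (1:ℝ)) (EuclideanSpace.single m (1:ℝ)) (ξ m) := by
    have := (((hasDerivAt_id (ξ m)).sub_const (ξ m)).smul_const (EuclideanSpace.single m (1:ℝ) : Euc n)).const_add (WithLp.toLp 2 ξ : Euc n)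
    simpa using this
  have h2 : HasFDerivAt g (fderiv ℝ g (WithLp.toLp 2 ξ)) ((WithLp.toLp 2 ξ : Euc n) + (ξ m - ξ m) • EuclideanSpace.single m (1:ℝ)) := by
    rw [sub_self, zero_smul, add_zero]
    exact ((hg.differentiable (by simp)) _).hasFDerivAt
  exact h2.comp_hasDerivAt (ξ m) h1

lemma jb_ge {n : ℕ} (ξ : Euc n) : 1 ≤ jb ξ := by
  unfold jb
  rw [Real.one_le_sqrt]
  nlinarith [sq_nonneg ‖ξ‖]

lemma mult_kernel {n : ℕ} {Λ : Fin n → Euc n → ℝ} (hΛ : IsWeightVector Λ) {p : Euc n → ℂ} (hsm : ContDiff ℝ (⊤ : ℕ∞) p)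
    (hbd : ∀ α : Fin n → ℕ, ∃ c > (0:ℝ), ∀ ξ, ‖mpd α p ξ‖ ≤ c * (∏ k, Λ k ξ ^ α k)⁻¹) :
    ∃ B : ℝ, 0 ≤ B ∧ (∀ ξ, ‖p ξ‖ ≤ B) ∧
      ∀ s x : Fin n → ℝ, ‖∫ ξ : Fin n → ℝ, EX x ξ * ((ET s ξ : ℝ) * p (WithLp.toLp 2 ξ))‖ ≤ B * ∏ i, kk (s i) (x i) := by
  obtain ⟨hc, hpos, C0, c0, hC0, hc0, hPG, hM, -⟩ := hΛ
  choose c hc hb using hbd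
  have hlow : ∀ k ξ, c0 ≤ Λ k ξ := by
    intro k ξ
    refine le_trans ?_ (hPG k ξ).1
    have := Real.one_le_rpow (jb_ge ξ) hc0.le
    nlinarith
  have hA : ∀ α : Fin n → ℕ, ∀ ξ, ‖mpd α p ξ‖ ≤ c α * (∏ k, c0 ^ α k)⁻¹ := by
    intro α ξ
    refine (hb α ξ).trans ?_
    have : 0 < ∏ k, c0 ^ α k := Finset.prod_pos fun k _ => by positivity
    refine mul_le_mul_of_nonneg_left ?_ (hc α).le
    refine inv_anti₀ this ?_
    exact Finset.prod_le_prod (fun k _ => by positivity) fun k _ => pow_le_pow_left₀ hc0.le (hlow k ξ) _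
  have hD : ∀ α : Fin n → ℕ, ∀ ξ : Fin n → ℝ, (∏ i, |ξ i| ^ (α i)) * ‖mpd α p (WithLp.toLp 2 ξ)‖ ≤ c α * (∏ k, c0 ^ α k)⁻¹ := by
    intro α ξ
    have h0 : 0 < ∏ k, c0 ^ α k := Finset.prod_pos fun k _ => by positivity
    have h1 : 0 < ∏ k, Λ k (WithLp.toLp 2 ξ) ^ α k := Finset.prod_pos fun k _ => pow_pos (hpos _ _) _
    have h2 : (∏ k, c0 ^ α k) * (∏ i, |ξ i| ^ (α i)) ≤ ∏ k, Λ k (WithLp.toLp 2 ξ) ^ α k := by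
      rw [← Finset.prod_mul_distrib]
      refine Finset.prod_le_prod (fun k _ => by positivity) fun k _ => ?_
      rw [← mul_pow]
      exact pow_le_pow_left₀ (by positivity) (hM k (WithLp.toLp 2 ξ)) _
    have h3 : 0 ≤ ∏ i, |ξ i| ^ (α i) := Finset.prod_nonneg fun k _ => by positivity
    calc (∏ i, |ξ i| ^ (α i)) * ‖mpd α p (WithLp.toLp 2 ξ)‖ ≤ (∏ i, |ξ i| ^ (α i)) * (c α * (∏ k, Λ k (WithLp.toLp 2 ξ) ^ α k)⁻¹) :=
          mul_le_mul_of_nonneg_left (hb α _) h3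
      _ = c α * ((∏ i, |ξ i| ^ (α i)) / (∏ k, Λ k (WithLp.toLp 2 ξ) ^ α k)) := by rw [div_eq_mul_inv]; ring
      _ ≤ c α * (∏ k, c0 ^ α k)⁻¹ := by
          refine mul_le_mul_of_nonneg_left ?_ (hc α).le
          rw [div_le_iff₀ h1, ← div_eq_inv_mul, le_div_iff₀ h0, mul_comm]
          exact h2
  set D : (Fin n → ℕ) → ℝ := fun α => c α * (∏ k, c0 ^ α k)⁻¹ with hDdef
  have hD0 : ∀ α, 0 ≤ D α := by
    intro α
    have h0 : 0 < ∏ k, c0 ^ α k := Finset.prod_pos fun k _ => by positivity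
    have := hc α
    simp only [hDdef]; positivity
  set B : ℝ := ∑ β : Fin n → Fin 3, D (fun i => (β i : ℕ)) with hB
  have hBα : ∀ α : Fin n → ℕ, (∀ i, α i ≤ 2) → D α ≤ B := by
    intro α hα
    have := Finset.single_le_sum (f := fun β : Fin n → Fin 3 => D (fun i => (β i : ℕ))) (fun β _ => hD0 _)
      (Finset.mem_univ (fun i => (⟨α i, by have := hα i; omega⟩ : Fin 3)))
    exact this
  have hB0 : 0 ≤ B := Finset.sum_nonneg fun β _ => hD0 _
  have hcont : ∀ α, Continuous (fun ξ : Fin n → ℝ => mpd α p (WithLp.toLp 2 ξ)) := fun α =>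
    (mpd_contDiff α hsm).continuous.comp (PiLp.continuous_toLp 2 _)
  have key := kernel_multi n (B := B) (P := fun α ξ => mpd α p (WithLp.toLp 2 ξ)) hB0 hcont
    (fun α => ⟨D α, fun ξ => hA α _⟩) (fun α hα ξ => (hD α ξ).trans (hBα α hα))
    (fun α m ξ => by
      rw [mpd_upd α hsm m]
      exact coord_deriv (mpd_contDiff α hsm) m ξ)
  refine ⟨max B (Chm ^ n * B), hB0.trans (le_max_left _ _), fun ξ => ?_, fun s x => ?_⟩
  · have := (hA 0 ξ).trans (hBα 0 (by simp))
    rw [mpd_zero] at this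
    exact this.trans (le_max_left _ _)
  · have h := key s x
    simp only [mpd_zero] at h
    refine h.trans (mul_le_mul_of_nonneg_right (le_max_right _ _) (Finset.prod_nonneg fun i _ => kk_nonneg _ _))

end PdCalc

section Repro

/-- Fourier multiplier of `qk` -/
def qh (r : ℝ) : ℝ := Real.exp (-r ^ 2) - Real.exp (-(2 * r ^ 2))

lemma qh_cont : Continuous qh := by unfold qh; fun_prop

lemma gk_fourier (c : NNReal) (hc : c ≠ 0) (s ξ : ℝ) :
    ∫ y, (gk c s y : ℂ) * Complex.exp (Complex.I * ((y * ξ : ℝ) : ℂ)) = ((Real.exp (-((c:ℝ) / 2 * ((2:ℝ) ^ s * ξ) ^ 2)) : ℝ) : ℂ) := by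
  have hv : c * Vr s ≠ 0 := mul_ne_zero hc (Vr_pos s).ne'
  have h1 := ProbabilityTheory.charFun_gaussianReal (μ := 0) (v := c * Vr s) ξ
  rw [charFun_apply_real, ProbabilityTheory.integral_gaussianReal_eq_integral_smul hv] at h1
  have e : (2:ℝ) ^ s * (2:ℝ) ^ s = (4:ℝ) ^ s := by
    rw [← Real.mul_rpow (by norm_num) (by norm_num)]; norm_num
  have h2 : (((c * Vr s : NNReal) : ℝ)) * ξ ^ 2 / 2 = (c:ℝ) / 2 * ((2:ℝ) ^ s * ξ) ^ 2 := by
    rw [NNReal.coe_mul, Vr_coe, ← e]; ring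
  rw [← h2]
  calc _ = ∫ y, ProbabilityTheory.gaussianPDFReal 0 (c * Vr s) y • Complex.exp (↑ξ * ↑y * Complex.I) := by
        refine integral_congr_ae (Filter.Eventually.of_forall fun y => ?_)
        simp only [gk, Complex.real_smul]
        congr 2
        push_cast; ring
    _ = _ := by
        rw [h1]
        push_cast
        congr 1
        ring

lemma qk_fourier (s ξ : ℝ) :
    ∫ y, (qk s y : ℂ) * Complex.exp (Complex.I * ((y * ξ : ℝ) : ℂ)) = ((qh ((2:ℝ) ^ s * ξ) : ℝ) : ℂ) := by
  have hi : ∀ c : NNReal, Integrable (fun y => (gk c s y : ℂ) * Complex.exp (Complex.I * ((y * ξ : ℝ) : ℂ))) := by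
    intro c
    refine ((gk_integrable c s).ofReal (𝕜 := ℂ)).mul_bdd (c := 1) (by fun_prop) (Filter.Eventually.of_forall fun y => ?_)
    rw [mul_comm, Complex.norm_exp_ofReal_mul_I]
  unfold qk
  simp only [Complex.ofReal_sub, sub_mul]
  rw [integral_sub (hi 2) (hi 4), gk_fourier 2 (by norm_num), gk_fourier 4 (by norm_num), ← Complex.ofReal_sub]
  unfold qh
  congr 3 <;> norm_num

/-- product multiplier -/
def QH {n : ℕ} (s ξ : Fin n → ℝ) : ℝ := ∏ i, qh ((2:ℝ) ^ (s i) * ξ i)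

lemma QH_neg {n : ℕ} (s ξ : Fin n → ℝ) : QH s (-ξ) = QH s ξ := by
  unfold QH qh; simp

lemma EX_add {n : ℕ} (x y ξ : Fin n → ℝ) : EX (x + y) ξ = EX x ξ * EX y ξ := by
  unfold EX
  rw [← Complex.exp_add, ← mul_add, ← Complex.ofReal_add, ← Finset.sum_add_distrib]
  simp [add_mul]
lemma EX_neg {n : ℕ} (x ξ : Fin n → ℝ) : EX (-x) ξ = EX x (-ξ) := by
  unfold EX; simp
lemma EX_zero {n : ℕ} (ξ : Fin n → ℝ) : EX (0 : Fin n → ℝ) ξ = 1 := by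
  unfold EX; simp
lemma EX_mul_neg {n : ℕ} (x ξ : Fin n → ℝ) : EX x ξ * EX (-x) ξ = 1 := by
  rw [← EX_add]; simp [EX_zero]
lemma EX_prod {n : ℕ} (x ξ : Fin n → ℝ) : EX x ξ = ∏ i, Complex.exp (Complex.I * ((x i * ξ i : ℝ) : ℂ)) := by
  unfold EX
  rw [← Complex.exp_sum, Complex.ofReal_sum, Finset.mul_sum]

lemma QK_fourier {n : ℕ} (s ξ : Fin n → ℝ) :
    ∫ y : Fin n → ℝ, ((∏ i, qk (s i) (y i) : ℝ) : ℂ) * EX y ξ = (QH s ξ : ℂ) := by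
  have : ∀ y : Fin n → ℝ, ((∏ i, qk (s i) (y i) : ℝ) : ℂ) * EX y ξ =
      ∏ i, ((qk (s i) (y i) : ℂ) * Complex.exp (Complex.I * ((y i * ξ i : ℝ) : ℂ))) := by
    intro y
    rw [EX_prod, Finset.prod_mul_distrib, Complex.ofReal_prod]
  simp_rw [this]
  rw [integral_fintype_prod_volume_eq_prod (𝕜 := ℂ) (fun i t => (qk (s i) t : ℂ) * Complex.exp (Complex.I * ((t * ξ i : ℝ) : ℂ)))]
  simp_rw [qk_fourier]
  unfold QH
  rw [Complex.ofReal_prod]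

/-- (inverse) Fourier integral -/
def GI {n : ℕ} (f : (Fin n → ℝ) → ℂ) (ξ : Fin n → ℝ) : ℂ := ∫ x, EX x ξ * f x

lemma EX_mul_integrable {n : ℕ} {f : (Fin n → ℝ) → ℂ} (hf : Integrable f) (ξ : Fin n → ℝ) :
    Integrable (fun x => EX x ξ * f x) := by
  refine hf.bdd_mul (c := 1) (Continuous.aestronglyMeasurable (by unfold EX; fun_prop)) (Filter.Eventually.of_forall fun y => ?_)
  rw [EX_norm]

lemma GI_norm_le {n : ℕ} (f : (Fin n → ℝ) → ℂ) (ξ : Fin n → ℝ) : ‖GI f ξ‖ ≤ ∫ x, ‖f x‖ := by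
  unfold GI
  refine (norm_integral_le_integral_norm _).trans (le_of_eq ?_)
  simp only [norm_mul, EX_norm, one_mul]

lemma GI_meas {n : ℕ} {f : (Fin n → ℝ) → ℂ} (hf : Measurable f) : Measurable (GI f) := by
  unfold GI
  have h1 := (EX_cont (n := n)).measurable
  have h2 : Measurable (fun p : (Fin n → ℝ) × (Fin n → ℝ) => EX p.2 p.1 * f p.2) := by
    have := h1.comp (measurable_swap (α := Fin n → ℝ) (β := Fin n → ℝ))
    exact this.mul (hf.comp measurable_snd)
  exact h2.stronglyMeasurable.integral_prod_right'.measurable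

lemma QN_prod_integrable {n : ℕ} (s : Fin n → ℝ) {f : (Fin n → ℝ) → ℂ} (hf : Integrable f) :
    Integrable (fun p : (Fin n → ℝ) × (Fin n → ℝ) => ((∏ i, qk (s i) (p.2 i) : ℝ) : ℂ) * f (p.1 + p.2)) := by
  have h1 : Integrable (fun y : Fin n → ℝ => ((∏ i, qk (s i) (y i) : ℝ) : ℂ)) :=
    (tprod_integrable (κ := fun i => qk (s i)) fun i => qk_integrable (s i)).ofReal
  have h2 := hf.mul_prod h1
  have h3 := (measurePreserving_add_prod (volume : Measure (Fin n → ℝ)) (volume : Measure (Fin n → ℝ))).integrable_comp_of_integrable h2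
  refine h3.congr (Filter.Eventually.of_forall fun p => ?_)
  simp only [Function.comp]
  rw [mul_comm]

lemma QN_eq {n : ℕ} (s : Fin n → ℝ) (f : (Fin n → ℝ) → ℂ) (x : Fin n → ℝ) :
    QN s f x = ∫ y : Fin n → ℝ, ((∏ i, qk (s i) (y i) : ℝ) : ℂ) * f (x + y) := by
  unfold QN tconv
  simp only [Complex.real_smul]

lemma QN_integrable {n : ℕ} (s : Fin n → ℝ) {f : (Fin n → ℝ) → ℂ} (hf : Integrable f) :
    Integrable (QN s f) := by
  refine (QN_prod_integrable s hf).integral_prod_left.congr (Filter.Eventually.of_forall fun x => ?_)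
  simp only [QN_eq]

lemma GI_QN {n : ℕ} (s : Fin n → ℝ) {f : (Fin n → ℝ) → ℂ} (hf : Integrable f) (ξ : Fin n → ℝ) :
    GI (QN s f) ξ = QH s ξ * GI f ξ := by
  unfold GI
  have hI : Integrable (Function.uncurry fun x y : Fin n → ℝ => EX x ξ * (((∏ i, qk (s i) (y i) : ℝ) : ℂ) * f (x + y))) (volume.prod volume) := by
    have h1 := QN_prod_integrable s hf
    rw [Measure.volume_eq_prod] at h1
    have h2 : Continuous (fun p : (Fin n → ℝ) × (Fin n → ℝ) => EX p.1 ξ) := by unfold EX; fun_prop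
    have h3 := h1.bdd_mul (c := 1) (f := fun p : (Fin n → ℝ) × (Fin n → ℝ) => EX p.1 ξ) h2.aestronglyMeasurable
      (Filter.Eventually.of_forall fun p => (EX_norm _ _).le)
    exact h3
  calc ∫ x, EX x ξ * QN s f x = ∫ x, ∫ y, EX x ξ * (((∏ i, qk (s i) (y i) : ℝ) : ℂ) * f (x + y)) := by
        refine integral_congr_ae (Filter.Eventually.of_forall fun x => ?_)
        simp only [QN_eq, integral_const_mul]
    _ = ∫ y, ∫ x, EX x ξ * (((∏ i, qk (s i) (y i) : ℝ) : ℂ) * f (x + y)) := integral_integral_swap hI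
    _ = ∫ y, (((∏ i, qk (s i) (y i) : ℝ) : ℂ) * EX y (-ξ)) * ∫ x, EX x ξ * f x := by
        refine integral_congr_ae (Filter.Eventually.of_forall fun y => ?_)
        simp only
        rw [← integral_add_right_eq_self (fun x => EX x ξ * f x) y, ← integral_const_mul]
        refine integral_congr_ae (Filter.Eventually.of_forall fun x => ?_)
        simp only
        rw [EX_add, ← EX_neg]
        linear_combination (-(EX x ξ * ((∏ i, qk (s i) (y i) : ℝ) : ℂ) * f (x + y))) * EX_mul_neg y ξ
    _ = _ := by
        rw [integral_mul_const, QK_fourier, QH_neg]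

end Repro

section ReproB

/-- one-dimensional reproducing weight -/
def wr (r : ℝ) : ℝ := qh r ^ 2 * eta r
lemma wr_cont : Continuous wr := by
  have := qh_cont
  have := eta_cont
  unfold wr; fun_prop
lemma wr_nonneg (r : ℝ) : 0 ≤ wr r := mul_nonneg (sq_nonneg _) (eta_nonneg _)
lemma wr_neg (r : ℝ) : wr (-r) = wr r := by unfold wr qh eta; simp
lemma wr_abs (r : ℝ) : wr |r| = wr r := by
  rcases abs_choice r with h | h <;> rw [h]
  exact wr_neg r

lemma wr_pos {r : ℝ} (hr : 0 < r) : 0 < wr r := by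
  unfold wr eta qh
  have : Real.exp (-(2 * r ^ 2)) < Real.exp (-r ^ 2) := by
    apply Real.exp_lt_exp.2; nlinarith [sq_pos_of_pos hr]
  have h := sub_pos.2 this
  positivity

lemma wr_le_eta (r : ℝ) : wr r ≤ eta r := by
  have h1 : Real.exp (-r ^ 2) ≤ 1 := Real.exp_le_one_iff.2 (by nlinarith [sq_nonneg r])
  have h2 : Real.exp (-(2 * r ^ 2)) ≤ 1 := Real.exp_le_one_iff.2 (by nlinarith [sq_nonneg r])
  have h3 := Real.exp_pos (-r ^ 2)
  have h4 := Real.exp_pos (-(2 * r ^ 2))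
  have h5 : qh r ^ 2 ≤ 1 := by unfold qh; rw [sq_le_one_iff_abs_le_one, abs_le]; constructor <;> linarith
  unfold wr
  nlinarith [eta_nonneg r]

lemma eta_exp_le (s : ℝ) : eta ((2:ℝ) ^ s) ≤ 16 * (1 + s ^ 2)⁻¹ := by
  set u : ℝ := (4:ℝ) ^ s with hu
  have hu0 : 0 < u := by positivity
  have e : ((2:ℝ) ^ s) ^ 2 = u := by
    rw [sq, ← Real.mul_rpow (by norm_num) (by norm_num)]; norm_num [hu]
  unfold eta
  rw [e]
  have hl : 1 ≤ Real.log 4 := by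
    rw [Real.le_log_iff_exp_le (by norm_num)]
    have := Real.exp_one_lt_d9; linarith
  have hE : ∀ x : ℝ, 0 ≤ x → 1 + x ^ 2 / 2 ≤ Real.exp x := by
    intro x hx
    have := Real.quadratic_le_exp_of_nonneg hx
    linarith
  have hs : ∀ t : ℝ, 0 ≤ t → 1 + t ^ 2 ≤ 2 * (4:ℝ) ^ t := by
    intro t ht
    have h1 := hE (Real.log 4 * t) (by positivity)
    rw [← Real.rpow_def_of_pos (by norm_num)] at h1
    have : t ^ 2 ≤ (Real.log 4 * t) ^ 2 := by
      apply pow_le_pow_left₀ ht; nlinarith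
    linarith
  rw [← div_eq_mul_inv, le_div_iff₀ (by positivity)]
  have hexp1 : Real.exp (-(1/2) * u) ≤ 1 := Real.exp_le_one_iff.2 (by linarith)
  have hexp0 := Real.exp_pos (-(1/2) * u)
  rcases le_total 0 s with h | h
  · have h1 := hs s h
    have h2 := hE (1/2 * u) (by positivity)
    have h3 : Real.exp (-(1/2) * u) * Real.exp (1/2 * u) = 1 := by rw [← Real.exp_add]; simp
    have h4 : Real.exp (-(1/2) * u) * (u ^ 2 / 8) ≤ 1 := by
      refine (mul_le_mul_of_nonneg_left (show u ^ 2 / 8 ≤ Real.exp (1/2 * u) by nlinarith) hexp0.le).trans h3.le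
    calc u * Real.exp (-(1/2) * u) * (1 + s ^ 2) ≤ u * Real.exp (-(1/2) * u) * (2 * u) :=
          mul_le_mul_of_nonneg_left h1 (by positivity)
      _ = 16 * (Real.exp (-(1/2) * u) * (u ^ 2 / 8)) := by ring
      _ ≤ 16 := by linarith
  · have h1 := hs (-s) (by linarith)
    rw [Real.rpow_neg (by norm_num), ← hu] at h1
    calc u * Real.exp (-(1/2) * u) * (1 + s ^ 2) ≤ u * 1 * (2 * u⁻¹) := by
          apply mul_le_mul _ _ (by positivity) (by positivity)
          · exact mul_le_mul_of_nonneg_left hexp1 hu0.le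
          · simpa using h1
      _ = 2 := by field_simp
      _ ≤ 16 := by norm_num

lemma wr_exp_integrable : Integrable (fun s : ℝ => wr ((2:ℝ) ^ s)) := by
  refine (integrable_inv_one_add_sq.const_mul 16).mono' ?_ (Filter.Eventually.of_forall fun s => ?_)
  · have h : Continuous (fun s : ℝ => (2:ℝ) ^ s) := Real.continuous_const_rpow (by norm_num)
    exact (wr_cont.comp h).aestronglyMeasurable
  · rw [Real.norm_of_nonneg (wr_nonneg _)]
    exact (wr_le_eta _).trans (eta_exp_le s)

/-- reproducing constant -/
def c00 : ℝ := ∫ s : ℝ, wr ((2:ℝ) ^ s)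

lemma c00_pos : 0 < c00 := by
  unfold c00
  rw [integral_pos_iff_support_of_nonneg (fun s => wr_nonneg _) wr_exp_integrable]
  have : Function.support (fun s : ℝ => wr ((2:ℝ) ^ s)) = Set.univ := by
    ext s; simp only [Function.mem_support, Set.mem_univ, iff_true]
    exact (wr_pos (by positivity)).ne'
  rw [this]; simp

lemma wr_shift {ξ : ℝ} (hξ : ξ ≠ 0) (s : ℝ) : wr ((2:ℝ) ^ s * ξ) = wr ((2:ℝ) ^ (s + Real.logb 2 |ξ|)) := by
  rw [Real.rpow_add (by norm_num), Real.rpow_logb (by norm_num) (by norm_num) (abs_pos.2 hξ), ← wr_abs ((2:ℝ) ^ s * ξ), abs_mul,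
    abs_of_pos (show (0:ℝ) < 2 ^ s by positivity)]

lemma wr_integrable {ξ : ℝ} (hξ : ξ ≠ 0) : Integrable (fun s : ℝ => wr ((2:ℝ) ^ s * ξ)) := by
  simp_rw [wr_shift hξ]
  exact wr_exp_integrable.comp_add_right _

lemma wr_integral {ξ : ℝ} (hξ : ξ ≠ 0) : ∫ s : ℝ, wr ((2:ℝ) ^ s * ξ) = c00 := by
  simp_rw [wr_shift hξ]
  exact integral_add_right_eq_self (fun s : ℝ => wr ((2:ℝ) ^ s)) _

/-- product reproducing weight -/
def WR {n : ℕ} (s ξ : Fin n → ℝ) : ℝ := ∏ i, wr ((2:ℝ) ^ (s i) * ξ i)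

lemma WR_eq {n : ℕ} (s ξ : Fin n → ℝ) : WR s ξ = QH s ξ * QH s ξ * ET s ξ := by
  unfold WR QH ET wr
  rw [← Finset.prod_mul_distrib, ← Finset.prod_mul_distrib]
  simp only [sq]
lemma WR_nonneg {n : ℕ} (s ξ : Fin n → ℝ) : 0 ≤ WR s ξ := Finset.prod_nonneg fun i _ => wr_nonneg _
lemma WR_cont {n : ℕ} : Continuous (fun p : (Fin n → ℝ) × (Fin n → ℝ) => WR p.2 p.1) := by
  unfold WR
  refine continuous_finset_prod _ fun i _ => wr_cont.comp ?_
  refine Continuous.mul ?_ (by fun_prop)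
  exact (Real.continuous_const_rpow (by norm_num)).comp (by fun_prop : Continuous fun p : (Fin n → ℝ) × (Fin n → ℝ) => p.2 i)
lemma WR_integrable {n : ℕ} {ξ : Fin n → ℝ} (hξ : ∀ i, ξ i ≠ 0) : Integrable (fun s => WR s ξ) :=
  tprod_integrable (κ := fun i t => wr ((2:ℝ) ^ t * ξ i)) fun i => wr_integrable (hξ i)
lemma WR_integral {n : ℕ} {ξ : Fin n → ℝ} (hξ : ∀ i, ξ i ≠ 0) : ∫ s, WR s ξ = c00 ^ n := by
  unfold WR
  rw [integral_fintype_prod_volume_eq_prod (𝕜 := ℝ) (fun i t => wr ((2:ℝ) ^ t * ξ i))]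
  simp_rw [wr_integral (hξ _)]
  simp

lemma ae_coord_ne {n : ℕ} : ∀ᵐ ξ : Fin n → ℝ, ∀ i, ξ i ≠ 0 := by
  rw [ae_all_iff]
  intro i
  rw [ae_iff]
  simp only [ne_eq, not_not]
  rw [volume_pi]
  exact Measure.pi_hyperplane _ i 0

lemma repro_integrable {n : ℕ} {H : (Fin n → ℝ) → ℂ} (hH : Integrable H) :
    Integrable (Function.uncurry fun ξ s : Fin n → ℝ => (WR s ξ : ℂ) * H ξ) (volume.prod volume) := by
  have hm : AEStronglyMeasurable (Function.uncurry fun ξ s : Fin n → ℝ => (WR s ξ : ℂ) * H ξ) (volume.prod volume) := by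
    have h1 : Continuous (fun p : (Fin n → ℝ) × (Fin n → ℝ) => (WR p.2 p.1 : ℂ)) := Complex.continuous_ofReal.comp WR_cont
    exact h1.aestronglyMeasurable.mul hH.aestronglyMeasurable.comp_fst
  rw [integrable_prod_iff hm]
  constructor
  · filter_upwards [ae_coord_ne] with ξ hξ
    exact ((WR_integrable hξ).ofReal (𝕜 := ℂ)).mul_const (H ξ)
  · refine (hH.norm.const_mul (c00 ^ n)).congr ?_
    filter_upwards [ae_coord_ne] with ξ hξ
    simp only [Function.uncurry, norm_mul, Complex.norm_real]
    rw [integral_mul_const]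
    simp only [Real.norm_of_nonneg (WR_nonneg _ _)]
    rw [WR_integral hξ]

lemma repro {n : ℕ} {H : (Fin n → ℝ) → ℂ} (hH : Integrable H) :
    ((c00 ^ n : ℝ) : ℂ) * ∫ ξ, H ξ = ∫ s : Fin n → ℝ, ∫ ξ, (WR s ξ : ℂ) * H ξ := by
  rw [← integral_integral_swap (repro_integrable hH), ← integral_const_mul]
  refine integral_congr_ae ?_
  filter_upwards [ae_coord_ne] with ξ hξ
  rw [integral_mul_const, integral_complex_ofReal, WR_integral hξ]

/-- inner kernel identity -/
lemma inner_formula {n : ℕ} {m : (Fin n → ℝ) → ℂ} (hm : Integrable m)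
    {F G : (Fin n → ℝ) → ℂ} (hF : Integrable F) (hG : Integrable G) :
    ∫ ξ, m ξ * (GI F (-ξ) * GI G ξ) = ∫ x, ∫ z, (∫ ξ, EX (x - z) ξ * m ξ) * (F z * G x) := by
  have hI : Integrable (Function.uncurry fun (ξ : Fin n → ℝ) (p : (Fin n → ℝ) × (Fin n → ℝ)) =>
      EX (p.1 - p.2) ξ * (m ξ * (G p.1 * F p.2))) (volume.prod (volume.prod volume)) := by
    have h1 := hm.mul_prod (hG.mul_prod hF)
    have h2 : Continuous (fun p : (Fin n → ℝ) × ((Fin n → ℝ) × (Fin n → ℝ)) => EX (p.2.1 - p.2.2) p.1) := by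
      unfold EX; fun_prop
    have h3 := h1.bdd_mul (c := 1) h2.aestronglyMeasurable
      (Filter.Eventually.of_forall fun p => (EX_norm _ _).le)
    exact h3
  have e1 : ∀ ξ, m ξ * (GI F (-ξ) * GI G ξ) = ∫ p : (Fin n → ℝ) × (Fin n → ℝ), EX (p.1 - p.2) ξ * (m ξ * (G p.1 * F p.2)) ∂(volume.prod volume) := by
    intro ξ
    unfold GI
    rw [mul_comm (∫ x, EX x (-ξ) * F x), ← integral_prod_mul, ← integral_const_mul]
    refine integral_congr_ae (Filter.Eventually.of_forall fun p => ?_)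
    simp only
    rw [sub_eq_add_neg, EX_add, EX_neg]
    ring
  simp_rw [e1]
  have hJ : Integrable (fun y : (Fin n → ℝ) × (Fin n → ℝ) => ∫ ξ, EX (y.1 - y.2) ξ * (m ξ * (G y.1 * F y.2))) (volume.prod volume) :=
    hI.swap.integral_prod_left
  rw [integral_integral_swap hI, integral_prod _ hJ]
  refine integral_congr_ae (Filter.Eventually.of_forall fun x => ?_)
  refine integral_congr_ae (Filter.Eventually.of_forall fun z => ?_)
  simp only
  rw [← integral_mul_const]
  refine integral_congr_ae (Filter.Eventually.of_forall fun ξ => ?_)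
  simp only
  ring

end ReproB

section Bilin

/-- the unnormalised multiplier operator on `Fin n → ℝ` -/
def TM {n : ℕ} (P : (Fin n → ℝ) → ℂ) (f : (Fin n → ℝ) → ℂ) (x : Fin n → ℝ) : ℂ :=
  ∫ ξ, EX x ξ * (P ξ * GI f (-ξ))

variable {n : ℕ} {P f g : (Fin n → ℝ) → ℂ} {B : ℝ}

lemma PG_integrable (hP : Continuous P) (hB : ∀ ξ, ‖P ξ‖ ≤ B) (hF : Integrable (fun ξ => GI f (-ξ))) :
    Integrable (fun ξ => P ξ * GI f (-ξ)) :=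
  hF.bdd_mul hP.aestronglyMeasurable (Filter.Eventually.of_forall hB)

lemma TM_bdd (hB : ∀ ξ, ‖P ξ‖ ≤ B) (hF : Integrable (fun ξ => GI f (-ξ))) (x : Fin n → ℝ) :
    ‖TM P f x‖ ≤ B * ∫ ξ, ‖GI f (-ξ)‖ := by
  unfold TM
  rw [← integral_const_mul]
  refine norm_integral_le_of_norm_le (hF.norm.const_mul B) (Filter.Eventually.of_forall fun ξ => ?_)
  rw [norm_mul, norm_mul, EX_norm, one_mul]
  exact mul_le_mul_of_nonneg_right (hB ξ) (norm_nonneg _)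

lemma TM_meas (hP : Continuous P) (hf : Measurable f) : Measurable (TM P f) := by
  unfold TM
  have h1 := (EX_cont (n := n)).measurable
  have h3 : Measurable (fun ξ : Fin n → ℝ => P ξ * GI f (-ξ)) := hP.measurable.mul ((GI_meas hf).comp measurable_neg)
  have h2 : Measurable (fun p : (Fin n → ℝ) × (Fin n → ℝ) => EX p.1 p.2 * (P p.2 * GI f (-p.2))) :=
    h1.mul (h3.comp measurable_snd)
  exact h2.stronglyMeasurable.integral_prod_right'.measurable

lemma TM_pair (hP : Continuous P) (hB : ∀ ξ, ‖P ξ‖ ≤ B) (hF : Integrable (fun ξ => GI f (-ξ))) (hg : Integrable g) :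
    ∫ x, TM P f x * g x = ∫ ξ, P ξ * GI f (-ξ) * GI g ξ := by
  have hI : Integrable (Function.uncurry fun (x ξ : Fin n → ℝ) => EX x ξ * (g x * (P ξ * GI f (-ξ)))) (volume.prod volume) := by
    have h1 := hg.mul_prod (PG_integrable hP hB hF)
    have h3 := h1.bdd_mul (c := 1) (EX_cont (n := n)).aestronglyMeasurable
      (Filter.Eventually.of_forall fun p => (EX_norm _ _).le)
    exact h3
  calc ∫ x, TM P f x * g x = ∫ x, ∫ ξ, EX x ξ * (g x * (P ξ * GI f (-ξ))) := by
        refine integral_congr_ae (Filter.Eventually.of_forall fun x => ?_)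
        simp only [TM]
        rw [← integral_mul_const]
        refine integral_congr_ae (Filter.Eventually.of_forall fun ξ => ?_)
        simp only; ring
    _ = ∫ ξ, ∫ x, EX x ξ * (g x * (P ξ * GI f (-ξ))) := integral_integral_swap hI
    _ = _ := by
        refine integral_congr_ae (Filter.Eventually.of_forall fun ξ => ?_)
        change _ = P ξ * GI f (-ξ) * ∫ x, EX x ξ * g x
        rw [← integral_const_mul]
        refine integral_congr_ae (Filter.Eventually.of_forall fun x => ?_)
        simp only; ring

lemma bilin (hP : Continuous P) (hB0 : 0 ≤ B) (hB : ∀ ξ, ‖P ξ‖ ≤ B)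
    (hK : ∀ s x : Fin n → ℝ, ‖∫ ξ : Fin n → ℝ, EX x ξ * ((ET s ξ : ℝ) * P ξ)‖ ≤ B * ∏ i, kk (s i) (x i))
    (hfm : Measurable f) (hgm : Measurable g)
    (hf : Integrable f) (hF : Integrable (fun ξ => GI f (-ξ))) (hg : Integrable g) :
    ENNReal.ofReal (c00 ^ n) * ‖∫ x, TM P f x * g x‖ₑ ≤ ENNReal.ofReal B * Bf f g := by
  have hH : Integrable (fun ξ => P ξ * GI f (-ξ) * GI g ξ) :=
    (PG_integrable hP hB hF).mul_bdd (c := ∫ x, ‖g x‖) (GI_meas hgm).aestronglyMeasurable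
      (Filter.Eventually.of_forall fun ξ => GI_norm_le g ξ)
  have e0 : ENNReal.ofReal (c00 ^ n) * ‖∫ x, TM P f x * g x‖ₑ = ‖∫ s : Fin n → ℝ, ∫ ξ, (WR s ξ : ℂ) * (P ξ * GI f (-ξ) * GI g ξ)‖ₑ := by
    rw [← repro hH, TM_pair hP hB hF hg, enorm_mul, ← ofReal_norm (((c00 ^ n : ℝ) : ℂ)), Complex.norm_real,
      Real.norm_of_nonneg (pow_nonneg c00_pos.le n)]
  rw [e0]
  refine (enorm_integral_le_lintegral_enorm _).trans ?_
  unfold Bf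
  rw [← lintegral_const_mul' _ _ ENNReal.ofReal_ne_top]
  refine lintegral_mono fun s => ?_
  have hm : Integrable (fun ξ => ((ET s ξ : ℝ) : ℂ) * P ξ) :=
    ((ET_integrable s).ofReal (𝕜 := ℂ)).mul_bdd hP.aestronglyMeasurable (Filter.Eventually.of_forall hB)
  have e1 : ∫ ξ, (WR s ξ : ℂ) * (P ξ * GI f (-ξ) * GI g ξ) =
      ∫ x, ∫ z, (∫ ξ, EX (x - z) ξ * (((ET s ξ : ℝ) : ℂ) * P ξ)) * (QN s f z * QN s g x) := by
    rw [← inner_formula hm (QN_integrable s hf) (QN_integrable s hg)]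
    refine integral_congr_ae (Filter.Eventually.of_forall fun ξ => ?_)
    simp only
    rw [GI_QN s hf, GI_QN s hg, WR_eq, QH_neg]
    push_cast; ring
  simp only
  rw [e1]
  refine (enorm_integral_le_lintegral_enorm _).trans ?_
  rw [← lintegral_const_mul' _ _ ENNReal.ofReal_ne_top]
  refine lintegral_mono fun x => ?_
  refine (enorm_integral_le_lintegral_enorm _).trans ?_
  rw [← lintegral_const_mul' _ _ ENNReal.ofReal_ne_top,
    ← lintegral_add_left_eq_self (μ := (volume : Measure (Fin n → ℝ))) _ x]
  refine lintegral_mono fun y => ?_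
  rw [enorm_mul, enorm_mul, ← mul_assoc (ENNReal.ofReal B)]
  refine mul_le_mul' ?_ le_rfl
  have h := hK s (x - (x + y))
  have e2 : x - (x + y) = -y := by abel
  rw [e2] at h ⊢
  rw [← KP_neg]
  unfold KP
  rw [← ENNReal.ofReal_prod_of_nonneg (fun i _ => kk_nonneg _ _), ← ENNReal.ofReal_mul hB0, ← ofReal_norm]
  exact ENNReal.ofReal_le_ofReal h

end Bilin

section Concl

/-- dual function -/
def dg {n : ℕ} (q : ℝ) (E : Set (Fin n → ℝ)) (T : (Fin n → ℝ) → ℂ) (x : Fin n → ℝ) : ℂ :=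
  E.indicator (fun x => (starRingEnd ℂ) (T x) * ((‖T x‖ ^ (q - 2) : ℝ) : ℂ)) x

variable {n : ℕ} {q : ℝ} {E : Set (Fin n → ℝ)} {T : (Fin n → ℝ) → ℂ}

lemma dg_meas (hE : MeasurableSet E) (hT : Measurable T) : Measurable (dg q E T) := by
  unfold dg
  refine Measurable.indicator ?_ hE
  have h1 : Measurable (fun x => (starRingEnd ℂ) (T x)) := Complex.continuous_conj.measurable.comp hT
  exact h1.mul (Complex.measurable_ofReal.comp (hT.norm.pow_const _))

lemma dg_norm (hq : 1 < q) (x : Fin n → ℝ) : ‖dg q E T x‖ = E.indicator (fun x => ‖T x‖ ^ (q - 1)) x := by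
  unfold dg
  by_cases hx : x ∈ E
  · rw [Set.indicator_of_mem hx, Set.indicator_of_mem hx, norm_mul, RCLike.norm_conj, Complex.norm_real,
      Real.norm_of_nonneg (by positivity)]
    rcases eq_or_ne ‖T x‖ 0 with h | h
    · rw [h, Real.zero_rpow (by linarith : q - 1 ≠ 0), zero_mul]
    · have h0 : 0 < ‖T x‖ := lt_of_le_of_ne (norm_nonneg _) (Ne.symm h)
      have : q - 1 = 1 + (q - 2) := by ring
      rw [this, Real.rpow_add h0, Real.rpow_one]
  · rw [Set.indicator_of_notMem hx, Set.indicator_of_notMem hx, norm_zero]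

lemma dg_mul (hq : 1 < q) (x : Fin n → ℝ) : T x * dg q E T x = ((E.indicator (fun x => ‖T x‖ ^ q) x : ℝ) : ℂ) := by
  unfold dg
  by_cases hx : x ∈ E
  · rw [Set.indicator_of_mem hx, Set.indicator_of_mem hx, ← mul_assoc, Complex.mul_conj, Complex.normSq_eq_norm_sq,
      ← Complex.ofReal_mul]
    congr 1
    rcases eq_or_ne ‖T x‖ 0 with h | h
    · rw [h, Real.zero_rpow (by linarith : q ≠ 0)]; simp
    · have h0 : 0 < ‖T x‖ := lt_of_le_of_ne (norm_nonneg _) (Ne.symm h)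
      have : q = 2 + (q - 2) := by ring
      nth_rewrite 2 [this]
      rw [Real.rpow_add h0, Real.rpow_two]
  · rw [Set.indicator_of_notMem hx, Set.indicator_of_notMem hx, mul_zero, Complex.ofReal_zero]

lemma dg_bdd (hq : 1 < q) {M : ℝ} (hM : ∀ x, ‖T x‖ ≤ M) (x : Fin n → ℝ) : ‖dg q E T x‖ ≤ M ^ (q - 1) := by
  have hM0 : 0 ≤ M := (norm_nonneg _).trans (hM x)
  rw [dg_norm hq]
  by_cases hx : x ∈ E
  swap
  · rw [Set.indicator_of_notMem hx]; positivity
  rw [Set.indicator_of_mem hx]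
  exact Real.rpow_le_rpow (norm_nonneg _) (hM x) (by linarith)

lemma dg_lint (hq : 1 < q) (hE : MeasurableSet E) {r : ℝ} (hr : 0 < r) :
    ∫⁻ x, ‖dg q E T x‖ₑ ^ r = ∫⁻ x in E, ‖T x‖ₑ ^ ((q - 1) * r) := by
  rw [← lintegral_indicator hE]
  refine lintegral_congr fun x => ?_
  rw [← ofReal_norm, dg_norm hq]
  by_cases hx : x ∈ E
  · rw [Set.indicator_of_mem hx, Set.indicator_of_mem hx, ENNReal.rpow_mul, ← ofReal_norm, ENNReal.ofReal_rpow_of_nonneg (norm_nonneg _) (by linarith)]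
  · rw [Set.indicator_of_notMem hx, Set.indicator_of_notMem hx, ENNReal.ofReal_zero, ENNReal.zero_rpow_of_pos hr]

lemma lintE_fin (hEf : volume E ≠ ⊤) {M : ℝ} (hM : ∀ x, ‖T x‖ ≤ M) {r : ℝ} (hr : 0 ≤ r) :
    ∫⁻ x in E, ‖T x‖ₑ ^ r ≠ ⊤ := by
  refine ne_top_of_le_ne_top (b := ENNReal.ofReal M ^ r * volume E) (ENNReal.mul_ne_top (ENNReal.rpow_ne_top_of_nonneg hr ENNReal.ofReal_ne_top) hEf) ?_
  rw [← setLIntegral_const]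
  refine lintegral_mono fun x => ENNReal.rpow_le_rpow ?_ hr
  rw [← ofReal_norm]; exact ENNReal.ofReal_le_ofReal (hM x)

lemma dg_integrable (hq : 1 < q) (hE : MeasurableSet E) (hEf : volume E ≠ ⊤) (hT : Measurable T) {M : ℝ} (hM : ∀ x, ‖T x‖ ≤ M) :
    Integrable (dg q E T) := by
  refine ⟨(dg_meas hE hT).aestronglyMeasurable, ?_⟩
  rw [hasFiniteIntegral_iff_enorm, lt_top_iff_ne_top]
  have := dg_lint (T := T) hq hE (r := 1) one_pos
  simp only [ENNReal.rpow_one] at this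
  rw [this]
  exact lintE_fin hEf hM (by linarith)

lemma dg_pair (hq : 1 < q) (hE : MeasurableSet E) (hEf : volume E ≠ ⊤) (hT : Measurable T) {M : ℝ} (hM : ∀ x, ‖T x‖ ≤ M) :
    ‖∫ x, T x * dg q E T x‖ₑ = ∫⁻ x in E, ‖T x‖ₑ ^ q := by
  have hi : Integrable (fun x => E.indicator (fun x => ‖T x‖ ^ q) x) := by
    have := ((dg_integrable hq hE hEf hT hM).bdd_mul hT.aestronglyMeasurable (Filter.Eventually.of_forall hM)).norm
    refine this.congr (Filter.Eventually.of_forall fun x => ?_)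
    simp only
    rw [dg_mul hq, Complex.norm_real, Real.norm_of_nonneg]
    exact Set.indicator_nonneg (fun x _ => by positivity) x
  have hn : ∀ x, 0 ≤ E.indicator (fun x => ‖T x‖ ^ q) x := fun x => Set.indicator_nonneg (fun x _ => by positivity) x
  simp_rw [dg_mul hq]
  rw [integral_complex_ofReal, ← ofReal_norm, Complex.norm_real, Real.norm_of_nonneg (integral_nonneg hn),
    ofReal_integral_eq_lintegral_ofReal hi (Filter.Eventually.of_forall hn), ← lintegral_indicator hE]
  refine lintegral_congr fun x => ?_
  by_cases hx : x ∈ E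
  · rw [Set.indicator_of_mem hx, Set.indicator_of_mem hx, ← ofReal_norm, ENNReal.ofReal_rpow_of_nonneg (norm_nonneg _) (by linarith)]
  · rw [Set.indicator_of_notMem hx, Set.indicator_of_notMem hx, ENNReal.ofReal_zero]

lemma absorb {a A K X : ENNReal} (hq : 1 < q) (ha0 : a ≠ 0) (ha : a ≠ ⊤) (hA : A ≠ ⊤) (h : a * A ≤ K * (X * A ^ (1 - 1 / q))) :
    A ≤ (a⁻¹ * K * X) ^ q := by
  rcases eq_or_ne A 0 with h0 | h0
  · rw [h0]; exact zero_le
  have hq0 : 0 < q := by linarith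
  have h1 : A ^ (1 - 1 / q) ≠ 0 := by
    intro hh; rw [ENNReal.rpow_eq_zero_iff] at hh
    rcases hh with hh | hh
    · exact h0 hh.1
    · exact hA hh.1
  have h2 : A ^ (1 - 1 / q) ≠ ⊤ := by
    refine ENNReal.rpow_ne_top_of_nonneg ?_ hA
    rw [sub_nonneg, div_le_one hq0]; exact hq.le
  have e : A = A ^ (1 / q) * A ^ (1 - 1 / q) := by
    rw [← ENNReal.rpow_add _ _ h0 hA]; simp
  have h3 : A ≤ a⁻¹ * (K * (X * A ^ (1 - 1 / q))) := by
    rwa [mul_comm, ← div_eq_mul_inv, ENNReal.le_div_iff_mul_le (Or.inl ha0) (Or.inl ha), mul_comm]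
  have h4 : A ^ (1 / q) * A ^ (1 - 1 / q) ≤ (a⁻¹ * K * X) * A ^ (1 - 1 / q) := by
    rw [← e]; refine h3.trans (le_of_eq (by ring))
  have h5 : A ^ (1 / q) ≤ a⁻¹ * K * X := (ENNReal.mul_le_mul_iff_left h1 h2).1 h4
  calc A = (A ^ (1 / q)) ^ q := by rw [← ENNReal.rpow_mul, one_div, inv_mul_cancel₀ hq0.ne', ENNReal.rpow_one]
    _ ≤ _ := ENNReal.rpow_le_rpow h5 hq0.le

lemma exhaust {h : (Fin n → ℝ) → ENNReal} {X : ENNReal}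
    (H : ∀ k : ℕ, ∫⁻ x in Metric.closedBall (0 : Fin n → ℝ) k, h x ≤ X) : ∫⁻ x, h x ≤ X := by
  have hU : (⋃ k : ℕ, Metric.closedBall (0 : Fin n → ℝ) k) = Set.univ := Metric.iUnion_closedBall_nat 0
  rw [← setLIntegral_univ, ← hU, setLIntegral_iUnion_of_directed]
  · exact iSup_le H
  · refine (monotone_nat_of_le_succ fun k => Metric.closedBall_subset_closedBall (by push_cast; linarith)).directed_le

lemma mult_bound {P : (Fin n → ℝ) → ℂ} {B : ℝ} (hq : 1 < q) (hP : Continuous P) (hB0 : 0 ≤ B) (hB : ∀ ξ, ‖P ξ‖ ≤ B)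
    (hK : ∀ s x : Fin n → ℝ, ‖∫ ξ : Fin n → ℝ, EX x ξ * ((ET s ξ : ℝ) * P ξ)‖ ≤ B * ∏ i, kk (s i) (x i)) :
    ∃ K : ENNReal, K ≠ ⊤ ∧ ∀ {f : (Fin n → ℝ) → ℂ} {R : ℝ} (_ : Measurable f) (_ : ∀ x, ‖f x‖ ≤ R) (_ : Integrable f)
      (_ : Integrable (fun ξ => GI f (-ξ))) (_ : ∫⁻ x, ‖f x‖ₑ ^ (2:ℝ) ≠ ⊤) (_ : ∫⁻ x, ‖f x‖ₑ ^ q ≠ ⊤),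
      ∫⁻ x, ‖TM P f x‖ₑ ^ q ≤ (K * (∫⁻ x, ‖f x‖ₑ ^ q) ^ (1 / q)) ^ q := by
  obtain ⟨C, hC, H⟩ := Bf_Lq (n := n) hq
  have hc : ENNReal.ofReal (c00 ^ n) ≠ 0 := by
    rw [ne_eq, ENNReal.ofReal_eq_zero, not_le]; exact pow_pos c00_pos n
  refine ⟨(ENNReal.ofReal (c00 ^ n))⁻¹ * (ENNReal.ofReal B * C), ENNReal.mul_ne_top (ENNReal.inv_ne_top.2 hc) (ENNReal.mul_ne_top ENNReal.ofReal_ne_top hC), ?_⟩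
  intro f R hfm hfR hf hF hf2 hfq
  refine exhaust fun k => ?_
  set E := Metric.closedBall (0 : Fin n → ℝ) k with hEdef
  have hE : MeasurableSet E := measurableSet_closedBall
  have hEf : volume E ≠ ⊤ := measure_closedBall_lt_top.ne
  have hT := TM_meas hP hfm
  set M := B * ∫ ξ, ‖GI f (-ξ)‖ with hMdef
  have hM : ∀ x, ‖TM P f x‖ ≤ M := TM_bdd hB hF
  set g := dg q E (TM P f) with hgdef
  have hgm : Measurable g := dg_meas hE hT
  have hg : Integrable g := dg_integrable hq hE hEf hT hM
  have hq1 : 0 < q - 1 := by linarith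
  have h1 := bilin hP hB0 hB hK hfm hgm hf hF hg
  have e1 : ∫⁻ x, ‖g x‖ₑ ^ (q / (q - 1)) = ∫⁻ x in E, ‖TM P f x‖ₑ ^ q := by
    rw [hgdef, dg_lint hq hE (by positivity), mul_div_cancel₀ _ hq1.ne']
  have hA : ∫⁻ x in E, ‖TM P f x‖ₑ ^ q ≠ ⊤ := lintE_fin hEf hM (by linarith)
  have h2 := H (R := max R (M ^ (q - 1))) hfm (fun x => (hfR x).trans (le_max_left _ _)) hgm
    (fun x => (dg_bdd hq hM x).trans (le_max_right _ _)) hf2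
    (by rw [hgdef, dg_lint hq hE (by positivity)]; exact lintE_fin hEf hM (by linarith)) hfq (by rw [e1]; exact hA)
  rw [e1] at h2
  rw [dg_pair hq hE hEf hT hM] at h1
  refine absorb hq hc ENNReal.ofReal_ne_top hA (h1.trans ?_)
  refine (mul_le_mul' le_rfl h2).trans (le_of_eq (by ring))

end Concl

section Transfer

lemma toLp_emb {n : ℕ} : MeasurableEmbedding (WithLp.toLp 2 : (Fin n → ℝ) → Euc n) :=
  (MeasurableEquiv.toLp 2 (Fin n → ℝ)).measurableEmbedding

lemma int_toLp {n : ℕ} (h : Euc n → ℂ) : ∫ x : Euc n, h x = ∫ x : Fin n → ℝ, h (WithLp.toLp 2 x) :=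
  ((PiLp.volume_preserving_toLp (Fin n)).integral_comp toLp_emb h).symm

lemma lint_toLp {n : ℕ} (h : Euc n → ENNReal) : ∫⁻ x : Euc n, h x = ∫⁻ x : Fin n → ℝ, h (WithLp.toLp 2 x) :=
  ((PiLp.volume_preserving_toLp (Fin n)).lintegral_comp_emb toLp_emb h).symm

lemma EX_inner {n : ℕ} (x ξ : Fin n → ℝ) :
    Complex.exp (Complex.I * ((⟪(WithLp.toLp 2 x : Euc n), (WithLp.toLp 2 ξ : Euc n)⟫ : ℝ) : ℂ)) = EX x ξ := by
  unfold EX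
  congr 3
  rw [PiLp.inner_apply]
  simp [mul_comm]

lemma FT_toLp {n : ℕ} (u : Euc n → ℂ) (ξ : Fin n → ℝ) :
    ∫ y : Euc n, Complex.exp (-(Complex.I * ((⟪y, (WithLp.toLp 2 ξ : Euc n)⟫ : ℝ) : ℂ))) * u y = GI (fun x => u (WithLp.toLp 2 x)) (-ξ) := by
  rw [int_toLp]
  unfold GI
  refine integral_congr_ae (Filter.Eventually.of_forall fun y => ?_)
  simp only
  rw [← EX_inner, WithLp.toLp_neg, inner_neg_right, Complex.ofReal_neg, mul_neg]

lemma fm_eq {n : ℕ} (p u : Euc n → ℂ) (x : Fin n → ℝ) :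
    fourierMult p u (WithLp.toLp 2 x) = (((2 * Real.pi) ^ n : ℝ)⁻¹ : ℂ) *
      TM (fun ξ => p (WithLp.toLp 2 ξ)) (fun x => u (WithLp.toLp 2 x)) x := by
  unfold fourierMult TM
  congr 1
  rw [int_toLp]
  refine integral_congr_ae (Filter.Eventually.of_forall fun ξ => ?_)
  simp only
  rw [FT_toLp, EX_inner, mul_assoc]

lemma FT_integrable {n : ℕ} (u : SchwartzMap (Euc n) ℂ) : Integrable (fun ξ : Fin n → ℝ => GI (fun x => u (WithLp.toLp 2 x)) (-ξ)) := by
  have h1 : Integrable (fun ξ : Euc n => FourierTransform.fourier (u : Euc n → ℂ) ((2 * Real.pi)⁻¹ • ξ)) := by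
    have h := (FourierTransform.fourier u).integrable (μ := volume)
    rw [SchwartzMap.fourier_coe] at h
    exact h.comp_smul (by positivity)
  have h2 := (PiLp.volume_preserving_toLp (Fin n)).integrable_comp_of_integrable h1
  refine h2.congr (Filter.Eventually.of_forall fun ξ => ?_)
  simp only [Function.comp]
  rw [← FT_toLp, Real.fourier_eq']
  refine integral_congr_ae (Filter.Eventually.of_forall fun y => ?_)
  simp only [smul_eq_mul]
  congr 2
  rw [inner_smul_right]
  have : -2 * Real.pi * ((2 * Real.pi)⁻¹ * inner ℝ y (WithLp.toLp 2 ξ : Euc n)) = - inner ℝ y (WithLp.toLp 2 ξ : Euc n) := by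
    field_simp
  rw [this]
  push_cast; ring

lemma sch_lint {n : ℕ} (u : SchwartzMap (Euc n) ℂ) {r : ℝ} (hr : 0 < r) :
    ∫⁻ x : Fin n → ℝ, ‖u (WithLp.toLp 2 x)‖ₑ ^ r ≠ ⊤ := by
  rw [← lint_toLp (fun x => ‖u x‖ₑ ^ r)]
  have h := lintegral_rpow_enorm_lt_top_of_eLpNorm_lt_top (p := ENNReal.ofReal r) (by simpa using hr) ENNReal.ofReal_ne_top
    (u.memLp (ENNReal.ofReal r) volume).2
  rw [ENNReal.toReal_ofReal hr.le] at h
  exact h.ne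

end Transfer


/-- zero-order Fourier multipliers are `L^q` bounded, `1 < q < ∞`. -/
theorem stmt_10 {n : ℕ} (Λ : Fin n → Euc n → ℝ) (hΛ : IsWeightVector Λ)
    (p : Euc n → ℂ) (hsm : ContDiff ℝ (⊤ : ℕ∞) p)
    (hbd : ∀ α : Fin n → ℕ, ∃ c > (0:ℝ), ∀ ξ,
      ‖mpd α p ξ‖ ≤ c * (∏ k, Λ k ξ ^ α k)⁻¹)
    (q : ℝ) (hq : 1 < q) :
    ∃ C > (0:ℝ), ∀ u : SchwartzMap (Euc n) ℂ,
      eLpNorm (fourierMult p (fun x => u x)) (ENNReal.ofReal q) volume ≤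
        ENNReal.ofReal C * eLpNorm (fun x => u x) (ENNReal.ofReal q) volume := by
  obtain ⟨B, hB0, hB, hK⟩ := mult_kernel hΛ hsm hbd
  have hP : Continuous (fun ξ : Fin n → ℝ => p (WithLp.toLp 2 ξ)) := hsm.continuous.comp (PiLp.continuous_toLp 2 _)
  obtain ⟨K, hKt, H⟩ := mult_bound (n := n) hq hP hB0 (fun ξ => hB _) hK
  have hq0 : 0 < q := by linarith
  set κ : ENNReal := ‖(((2 * Real.pi) ^ n : ℝ)⁻¹ : ℂ)‖ₑ with hκ
  have hκt : κ ≠ ⊤ := enorm_ne_top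
  refine ⟨(κ * K).toReal + 1, by positivity, fun u => ?_⟩
  have hle : κ * K ≤ ENNReal.ofReal ((κ * K).toReal + 1) := by
    rw [ENNReal.le_ofReal_iff_toReal_le (ENNReal.mul_ne_top hκt hKt) (by positivity)]
    linarith
  have hc : Continuous (fun x : Fin n → ℝ => u (WithLp.toLp 2 x)) := u.continuous.comp (PiLp.continuous_toLp 2 _)
  obtain ⟨R, hR⟩ : ∃ R : ℝ, ∀ x, ‖u x‖ ≤ R := ⟨_, fun x => u.norm_le_seminorm ℝ x⟩
  have hi : Integrable (fun x : Fin n → ℝ => u (WithLp.toLp 2 x)) :=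
    (PiLp.volume_preserving_toLp (Fin n)).integrable_comp_of_integrable (u.integrable (μ := volume))
  have h := H hc.measurable (fun x => hR _) hi (FT_integrable u) (sch_lint u two_pos) (sch_lint u hq0)
  have hp0 : ENNReal.ofReal q ≠ 0 := by simpa using hq0
  rw [eLpNorm_eq_lintegral_rpow_enorm_toReal hp0 ENNReal.ofReal_ne_top, eLpNorm_eq_lintegral_rpow_enorm_toReal hp0 ENNReal.ofReal_ne_top,
    ENNReal.toReal_ofReal hq0.le, lint_toLp, lint_toLp]
  refine le_trans ?_ (mul_le_mul' hle le_rfl)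
  simp_rw [fm_eq, enorm_mul, ENNReal.mul_rpow_of_nonneg _ _ hq0.le]
  rw [lintegral_const_mul' _ _ (ENNReal.rpow_ne_top_of_nonneg hq0.le hκt), ENNReal.mul_rpow_of_nonneg _ _ (by positivity), ← ENNReal.rpow_mul,
    mul_one_div_cancel hq0.ne', ENNReal.rpow_one, mul_assoc]
  refine mul_le_mul' le_rfl ?_
  refine (ENNReal.rpow_le_rpow h (by positivity)).trans (le_of_eq ?_)
  rw [← ENNReal.rpow_mul, mul_one_div_cancel hq0.ne', ENNReal.rpow_one]

end
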